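/- Reverse Hölder inequality for k = 2 with general H (estimate (AB') in the proof of Theorem 1.6 for classical solutions). Let n ≥ 3, Ω ⊆ ℝⁿ a domain, f : Ω×ℝ×ℝⁿ → ℝ positive and C^{1,1}_loc, and H : Ω×ℝ×ℝⁿ → Sym_n(ℝ) C^{1,1}_loc. Fix concentric balls with closure(B_{2R}) ⊂ Ω and M > 0, and set β := 3n/(3n−4). Then there is a constant C, depending only on n, R, f, H and M, such that for every u ∈ C²(Ω) satisfying σ_2(A_H[u]) = f(x,u,∇u)² and λ(A_H[u]) ∈ Γ_2^+ on Ω, every constant C₁ ∈ [0,M] with Δu + C₁ ≥ 1 and |∇²u| ≤ Δu + C₁ pointwise on B_{2R}, and with sup_{B_{2R}}(|u|+|∇u|) ≤ M and ∫_{B_{2R}}(Δu+C₁)^{3n/2} ≤ M, one has for all q > 3n/2 − 2 and all ρ ∈ (0,R/3]: (∫_{B_{R+ρ}} (Δu+C₁)^{βq})^{1/β} ≤ (Cq/ρ²) ∫_{B_{R+3ρ}} (Δu+C₁)^{q+2}. -/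

import Mathlib

open MeasureTheory Metric Set Matrix

noncomputable section

/-- The `k`-th elementary symmetric polynomial of the eigenvalues of an `n × n` real
matrix, defined via the coefficients of the characteristic polynomial. -/
def esymmMat {n : ℕ} (k : ℕ) (A : Matrix (Fin n) (Fin n) ℝ) : ℝ :=
  (-1 : ℝ) ^ k * A.charpoly.coeff (n - k)

/-- `λ(A) ∈ Γ_k^+`, i.e. `σ_j(A) > 0` for all `1 ≤ j ≤ k`. -/
def GammaPlus {n : ℕ} (k : ℕ) (A : Matrix (Fin n) (Fin n) ℝ) : Prop :=
  ∀ j : ℕ, 1 ≤ j → j ≤ k → 0 < esymmMat j A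

/-- The Newton tensors `T_0(A) = I`, `T_j(A) = σ_j(A) I - T_{j-1}(A) A`. -/
def newtonT {n : ℕ} : ℕ → Matrix (Fin n) (Fin n) ℝ → Matrix (Fin n) (Fin n) ℝ
  | 0, _ => 1
  | (j + 1), A => esymmMat (j + 1) A • (1 : Matrix (Fin n) (Fin n) ℝ) - newtonT j A * A

/-- `i`-th partial derivative. -/
def pd {n : ℕ} (i : Fin n) (w : (Fin n → ℝ) → ℝ) (x : Fin n → ℝ) : ℝ :=
  fderiv ℝ w x (Pi.single i 1)

/-- Gradient as a vector. -/
def grad {n : ℕ} (w : (Fin n → ℝ) → ℝ) (x : Fin n → ℝ) : Fin n → ℝ :=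
  fun i => pd i w x

/-- Hessian matrix. -/
def hess {n : ℕ} (w : (Fin n → ℝ) → ℝ) (x : Fin n → ℝ) : Matrix (Fin n) (Fin n) ℝ :=
  Matrix.of fun i j => pd i (pd j w) x

/-- Squared Euclidean norm of a vector. -/
def normSq {n : ℕ} (ξ : Fin n → ℝ) : ℝ := ∑ i, ξ i ^ 2

/-- Euclidean norm of a vector. -/
def vnorm {n : ℕ} (ξ : Fin n → ℝ) : ℝ := Real.sqrt (∑ i, ξ i ^ 2)

/-- Operator norm of a matrix, viewed as a linear map between Euclidean spaces. -/
def matNorm {n : ℕ} (M : Matrix (Fin n) (Fin n) ℝ) : ℝ :=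
  ‖LinearMap.toContinuousLinearMap (Matrix.toEuclideanLin M)‖

/-- Laplacian. -/
def lapl {n : ℕ} (w : (Fin n → ℝ) → ℝ) (x : Fin n → ℝ) : ℝ := ∑ l, pd l (pd l w) x

/-- `W^{2,p}` norm (with classical derivatives) on a set. -/
def W2pNorm {n : ℕ} (p : ℝ) (w : (Fin n → ℝ) → ℝ) (B : Set (Fin n → ℝ)) : ℝ :=
  (∫ x in B, (|w x| ^ p + vnorm (grad w x) ^ p + matNorm (hess w x) ^ p)) ^ (1 / p)

/-- `C^{1,1}_loc` on a set: continuously differentiable with locally Lipschitz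
first derivatives. -/
def C11On {E F : Type*} [NormedAddCommGroup E] [NormedSpace ℝ E]
    [NormedAddCommGroup F] [NormedSpace ℝ F] (f : E → F) (s : Set E) : Prop :=
  ContDiffOn ℝ 1 f s ∧
    ∀ x ∈ s, ∃ (K : NNReal) (t : Set E), t ∈ nhdsWithin x s ∧
      LipschitzOnWith K (fderivWithin ℝ f s) t

/-- First order difference quotient `∇_l^h`. -/
def dq {n : ℕ} (l : Fin n) (h : ℝ) (w : (Fin n → ℝ) → ℝ) (x : Fin n → ℝ) : ℝ :=
  (w (x + h • (Pi.single l 1 : Fin n → ℝ)) - w x) / h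

/-- Second order difference quotient `Δ_{ll}^h`. -/
def ddq {n : ℕ} (l : Fin n) (h : ℝ) (w : (Fin n → ℝ) → ℝ) (x : Fin n → ℝ) : ℝ :=
  (w (x + h • (Pi.single l 1 : Fin n → ℝ)) - 2 * w x + w (x - h • (Pi.single l 1 : Fin n → ℝ))) / h ^ 2

/-- `L^s` seminorm (as an extended real number) of a function on a set. -/
def lpN {n : ℕ} (s : ℝ) (w : (Fin n → ℝ) → ℝ) (S : Set (Fin n → ℝ)) : ENNReal :=
  (∫⁻ x in S, ENNReal.ofReal (|w x| ^ s)) ^ (1 / s)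

end


open MeasureTheory Metric Set Matrix

theorem multiset_esymm_two (s : Multiset ℝ) :
    s.sum ^ 2 = (s.map (fun a => a ^ 2)).sum + 2 * s.esymm 2 := by
  induction s using Multiset.induction with
  | empty => simp [Multiset.esymm, Multiset.powersetCard_zero_right]
  | cons a s ih =>
    have h1 : s.esymm 1 = s.sum := by
      simp [Multiset.esymm, Multiset.powersetCard_one]
    have h2 : (a ::ₘ s).esymm 2 = s.esymm 2 + a * s.esymm 1 := by
      simp only [Multiset.esymm, Multiset.powersetCard_cons, Multiset.map_add, Multiset.sum_add,
        Multiset.map_map, Function.comp_def, Multiset.prod_cons]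
      rw [Multiset.sum_map_mul_left]
    rw [h2, h1, Multiset.sum_cons, Multiset.map_cons, Multiset.sum_cons]
    nlinarith

theorem esymmMat_one {n : ℕ} (hn : 3 ≤ n) (A : Matrix (Fin n) (Fin n) ℝ) :
    esymmMat 1 A = ∑ i, A i i := by
  have : Nonempty (Fin n) := ⟨⟨0, by omega⟩⟩
  have := Matrix.trace_eq_neg_charpoly_coeff A
  simp only [Fintype.card_fin] at this
  simp only [esymmMat]
  rw [Matrix.trace] at this
  simp only [Matrix.diag] at this
  rw [this]; ring

theorem esymmMat_two {n : ℕ} (hn : 3 ≤ n) (A : Matrix (Fin n) (Fin n) ℝ)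
    (hA : ∀ i j, A i j = A j i) :
    2 * esymmMat 2 A = (∑ i, A i i) ^ 2 - ∑ i, ∑ j, A i j ^ 2 := by
  have hH : A.IsHermitian := by
    ext i j; simp [hA i j]
  set s : Multiset ℝ := Finset.univ.val.map hH.eigenvalues with hs
  have hc : A.charpoly = (s.map (fun a => Polynomial.X - Polynomial.C a)).prod := by
    rw [hH.charpoly_eq, hs, Multiset.map_map]; rfl
  have hcard : Multiset.card s = n := by simp [hs]
  have hco : A.charpoly.coeff (n - 2) = s.esymm 2 := by
    rw [hc, Multiset.prod_X_sub_C_coeff s (by omega), hcard]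
    rw [show n - (n - 2) = 2 by omega]; simp
  have htr : ∑ i, A i i = s.sum := by
    have := hH.trace_eq_sum_eigenvalues
    simp only [Matrix.trace, Matrix.diag] at this
    rw [this, hs]; simp [List.sum_ofFn]
  have hsq : ∑ i, ∑ j, A i j ^ 2 = (s.map (fun a => a ^ 2)).sum := by
    have h1 : ∑ i, ∑ j, A i j ^ 2 = (A * A).trace := by
      simp only [Matrix.trace, Matrix.diag, Matrix.mul_apply]
      refine Finset.sum_congr rfl fun i _ => Finset.sum_congr rfl fun j _ => ?_
      rw [hA j i, sq]
    rw [h1]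
    have h2 := hH.spectral_theorem
    rw [Unitary.conjStarAlgAut_apply] at h2
    conv_lhs => rw [h2]
    set U : Matrix (Fin n) (Fin n) ℝ := (hH.eigenvectorUnitary : Matrix (Fin n) (Fin n) ℝ) with hU
    have hUU : star U * U = 1 := Unitary.coe_star_mul_self hH.eigenvectorUnitary
    set D : Matrix (Fin n) (Fin n) ℝ := diagonal (RCLike.ofReal ∘ hH.eigenvalues)
    have : (U * D * star U) * (U * D * star U) = U * (D * D * star U) := by
      calc (U * D * star U) * (U * D * star U) = U * D * (star U * U) * D * star U := by
            simp only [mul_assoc]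
        _ = _ := by rw [hUU]; simp only [mul_assoc, mul_one]
    have h3 : ((U * D * star U) * (U * D * star U)).trace = (D * D).trace := by
      rw [this, Matrix.trace_mul_comm, mul_assoc, hUU, mul_one]
    refine Eq.trans ?_ (h3.trans ?_)
    · rfl
    · simp [D, hs, Matrix.trace, sq, List.sum_ofFn]
  rw [htr, hsq, multiset_esymm_two, esymmMat, hco]; ring

/-- Frobenius product of two arrays. -/
def fdot {n : ℕ} (A B : Fin n → Fin n → ℝ) : ℝ := ∑ i, ∑ j, A i j * B i j

/-- Trace of an array. -/
def ftr {n : ℕ} (A : Fin n → Fin n → ℝ) : ℝ := ∑ i, A i i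

theorem fdot_comm {n : ℕ} (A B : Fin n → Fin n → ℝ) : fdot A B = fdot B A := by
  simp [fdot, mul_comm]

theorem fdot_sub_left {n : ℕ} (A B D : Fin n → Fin n → ℝ) :
    fdot (fun i j => A i j - B i j) D = fdot A D - fdot B D := by
  simp [fdot, sub_mul]

theorem fdot_add_left {n : ℕ} (A B D : Fin n → Fin n → ℝ) :
    fdot (fun i j => A i j + B i j) D = fdot A D + fdot B D := by
  simp [fdot, add_mul, Finset.sum_add_distrib]

theorem fdot_smul_left {n : ℕ} (c : ℝ) (A D : Fin n → Fin n → ℝ) :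
    fdot (fun i j => c * A i j) D = c * fdot A D := by
  simp [fdot, mul_assoc, Finset.mul_sum]

theorem fdot_self_nonneg {n : ℕ} (A : Fin n → Fin n → ℝ) : 0 ≤ fdot A A :=
  Finset.sum_nonneg fun _ _ => Finset.sum_nonneg fun _ _ => mul_self_nonneg _

theorem fdot_cs {n : ℕ} (A B : Fin n → Fin n → ℝ) :
    fdot A B ^ 2 ≤ fdot A A * fdot B B := by
  have := Finset.sum_mul_sq_le_sq_mul_sq (Finset.univ : Finset (Fin n × Fin n))
    (fun p => A p.1 p.2) (fun p => B p.1 p.2)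
  simpa [fdot, Fintype.sum_prod_type, sq] using this

theorem fdot_sub_smul_sq {n : ℕ} (c : ℝ) (A B : Fin n → Fin n → ℝ) :
    fdot (fun i j => B i j - c * A i j) (fun i j => B i j - c * A i j)
      = fdot B B - 2 * c * fdot A B + c ^ 2 * fdot A A := by
  simp only [fdot, Finset.mul_sum, ← Finset.sum_sub_distrib, ← Finset.sum_add_distrib]
  exact Finset.sum_congr rfl fun i _ => Finset.sum_congr rfl fun j _ => by ring

/-- Quantitative reverse Cauchy--Schwarz. -/
theorem lorentz_deficit {n : ℕ} (A B : Fin n → Fin n → ℝ) {τ t g gl : ℝ} (hτ : 0 < τ)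
    (hg : 0 < g) (hA : τ ^ 2 - fdot A A = 2 * g) (hB : τ * t - fdot A B = gl) :
    fdot (fun i j => B i j - t / τ * A i j) (fun i j => B i j - t / τ * A i j)
      ≤ fdot B B - t ^ 2 + gl ^ 2 / (2 * g) := by
  rw [fdot_sub_smul_sq]
  have h1 : fdot A A = τ ^ 2 - 2 * g := by linarith
  have h2 : fdot A B = τ * t - gl := by linarith
  obtain ⟨c, hc⟩ : ∃ c, c = t / τ := ⟨_, rfl⟩
  have hct : t = c * τ := by rw [hc]; field_simp
  rw [h1, h2, ← hc]
  have h3 : 2 * c * gl - 2 * g * c ^ 2 ≤ gl ^ 2 / (2 * g) := by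
    rw [le_div_iff₀ (by positivity)]
    nlinarith [sq_nonneg (gl - 2 * g * c)]
  rw [hct]; nlinarith

/-- Lower ellipticity bound. -/
theorem newton_lower {n : ℕ} (A : Fin n → Fin n → ℝ) {τ g : ℝ} (hτ : 0 < τ)
    (hg : 0 < g) (hA : τ ^ 2 - fdot A A = 2 * g) (ξ : Fin n → ℝ) :
    g / τ * ∑ i, ξ i ^ 2 ≤ τ * ∑ i, ξ i ^ 2 - ∑ i, ∑ j, A i j * ξ i * ξ j := by
  set N := ∑ i, ξ i ^ 2 with hN
  have hN0 : 0 ≤ N := Finset.sum_nonneg fun _ _ => sq_nonneg _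
  have h1 := fdot_cs A (fun i j => ξ i * ξ j)
  have h2 : fdot (fun i j => ξ i * ξ j) (fun i j => ξ i * ξ j) = N ^ 2 := by
    simp only [fdot, hN, sq, Finset.sum_mul_sum]
    refine Finset.sum_congr rfl fun i _ => Finset.sum_congr rfl fun j _ => by ring
  have h3 : ∑ i, ∑ j, A i j * ξ i * ξ j = fdot A (fun i j => ξ i * ξ j) := by
    simp only [fdot, mul_assoc]
  rw [h3]
  rw [h2] at h1
  have hAA := fdot_self_nonneg A
  have hgt : 0 ≤ τ - g / τ := by
    rw [sub_nonneg, div_le_iff₀ hτ]; nlinarith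
  have h4 : fdot A A ≤ (τ - g / τ) ^ 2 := by
    have : g / τ * τ = g := by field_simp
    nlinarith [sq_nonneg (g / τ)]
  have h5 : fdot A (fun i j => ξ i * ξ j) ≤ (τ - g / τ) * N := by
    apply le_of_sq_le_sq _ (by positivity)
    rw [mul_pow]
    exact h1.trans (by gcongr)
  linarith

/-- Upper bound for the Newton tensor. -/
theorem newton_upper {n : ℕ} (A : Fin n → Fin n → ℝ) {τ g : ℝ} (hτ : 0 < τ)
    (hg : 0 < g) (hA : τ ^ 2 - fdot A A = 2 * g) (ξ : Fin n → ℝ) :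
    τ * ∑ i, ξ i ^ 2 - ∑ i, ∑ j, A i j * ξ i * ξ j ≤ 2 * τ * ∑ i, ξ i ^ 2 := by
  have := newton_lower (fun i j => - A i j) hτ hg (by simpa [fdot] using hA) ξ
  have hN0 : 0 ≤ ∑ i, ξ i ^ 2 := Finset.sum_nonneg fun _ _ => sq_nonneg _
  have h2 : 0 ≤ g / τ * ∑ i, ξ i ^ 2 := by positivity
  simp only [neg_mul, Finset.sum_neg_distrib] at this
  linarith

/-- Gårding type inequality. -/
theorem garding_two {n : ℕ} (A B : Fin n → Fin n → ℝ) {τ t f k : ℝ} (hτ : 0 < τ) (ht : 0 < t)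
    (hf : 0 < f) (hk : 0 < k)
    (hA : τ ^ 2 - fdot A A = 2 * f ^ 2) (hB : t ^ 2 - fdot B B = 2 * k ^ 2) :
    (τ - t) ^ 2 - fdot (fun i j => A i j - B i j) (fun i j => A i j - B i j) ≤ 2 * (f - k) ^ 2 := by
  have h1 := fdot_cs A B
  have h := fdot_sub_smul_sq 1 B A
  simp only [one_mul, one_pow] at h
  rw [h, fdot_comm B A]
  have hab : fdot A B ≤ τ * t - 2 * f * k := by
    have hAA := fdot_self_nonneg A
    have hBB := fdot_self_nonneg B
    have e1 : √2 * f ≤ τ := by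
      apply le_of_sq_le_sq _ hτ.le
      rw [mul_pow, Real.sq_sqrt (by norm_num)]; linarith
    have e2 : √2 * k ≤ t := by
      apply le_of_sq_le_sq _ ht.le
      rw [mul_pow, Real.sq_sqrt (by norm_num)]; linarith
    have e3 : 2 * f * k ≤ τ * t := by
      have := mul_le_mul e1 e2 (by positivity) hτ.le
      have h2 : √2 * √2 = 2 := Real.mul_self_sqrt (by norm_num)
      calc 2 * f * k = (√2 * √2) * (f * k) := by rw [h2]; ring
        _ = √2 * f * (√2 * k) := by ring
        _ ≤ _ := this
    apply le_of_sq_le_sq _ (by linarith)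
    refine h1.trans ?_
    have : fdot A A = τ ^ 2 - 2 * f ^ 2 := by linarith
    have : fdot B B = t ^ 2 - 2 * k ^ 2 := by linarith
    simp only [*]
    nlinarith [sq_nonneg (τ * k - t * f)]
  nlinarith

open MeasureTheory Metric Set Matrix

open scoped ContDiff

theorem pd_add {n : ℕ} {i : Fin n} {f g : (Fin n → ℝ) → ℝ} {x : Fin n → ℝ}
    (hf : DifferentiableAt ℝ f x) (hg : DifferentiableAt ℝ g x) :
    pd i (fun y => f y + g y) x = pd i f x + pd i g x := by
  simp only [pd]; rw [fderiv_fun_add hf hg]; rfl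

theorem pd_sub {n : ℕ} {i : Fin n} {f g : (Fin n → ℝ) → ℝ} {x : Fin n → ℝ}
    (hf : DifferentiableAt ℝ f x) (hg : DifferentiableAt ℝ g x) :
    pd i (fun y => f y - g y) x = pd i f x - pd i g x := by
  simp only [pd]; rw [fderiv_fun_sub hf hg]; rfl

theorem pd_mul {n : ℕ} {i : Fin n} {f g : (Fin n → ℝ) → ℝ} {x : Fin n → ℝ}
    (hf : DifferentiableAt ℝ f x) (hg : DifferentiableAt ℝ g x) :
    pd i (fun y => f y * g y) x = pd i f x * g x + f x * pd i g x := by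
  simp only [pd]; rw [fderiv_fun_mul hf hg]
  simp [mul_comm, add_comm]

theorem pd_const_mul {n : ℕ} {i : Fin n} {f : (Fin n → ℝ) → ℝ} {x : Fin n → ℝ} (c : ℝ)
    (hf : DifferentiableAt ℝ f x) :
    pd i (fun y => c * f y) x = c * pd i f x := by
  simp only [pd]; rw [fderiv_const_mul hf]; rfl

theorem pd_const {n : ℕ} {i : Fin n} {x : Fin n → ℝ} (c : ℝ) :
    pd i (fun _ => c) x = 0 := by
  simp [pd]

theorem pd_sum {n : ℕ} {ι : Type*} (s : Finset ι) {i : Fin n} {f : ι → (Fin n → ℝ) → ℝ}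
    {x : Fin n → ℝ} (hf : ∀ a ∈ s, DifferentiableAt ℝ (f a) x) :
    pd i (fun y => ∑ a ∈ s, f a y) x = ∑ a ∈ s, pd i (f a) x := by
  simp only [pd]; rw [fderiv_fun_sum hf]; simp

theorem pd_rpow {n : ℕ} {i : Fin n} {f : (Fin n → ℝ) → ℝ} {x : Fin n → ℝ} (s : ℝ)
    (hf : DifferentiableAt ℝ f x) (h0 : 0 < f x) :
    pd i (fun y => f y ^ s) x = s * (f x ^ s / f x) * pd i f x := by
  simp only [pd]
  rw [(hf.hasFDerivAt.rpow_const (Or.inl h0.ne')).fderiv]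
  simp [Real.rpow_sub h0]

theorem pd_congr_of_eventuallyEq {n : ℕ} {i : Fin n} {f g : (Fin n → ℝ) → ℝ} {x : Fin n → ℝ}
    (h : f =ᶠ[nhds x] g) : pd i f x = pd i g x := by
  simp only [pd]; rw [h.fderiv_eq]

theorem contDiff_pd {n : ℕ} {i : Fin n} {f : (Fin n → ℝ) → ℝ} {k m : WithTop ℕ∞}
    (hf : ContDiff ℝ m f) (h : k + 1 ≤ m) : ContDiff ℝ k (pd i f) :=
  (hf.fderiv_right h).clm_apply contDiff_const

theorem contDiff_pd_top {n : ℕ} {i : Fin n} {f : (Fin n → ℝ) → ℝ}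
    (hf : ContDiff ℝ ∞ f) : ContDiff ℝ ∞ (pd i f) :=
  contDiff_pd hf (by simp)

theorem pd_comm_at {n : ℕ} {i j : Fin n} {f : (Fin n → ℝ) → ℝ} {x : Fin n → ℝ}
    (hf : ContDiffAt ℝ 2 f x) : pd i (pd j f) x = pd j (pd i f) x := by
  have h := hf.isSymmSndFDerivAt (by simp)
  have hd : DifferentiableAt ℝ (fderiv ℝ f) x :=
    (hf.fderiv_right (m := 1) (by norm_num)).differentiableAt (by norm_num)
  have key : ∀ a b : Fin n, pd a (pd b f) x
      = fderiv ℝ (fderiv ℝ f) x (Pi.single a 1) (Pi.single b 1) := by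
    intro a b
    have h1 : HasFDerivAt (pd b f)
        ((ContinuousLinearMap.apply ℝ ℝ (Pi.single b (1:ℝ) : Fin n → ℝ)).comp
          (fderiv ℝ (fderiv ℝ f) x)) x :=
      ((ContinuousLinearMap.apply ℝ ℝ (Pi.single b (1:ℝ) : Fin n → ℝ)).hasFDerivAt).comp x
        hd.hasFDerivAt
    simp only [pd] at h1 ⊢
    rw [h1.fderiv]; rfl
  rw [key, key]; exact h _ _

theorem pd_comm {n : ℕ} {i j : Fin n} {f : (Fin n → ℝ) → ℝ}
    (hf : ContDiff ℝ 2 f) : pd i (pd j f) = pd j (pd i f) := by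
  ext x; exact pd_comm_at hf.contDiffAt

theorem contDiff_mul_tsupport {n : ℕ} {m : WithTop ℕ∞} {φ g : (Fin n → ℝ) → ℝ}
    (hφ : ContDiff ℝ m φ) (hg : ∀ x ∈ tsupport φ, ContDiffAt ℝ m g x) :
    ContDiff ℝ m (fun x => φ x * g x) := by
  rw [contDiff_iff_contDiffAt]
  intro x
  by_cases hx : x ∈ tsupport φ
  · exact hφ.contDiffAt.mul (hg x hx)
  · have : (fun x => φ x * g x) =ᶠ[nhds x] fun _ => 0 := by
      filter_upwards [notMem_tsupport_iff_eventuallyEq.mp hx] with y hy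
      simp [hy]
    exact contDiffAt_const.congr_of_eventuallyEq this

theorem continuous_mul_tsupport {n : ℕ} {φ g : (Fin n → ℝ) → ℝ}
    (hφ : Continuous φ) (hg : ∀ x ∈ tsupport φ, ContinuousAt g x) :
    Continuous (fun x => φ x * g x) := by
  have h0 := contDiff_mul_tsupport (m := 0) (contDiff_zero.2 hφ) (g := g)
  rw [continuous_iff_continuousAt]
  intro x
  by_cases hx : x ∈ tsupport φ
  · exact hφ.continuousAt.mul (hg x hx)
  · have : (fun x => φ x * g x) =ᶠ[nhds x] fun _ => 0 := by
      filter_upwards [notMem_tsupport_iff_eventuallyEq.mp hx] with y hy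
      simp [hy]
    exact continuousAt_const.congr this.symm

theorem pd_eq_zero_of_notMem {n : ℕ} {i : Fin n} {f : (Fin n → ℝ) → ℝ} {x : Fin n → ℝ}
    (hx : x ∉ tsupport f) : pd i f x = 0 := by
  rw [pd_congr_of_eventuallyEq (notMem_tsupport_iff_eventuallyEq.mp hx)]
  simp [pd]

theorem tsupport_pd_subset {n : ℕ} {i : Fin n} {f : (Fin n → ℝ) → ℝ} :
    tsupport (pd i f) ⊆ tsupport f := by
  refine closure_minimal ?_ (isClosed_tsupport f)
  intro x hx
  by_contra h
  exact hx (pd_eq_zero_of_notMem h)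

theorem hasCompactSupport_pd {n : ℕ} {i : Fin n} {f : (Fin n → ℝ) → ℝ}
    (hf : HasCompactSupport f) : HasCompactSupport (pd i f) :=
  hf.of_isClosed_subset (isClosed_tsupport _) tsupport_pd_subset

/-- Divergence theorem for compactly supported functions. -/
theorem integral_pd_eq_zero {n : ℕ} {i : Fin n} {f : (Fin n → ℝ) → ℝ}
    (hf : ContDiff ℝ 1 f) (hc : HasCompactSupport f) : ∫ x, pd i f x = 0 := by
  have hd := hf.differentiable (by norm_num)
  have hcont : Continuous (pd i f) := (contDiff_pd (k := 0) hf (by norm_num)).continuous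
  have h := integral_mul_fderiv_eq_neg_fderiv_mul_of_integrable (μ := volume)
    (f := fun _ : Fin n → ℝ => (1:ℝ)) (g := f) (v := Pi.single i 1) (by simp)
    (by simpa [pd, Function.comp_def] using (show Integrable (fun x => pd i f x) volume from
      hcont.integrable_of_hasCompactSupport (hasCompactSupport_pd hc)))
    (by simpa using hf.continuous.integrable_of_hasCompactSupport hc) (by fun_prop) (fun x _ => hd x)
  simpa [pd] using h

theorem integral_div_eq_zero {n : ℕ} {W : Fin n → (Fin n → ℝ) → ℝ}
    (hf : ∀ i, ContDiff ℝ 1 (W i)) (hc : ∀ i, HasCompactSupport (W i)) :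
    ∫ x, ∑ i, pd i (W i) x = 0 := by
  rw [integral_finsetSum]
  · exact Finset.sum_eq_zero fun i _ => integral_pd_eq_zero (hf i) (hc i)
  · intro i _
    exact ((contDiff_pd (k := 0) (hf i) (by norm_num)).continuous).integrable_of_hasCompactSupport
      (hasCompactSupport_pd (hc i))

theorem abs_sum_le_of {n : ℕ} {f : Fin n → ℝ} {c : ℝ} (h : ∀ i, |f i| ≤ c) :
    |∑ i, f i| ≤ n * c := by
  refine (Finset.abs_sum_le_sum_abs _ _).trans ?_
  refine (Finset.sum_le_sum fun i _ => h i).trans ?_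
  simp

open MeasureTheory Metric Set Matrix

open scoped ContDiff

/-- Linear expression used in the correction vector field. -/
def Xf {n : ℕ} (A : Fin n → Fin n → ℝ) (h : Fin n → Fin n → Fin n → ℝ) (c : Fin n) : ℝ :=
  - ∑ a, A a c * (∑ i, h i i a) + ∑ a, ∑ b, A a b * h b c a + (∑ i, A i i) * (∑ i, h i i c)
    - ∑ a, ∑ b, A a b * h a b c

theorem Xf_bound {n : ℕ} (A : Fin n → Fin n → ℝ) (h : Fin n → Fin n → Fin n → ℝ) (c : Fin n)
    {d K : ℝ} (hA : ∀ a b, |A a b| ≤ d) (hh : ∀ a b c, |h a b c| ≤ K) (hd : 0 ≤ d) :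
    |Xf A h c| ≤ 4 * (n:ℝ) ^ 2 * K * d := by
  have e1 : |∑ a, A a c * (∑ i, h i i a)| ≤ n * (d * (n * K)) := by
    refine abs_sum_le_of fun a => ?_
    rw [abs_mul]
    exact mul_le_mul (hA _ _) (abs_sum_le_of fun i => hh _ _ _) (abs_nonneg _) hd
  have e2 : |∑ a, ∑ b, A a b * h b c a| ≤ n * (n * (d * K)) := by
    refine abs_sum_le_of fun a => abs_sum_le_of fun b => ?_
    rw [abs_mul]
    exact mul_le_mul (hA _ _) (hh _ _ _) (abs_nonneg _) hd
  have e3 : |(∑ i, A i i) * (∑ i, h i i c)| ≤ (n * d) * (n * K) := by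
    rw [abs_mul]
    exact mul_le_mul (abs_sum_le_of fun i => hA _ _) (abs_sum_le_of fun i => hh _ _ _)
      (abs_nonneg _) (by positivity)
  have e4 : |∑ a, ∑ b, A a b * h a b c| ≤ n * (n * (d * K)) := by
    refine abs_sum_le_of fun a => abs_sum_le_of fun b => ?_
    rw [abs_mul]
    exact mul_le_mul (hA _ _) (hh _ _ _) (abs_nonneg _) hd
  rw [abs_le] at *
  unfold Xf
  constructor <;> nlinarith

theorem Xf_lin {n : ℕ} (A B : Fin n → Fin n → ℝ) (h : Fin n → Fin n → Fin n → ℝ) (c : Fin n)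
    (k : ℝ) : Xf A h c = k * Xf B h c + Xf (fun a b => A a b - k * B a b) h c := by
  have e1 : ∑ a, (A a c - k * B a c) * (∑ i, h i i a)
      = ∑ a, A a c * (∑ i, h i i a) - k * ∑ a, B a c * (∑ i, h i i a) := by
    rw [Finset.mul_sum, ← Finset.sum_sub_distrib]
    exact Finset.sum_congr rfl fun a _ => by ring
  have e2 : ∀ g : Fin n → Fin n → ℝ, ∑ a, ∑ b, (A a b - k * B a b) * g a b
      = ∑ a, ∑ b, A a b * g a b - k * ∑ a, ∑ b, B a b * g a b := by
    intro g
    simp only [Finset.mul_sum, ← Finset.sum_sub_distrib]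
    exact Finset.sum_congr rfl fun a _ => Finset.sum_congr rfl fun b _ => by ring
  have e3 : ∑ i, (A i i - k * B i i) = ∑ i, A i i - k * ∑ i, B i i := by
    rw [Finset.mul_sum, ← Finset.sum_sub_distrib]
  unfold Xf
  rw [e1, e2, e2 (fun a b => h a b c), e3]; ring

/-- First-order terms combine into the correction. -/
theorem first_order_identity {n : ℕ} (A : Fin n → Fin n → ℝ) (h : Fin n → Fin n → Fin n → ℝ)
    (Hh : Fin n → Fin n → ℝ) (e1 : Fin n → Fin n → Fin n → ℝ) (vl dT : Fin n → ℝ)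
    (dH : Fin n → Fin n → Fin n → ℝ)
    (hdH : ∀ l i j, dH l i j = ∑ m, h i j m * (A m l + Hh m l) + e1 i j l)
    (hdT : ∀ j, dT j = - ∑ i, dH j i i + ∑ i, dH i i j) :
    ∑ j, dT j * vl j + ((∑ i, A i i) * ∑ i, ∑ m, h i i m * vl m
        - ∑ i, ∑ j, A i j * ∑ m, h i j m * vl m)
      = ∑ c, vl c * Xf A h c + ∑ j, vl j * (- ∑ i, (∑ m, h i i m * Hh m j + e1 i i j)
          + ∑ i, (∑ m, h i j m * Hh m i + e1 i j i)) := by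
  have a1 : (∑ i, A i i) * ∑ i, ∑ m, h i i m * vl m
      = ∑ c, vl c * ((∑ i, A i i) * ∑ i, h i i c) := by
    rw [Finset.sum_comm]
    simp only [← Finset.sum_mul]
    rw [Finset.mul_sum]
    exact Finset.sum_congr rfl fun a _ => by ring
  have a2 : ∑ i, ∑ j, A i j * ∑ m, h i j m * vl m
      = ∑ c, vl c * ∑ a, ∑ b, A a b * h a b c := by
    simp only [Finset.mul_sum]
    conv_rhs => rw [Finset.sum_comm]
    conv_rhs => rw [Finset.sum_congr rfl fun i _ => Finset.sum_comm]
    exact Finset.sum_congr rfl fun i _ => Finset.sum_congr rfl fun j _ =>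
      Finset.sum_congr rfl fun m _ => by ring
  have a3 : ∀ j, dT j = (- ∑ a, A a j * (∑ i, h i i a) + ∑ a, ∑ b, A a b * h b j a)
      + (- ∑ i, (∑ m, h i i m * Hh m j + e1 i i j)
          + ∑ i, (∑ m, h i j m * Hh m i + e1 i j i)) := by
    intro j
    rw [hdT]
    have b1 : ∑ i, dH j i i = ∑ a, A a j * (∑ i, h i i a)
        + ∑ i, (∑ m, h i i m * Hh m j + e1 i i j) := by
      simp only [hdH, mul_add, Finset.sum_add_distrib, Finset.mul_sum]
      rw [Finset.sum_comm (f := fun a i => A a j * h i i a)]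
      simp only [mul_comm (A _ _)]
      ring
    have b2 : ∑ i, dH i i j = ∑ a, ∑ b, A a b * h b j a
        + ∑ i, (∑ m, h i j m * Hh m i + e1 i j i) := by
      simp only [hdH, mul_add, Finset.sum_add_distrib]
      rw [Finset.sum_comm (f := fun a b => A a b * h b j a)]
      simp only [mul_comm (A _ _)]
      ring
    rw [b1, b2]; ring
  rw [a1, a2, ← Finset.sum_sub_distrib, ← Finset.sum_add_distrib, ← Finset.sum_add_distrib]
  refine Finset.sum_congr rfl fun c _ => ?_
  rw [a3, Xf]; ring

open MeasureTheory Metric Set Matrix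

open scoped ContDiff

theorem pow_aux2 {v : ℝ} (hv : 1 / 2 ≤ v) : v ^ 2 ≤ 2 * v ^ 3 := by
  nlinarith [sq_nonneg v]

theorem pow_aux1 {v : ℝ} (hv : 1 / 2 ≤ v) : v ≤ 4 * v ^ 3 := by
  nlinarith [sq_nonneg v]

theorem lemS_scalar {κ s v w r β Q E3 σ B1 B2 B3 B4 c0 K d gi : ℝ} (hκ : 0 < κ) (hs : 1 ≤ s)
    (hv : 1 / 2 ≤ v) (hc0 : 0 < c0) (hσ0 : 0 ≤ σ) (hσ1 : σ ≤ 1)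
    (hB2 : 0 ≤ B2) (hB3 : 0 ≤ B3)
    (hβ : |β| ≤ B1) (hE3 : |E3| ≤ B2 * v ^ 3 + B3 * |w| + B4 * v * d)
    (hd : d ^ 2 ≤ Q + gi ^ 2 / (2 * c0)) (hgi : gi ^ 2 ≤ 2 * K ^ 2 * v ^ 2 + 2 * r ^ 2) :
    - (κ / 2 * s * (w / v) ^ 2) - (B2 + 4 / κ * (B1 + B3) ^ 2 + 2 * K ^ 2 / c0 + B4 ^ 2 / 2) * v ^ 3
        - (1 / κ + 1 / c0) * s * r ^ 2
      ≤ - (s / v * (w * r)) + β * w + Q - σ * E3 := by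
  have hv0 : 0 < v := by linarith
  obtain ⟨y, hy⟩ : ∃ y, y = w / v := ⟨_, rfl⟩
  have hw : w = y * v := by rw [hy]; field_simp
  have hv2 : v ^ 2 ≤ 2 * v ^ 3 := pow_aux2 hv
  have h1 : s / v * (w * r) ≤ κ / 4 * s * y ^ 2 + 1 / κ * s * r ^ 2 := by
    have e1 : s / v * (w * r) = s * (y * r) := by rw [hw]; field_simp
    have e2 : y * r ≤ κ / 4 * y ^ 2 + 1 / κ * r ^ 2 := by
      have : 0 ≤ 1 / κ * (κ / 2 * y - r) ^ 2 := by positivity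
      have h : 1 / κ * (κ / 2 * y - r) ^ 2 = κ / 4 * y ^ 2 + 1 / κ * r ^ 2 - y * r := by
        field_simp; ring
      linarith
    rw [e1]; nlinarith
  have h2 : (B1 + B3) * |w| ≤ κ / 8 * y ^ 2 + 2 / κ * (B1 + B3) ^ 2 * v ^ 2 := by
    rw [hw, abs_mul, abs_of_pos hv0]
    have : 0 ≤ 2 / κ * (κ / 4 * |y| - (B1 + B3) * v) ^ 2 := by positivity
    have h : 2 / κ * (κ / 4 * |y| - (B1 + B3) * v) ^ 2
        = κ / 8 * |y| ^ 2 + 2 / κ * (B1 + B3) ^ 2 * v ^ 2 - (B1 + B3) * (|y| * v) := by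
      field_simp; ring
    rw [sq_abs] at h
    linarith
  have h3 : B4 * v * d ≤ d ^ 2 + B4 ^ 2 / 4 * v ^ 2 := by nlinarith [sq_nonneg (d - B4 * v / 2)]
  have h4 : gi ^ 2 / (2 * c0) ≤ K ^ 2 / c0 * v ^ 2 + 1 / c0 * r ^ 2 := by
    rw [div_le_iff₀ (by positivity)]
    have : (K ^ 2 / c0 * v ^ 2 + 1 / c0 * r ^ 2) * (2 * c0) = 2 * K ^ 2 * v ^ 2 + 2 * r ^ 2 := by
      field_simp
    linarith
  have h5 : -(B1 * |w|) ≤ β * w := by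
    have := abs_mul β w
    have h := neg_abs_le (β * w)
    have h' : |β| * |w| ≤ B1 * |w| := by gcongr
    linarith
  have hd0 := sq_nonneg d
  have h6 : σ * E3 ≤ B2 * v ^ 3 + B3 * |w| + (d ^ 2 + B4 ^ 2 / 4 * v ^ 2) := by
    have hv3 : 0 ≤ v ^ 3 := by positivity
    have : E3 ≤ B2 * v ^ 3 + B3 * |w| + (d ^ 2 + B4 ^ 2 / 4 * v ^ 2) :=
      (le_abs_self _).trans (by linarith)
    have h0 : 0 ≤ B2 * v ^ 3 + B3 * |w| + (d ^ 2 + B4 ^ 2 / 4 * v ^ 2) := by positivity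
    exact (mul_le_mul_of_nonneg_left this hσ0).trans (mul_le_of_le_one_left h0 hσ1)
  rw [← hy]
  have m1 : 2 / κ * (B1 + B3) ^ 2 * v ^ 2 ≤ 4 / κ * (B1 + B3) ^ 2 * v ^ 3 := by
    have : 0 ≤ 2 / κ * (B1 + B3) ^ 2 := by positivity
    calc _ ≤ 2 / κ * (B1 + B3) ^ 2 * (2 * v ^ 3) := by gcongr
      _ = _ := by ring
  have m2 : K ^ 2 / c0 * v ^ 2 ≤ 2 * K ^ 2 / c0 * v ^ 3 := by
    calc _ ≤ K ^ 2 / c0 * (2 * v ^ 3) := by gcongr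
      _ = _ := by ring
  have m3 : B4 ^ 2 / 4 * v ^ 2 ≤ B4 ^ 2 / 2 * v ^ 3 := by
    calc _ ≤ B4 ^ 2 / 4 * (2 * v ^ 3) := by gcongr
      _ = _ := by ring
  have m4 : κ / 8 * y ^ 2 ≤ κ / 4 * s * y ^ 2 := by
    have : 0 ≤ κ / 8 * y ^ 2 := by positivity
    calc κ / 8 * y ^ 2 ≤ (2 * s) * (κ / 8 * y ^ 2) := le_mul_of_one_le_left this (by linarith)
      _ = _ := by ring
  have m5 : 1 / c0 * r ^ 2 ≤ 1 / c0 * s * r ^ 2 := by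
    have : 0 ≤ 1 / c0 * r ^ 2 := by positivity
    calc 1 / c0 * r ^ 2 ≤ s * (1 / c0 * r ^ 2) := le_mul_of_one_le_left this (by linarith)
      _ = _ := by ring
  linarith

theorem fdot_entry_le {n : ℕ} (A : Fin n → Fin n → ℝ) (a b : Fin n) :
    |A a b| ≤ √(fdot A A) := by
  apply Real.abs_le_sqrt
  unfold fdot
  have h1 : A a b ^ 2 ≤ ∑ j, A a j * A a j := by
    rw [sq]
    exact Finset.single_le_sum (f := fun j => A a j * A a j) (fun j _ => mul_self_nonneg _)
      (Finset.mem_univ b)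
  exact h1.trans (Finset.single_le_sum (f := fun i => ∑ j, A i j * A i j)
    (fun i _ => Finset.sum_nonneg fun j _ => mul_self_nonneg _) (Finset.mem_univ a))

set_option maxHeartbeats 1000000 in
/-- Per-index lower bound. -/
theorem lemS_index {n : ℕ} {K c0 s v τ g w r gi t p β k0 : ℝ} (hn : 1 ≤ (n:ℝ)) (hK : 1 ≤ K)
    (hc0 : 0 < c0) (hs : 1 ≤ s) (hv : 1 / 2 ≤ v) (hτ : 0 < τ) (hvτ : v = τ + k0) (hk0 : |k0| ≤ K)
    (hg : c0 ≤ g) (A D : Fin n → Fin n → ℝ) (h dh : Fin n → Fin n → Fin n → ℝ) (i : Fin n)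
    (hA : τ ^ 2 - fdot A A = 2 * g)
    (hD : τ * t - fdot A D = gi) (hgi : gi ^ 2 ≤ 2 * K ^ 2 * v ^ 2 + 2 * r ^ 2)
    (hw : w = t + p) (hp : |p| ≤ 4 * (n:ℝ) ^ 2 * K * v) (hh : ∀ a b c, |h a b c| ≤ K)
    (hdh : ∀ a b c, |dh a b c| ≤ K * v) (hβ : |β| ≤ 5 * (n:ℝ) ^ 2 * K ^ 2) :
    - (c0 / (6 * K) / 2 * s * (w / v) ^ 2) - (200 * (n:ℝ) ^ 4 * K ^ 3
        + 4 / (c0 / (6 * K)) * (9 * (n:ℝ) ^ 2 * K ^ 2) ^ 2 + 2 * K ^ 2 / c0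
        + (4 * (n:ℝ) ^ 2 * K) ^ 2 / 2) * v ^ 3
        - (1 / (c0 / (6 * K)) + 1 / c0) * s * r ^ 2
      ≤ - (s / v * (w * r)) + β * w + (fdot D D - t ^ 2)
        - 1 / (s + 2) * (v * Xf D h i - w * Xf A h i + v * Xf A dh i) := by
  have hv0 : 0 < v := by linarith
  have hg0 : 0 < g := by linarith
  set d := √(fdot (fun i j => D i j - t / τ * A i j) (fun i j => D i j - t / τ * A i j)) with hd
  have hd2 : d ^ 2 ≤ (fdot D D - t ^ 2) + gi ^ 2 / (2 * c0) := by
    rw [hd, Real.sq_sqrt (fdot_self_nonneg _)]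
    refine (lorentz_deficit A D hτ hg0 hA hD).trans ?_
    gcongr
  have hτv : τ ≤ 3 * K * v := by
    have := (abs_le.1 hk0).1
    nlinarith
  have hAτ : ∀ a b, |A a b| ≤ τ := by
    intro a b
    refine (fdot_entry_le A a b).trans ?_
    rw [show τ = √(τ ^ 2) by rw [Real.sqrt_sq hτ.le]]
    exact Real.sqrt_le_sqrt (by linarith)
  have hn2 : 1 ≤ (n:ℝ) ^ 2 := by nlinarith
  have X1 : |Xf A h i| ≤ 4 * (n:ℝ) ^ 2 * K * τ := Xf_bound A h i hAτ hh hτ.le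
  have X2 : |Xf A dh i| ≤ 4 * (n:ℝ) ^ 2 * (K * v) * τ := Xf_bound A dh i hAτ hdh hτ.le
  have X3 : |Xf (fun a b => D a b - t / τ * A a b) h i| ≤ 4 * (n:ℝ) ^ 2 * K * d :=
    Xf_bound _ h i (fun a b => fdot_entry_le (fun i j => D i j - t / τ * A i j) a b) hh (Real.sqrt_nonneg _)
  have hE3 : |v * Xf D h i - w * Xf A h i + v * Xf A dh i|
      ≤ (200 * (n:ℝ) ^ 4 * K ^ 3) * v ^ 3 + (4 * (n:ℝ) ^ 2 * K ^ 2) * |w|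
        + (4 * (n:ℝ) ^ 2 * K) * v * d := by
    rw [Xf_lin D A h i (t / τ)]
    have e : v * (t / τ * Xf A h i + Xf (fun a b => D a b - t / τ * A a b) h i)
        - w * Xf A h i + v * Xf A dh i
        = (Xf A h i / τ) * (k0 * t - p * τ) + v * Xf (fun a b => D a b - t / τ * A a b) h i
          + v * Xf A dh i := by
      rw [hw, hvτ]; field_simp; ring
    rw [e]
    have f1 : |Xf A h i / τ| ≤ 4 * (n:ℝ) ^ 2 * K := by
      rw [abs_div, abs_of_pos hτ, div_le_iff₀ hτ]; exact X1
    have ht : |t| ≤ |w| + 4 * (n:ℝ) ^ 2 * K * v := by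
      have : t = w - p := by linarith
      rw [this]; exact (abs_sub _ _).trans (by linarith)
    have f2 : |k0 * t - p * τ| ≤ K * (|w| + 4 * (n:ℝ) ^ 2 * K * v)
        + (4 * (n:ℝ) ^ 2 * K * v) * (3 * K * v) := by
      refine (abs_sub _ _).trans ?_
      rw [abs_mul, abs_mul, abs_of_pos hτ]
      gcongr
    refine (abs_add_three _ _ _).trans ?_
    rw [abs_mul, abs_mul, abs_mul, abs_of_pos hv0]
    have g1 : |Xf A h i / τ| * |k0 * t - p * τ| ≤ 4 * (n:ℝ) ^ 2 * K * (K * (|w| + 4 * (n:ℝ) ^ 2 * K * v)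
        + (4 * (n:ℝ) ^ 2 * K * v) * (3 * K * v)) := by gcongr
    have g2 : v * |Xf (fun a b => D a b - t / τ * A a b) h i| ≤ v * (4 * (n:ℝ) ^ 2 * K * d) := by
      gcongr
    have g3 : v * |Xf A dh i| ≤ v * (4 * (n:ℝ) ^ 2 * (K * v) * (3 * K * v)) := by
      refine mul_le_mul_of_nonneg_left (X2.trans ?_) hv0.le
      gcongr
    have hv2 : v ^ 2 ≤ 2 * v ^ 3 := pow_aux2 hv
    have hv1 : v ≤ 4 * v ^ 3 := pow_aux1 hv
    have hv3 : 0 < v ^ 3 := by positivity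
    have m1 : 16 * (n:ℝ) ^ 4 * K ^ 3 * v ≤ 16 * (n:ℝ) ^ 4 * K ^ 3 * (4 * v ^ 3) := by gcongr
    have m1' : 48 * (n:ℝ) ^ 4 * K ^ 3 * v ^ 2 ≤ 48 * (n:ℝ) ^ 4 * K ^ 3 * (2 * v ^ 3) := by gcongr
    have m2 : 12 * (n:ℝ) ^ 2 * K ^ 2 * v ^ 3 ≤ 12 * (n:ℝ) ^ 4 * K ^ 3 * v ^ 3 := by
      have a1 : (n:ℝ) ^ 2 ≤ (n:ℝ) ^ 4 := pow_le_pow_right₀ hn (by norm_num)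
      have a2 : K ^ 2 ≤ K ^ 3 := pow_le_pow_right₀ hK (by norm_num)
      gcongr
    have m3 : 0 ≤ (n:ℝ) ^ 4 * K ^ 3 * v ^ 3 := by positivity
    have l1 : 4 * (n:ℝ) ^ 2 * K * (K * (|w| + 4 * (n:ℝ) ^ 2 * K * v)
        + (4 * (n:ℝ) ^ 2 * K * v) * (3 * K * v)) = 4 * (n:ℝ) ^ 2 * K ^ 2 * |w|
        + 16 * (n:ℝ) ^ 4 * K ^ 3 * v + 48 * (n:ℝ) ^ 4 * K ^ 3 * v ^ 2 := by ring
    have l2 : v * (4 * (n:ℝ) ^ 2 * (K * v) * (3 * K * v)) = 12 * (n:ℝ) ^ 2 * K ^ 2 * v ^ 3 := by ring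
    rw [l1] at g1
    rw [l2] at g3
    linarith
  have hσ1 : 1 / (s + 2) ≤ 1 := by rw [div_le_one (by linarith)]; linarith
  have := lemS_scalar (κ := c0 / (6 * K)) (s := s) (v := v) (w := w) (r := r) (β := β)
    (Q := fdot D D - t ^ 2) (E3 := v * Xf D h i - w * Xf A h i + v * Xf A dh i)
    (σ := 1 / (s + 2)) (B1 := 5 * (n:ℝ) ^ 2 * K ^ 2) (B2 := 200 * (n:ℝ) ^ 4 * K ^ 3)
    (B3 := 4 * (n:ℝ) ^ 2 * K ^ 2) (B4 := 4 * (n:ℝ) ^ 2 * K) (c0 := c0) (K := K) (d := d) (gi := gi)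
    (by positivity) hs hv hc0 (by positivity) hσ1 (by positivity) (by positivity) hβ hE3 hd2 hgi
  refine le_trans (le_of_eq ?_) this
  ring

open MeasureTheory Metric Set Matrix

open scoped ContDiff

/-- Bilinear form of the Newton tensor. -/
def Tq {n : ℕ} (A : Fin n → Fin n → ℝ) (ξ η : Fin n → ℝ) : ℝ :=
  (∑ i, A i i) * (∑ i, ξ i * η i) - ∑ i, ∑ j, A i j * ξ i * η j

theorem Tq_expand {n : ℕ} (A : Fin n → Fin n → ℝ) (hA : ∀ i j, A i j = A j i) (ξ η : Fin n → ℝ)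
    (a b : ℝ) : Tq A (fun i => a * ξ i + b * η i) (fun i => a * ξ i + b * η i)
      = a ^ 2 * Tq A ξ ξ + 2 * a * b * Tq A ξ η + b ^ 2 * Tq A η η := by
  have hs : ∑ i, ∑ j, A i j * η i * ξ j = ∑ i, ∑ j, A i j * ξ i * η j := by
    rw [Finset.sum_comm]
    exact Finset.sum_congr rfl fun i _ => Finset.sum_congr rfl fun j _ => by rw [hA]; ring
  have e1 : ∑ i, (a * ξ i + b * η i) * (a * ξ i + b * η i) = a ^ 2 * ∑ i, ξ i * ξ i
      + 2 * a * b * ∑ i, ξ i * η i + b ^ 2 * ∑ i, η i * η i := by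
    simp only [Finset.mul_sum, ← Finset.sum_add_distrib]
    exact Finset.sum_congr rfl fun i _ => by ring
  have e2 : ∑ i, ∑ j, A i j * (a * ξ i + b * η i) * (a * ξ j + b * η j)
      = a ^ 2 * ∑ i, ∑ j, A i j * ξ i * ξ j + a * b * ∑ i, ∑ j, A i j * ξ i * η j
      + a * b * ∑ i, ∑ j, A i j * η i * ξ j + b ^ 2 * ∑ i, ∑ j, A i j * η i * η j := by
    simp only [Finset.mul_sum, ← Finset.sum_add_distrib]
    exact Finset.sum_congr rfl fun i _ => Finset.sum_congr rfl fun j _ => by ring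
  simp only [Tq]
  rw [e1, e2, hs]; ring

theorem Tq_lower {n : ℕ} (A : Fin n → Fin n → ℝ) {τ g : ℝ} (hτ : 0 < τ) (hg : 0 < g)
    (hτA : τ = ∑ i, A i i) (hA : τ ^ 2 - fdot A A = 2 * g) (ξ : Fin n → ℝ) :
    g / τ * ∑ i, ξ i ^ 2 ≤ Tq A ξ ξ := by
  have := newton_lower A hτ hg hA ξ
  simpa [Tq, ← hτA, sq] using this

theorem Tq_upper {n : ℕ} (A : Fin n → Fin n → ℝ) {τ g : ℝ} (hτ : 0 < τ) (hg : 0 < g)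
    (hτA : τ = ∑ i, A i i) (hA : τ ^ 2 - fdot A A = 2 * g) (ξ : Fin n → ℝ) :
    Tq A ξ ξ ≤ 2 * τ * ∑ i, ξ i ^ 2 := by
  have := newton_upper A hτ hg hA ξ
  simpa [Tq, ← hτA, sq] using this

theorem tau_le_aux {τ v k0 K : ℝ} (hK : 1 ≤ K) (hv : 1 / 2 ≤ v) (hvτ : v = τ + k0) (hk0 : |k0| ≤ K) :
    τ ≤ 3 * K * v := by
  have := (abs_le.1 hk0).1
  nlinarith

theorem entry_le_tau {n : ℕ} (A : Fin n → Fin n → ℝ) {τ g : ℝ} (hτ : 0 < τ) (hg : 0 < g)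
    (hA : τ ^ 2 - fdot A A = 2 * g) (a b : Fin n) : |A a b| ≤ τ := by
  refine (fdot_entry_le A a b).trans ?_
  rw [show τ = √(τ ^ 2) by rw [Real.sqrt_sq hτ.le]]
  exact Real.sqrt_le_sqrt (by linarith)

theorem aux_nK {N K : ℝ} (hn : 1 ≤ N) (hK : 1 ≤ K) : N * (N * (K * K) + K) ≤ 2 * N ^ 2 * K ^ 2 := by
  have h0 : K ≤ K * K := by nlinarith
  have : K ≤ N * (K * K) := h0.trans (le_mul_of_one_le_left (by positivity) hn)
  nlinarith

theorem aux_sq {F r B : ℝ} (h : |F| ≤ B) : (F + r) ^ 2 ≤ 2 * B ^ 2 + 2 * r ^ 2 := by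
  have h1 : F ^ 2 ≤ B ^ 2 := by
    rw [sq_le_sq]; exact h.trans (le_abs_self _)
  nlinarith [sq_nonneg (F - r)]

theorem aux_young (a b : ℝ) : |2 * a * b| ≤ a ^ 2 + b ^ 2 := by
  rw [abs_le]; constructor <;> nlinarith [sq_nonneg (a - b), sq_nonneg (a + b)]

theorem lemS_hT {n : ℕ} {K c0 s v τ g : ℝ} (hK : 1 ≤ K) (hc0 : 0 < c0) (hs : 1 ≤ s)
    (hv0 : 0 < v) (hτ : 0 < τ) (hg : c0 ≤ g) (hτv : τ ≤ 3 * K * v)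
    (A : Fin n → Fin n → ℝ) (hτA : τ = ∑ i, A i i) (hA : τ ^ 2 - fdot A A = 2 * g)
    (vl : Fin n → ℝ) :
    c0 / (6 * K) * s * ∑ i, (vl i / v) ^ 2 ≤ s / (2 * v) * Tq A vl vl := by
  have hg0 : 0 < g := by linarith
  have h1 := Tq_lower A hτ hg0 hτA hA vl
  have h2 : c0 / (3 * K * v) ≤ g / τ := by gcongr
  have h3 : c0 / (3 * K * v) * ∑ i, vl i ^ 2 ≤ Tq A vl vl := by
    refine le_trans ?_ h1
    have : 0 ≤ ∑ i, vl i ^ 2 := Finset.sum_nonneg fun _ _ => sq_nonneg _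
    gcongr
  have h4 : ∑ i, (vl i / v) ^ 2 = (∑ i, vl i ^ 2) / v ^ 2 := by
    rw [Finset.sum_div]; exact Finset.sum_congr rfl fun i _ => by rw [div_pow]
  rw [h4]
  calc _ = s / (2 * v) * (c0 / (3 * K * v) * ∑ i, vl i ^ 2) := by field_simp; ring
    _ ≤ _ := by gcongr

theorem lemS_cut {n : ℕ} {K s v τ g φ : ℝ} (hK : 1 ≤ K) (hs : 1 ≤ s)
    (hv : 1 / 2 ≤ v) (hτ : 0 < τ) (hg0 : 0 < g) (hτv : τ ≤ 3 * K * v)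
    (A : Fin n → Fin n → ℝ) (hAs : ∀ i j, A i j = A j i) (hτA : τ = ∑ i, A i i)
    (hA : τ ^ 2 - fdot A A = 2 * g) (vl φl : Fin n → ℝ) :
    - (φ ^ 2 * (s / (2 * v) * Tq A vl vl)) - 24 * K * v ^ 3 * ∑ i, φl i ^ 2
      ≤ 2 * φ * Tq A φl vl := by
  have hv0 : 0 < v := by linarith
  have hv2 := pow_aux2 hv
  have hΦ0 : 0 ≤ ∑ i, φl i ^ 2 := Finset.sum_nonneg fun _ _ => sq_nonneg _
  have h1 : 0 ≤ Tq A (fun i => (2 * v / s) * φl i + φ * vl i) (fun i => (2 * v / s) * φl i + φ * vl i) := by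
    refine le_trans ?_ (Tq_lower A hτ hg0 hτA hA _)
    have : 0 ≤ ∑ i, (2 * v / s * φl i + φ * vl i) ^ 2 := Finset.sum_nonneg fun _ _ => sq_nonneg _
    positivity
  rw [Tq_expand A hAs] at h1
  have h2 := Tq_upper A hτ hg0 hτA hA φl
  have h3 : 0 ≤ s / (2 * v) * ((2 * v / s) ^ 2 * Tq A φl φl + 2 * (2 * v / s) * φ * Tq A φl vl
    + φ ^ 2 * Tq A vl vl) := mul_nonneg (by positivity) h1
  have h4 : s / (2 * v) * ((2 * v / s) ^ 2 * Tq A φl φl + 2 * (2 * v / s) * φ * Tq A φl vl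
    + φ ^ 2 * Tq A vl vl) = 2 * v / s * Tq A φl φl + 2 * φ * Tq A φl vl
      + φ ^ 2 * (s / (2 * v) * Tq A vl vl) := by field_simp
  have h5 : 2 * v / s * Tq A φl φl ≤ 24 * K * v ^ 3 * ∑ i, φl i ^ 2 := by
    have a1 : 2 * v / s ≤ 2 * v := div_le_self (by linarith) hs
    calc 2 * v / s * Tq A φl φl ≤ 2 * v / s * (2 * τ * ∑ i, φl i ^ 2) := by gcongr
      _ ≤ 2 * v * (2 * (3 * K * v) * ∑ i, φl i ^ 2) := by gcongr
      _ = (12 * K * ∑ i, φl i ^ 2) * v ^ 2 := by ring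
      _ ≤ (12 * K * ∑ i, φl i ^ 2) * (2 * v ^ 3) := by gcongr
      _ = _ := by ring
  linarith

theorem lemS_X {n : ℕ} {K s v τ φ : ℝ} (hn : 1 ≤ (n:ℝ)) (hK : 1 ≤ K) (hs : 1 ≤ s)
    (hv : 1 / 2 ≤ v) (hτ : 0 < τ) (hτv : τ ≤ 3 * K * v)
    (A : Fin n → Fin n → ℝ) (hAτ : ∀ a b, |A a b| ≤ τ) (h : Fin n → Fin n → Fin n → ℝ)
    (hh : ∀ a b c, |h a b c| ≤ K) (φl : Fin n → ℝ) :
    1 / (s + 2) * (2 * φ * v * ∑ i, φl i * Xf A h i)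
      ≤ 24 * (n:ℝ) ^ 3 * K ^ 2 * v ^ 3 * (φ ^ 2 + ∑ i, φl i ^ 2) := by
  have hv0 : 0 < v := by linarith
  have hv2 := pow_aux2 hv
  have hΦ0 : 0 ≤ ∑ i, φl i ^ 2 := Finset.sum_nonneg fun _ _ => sq_nonneg _
  have hσ : 0 ≤ 1 / (s + 2) := by positivity
  have hσ1 : 1 / (s + 2) ≤ 1 := by rw [div_le_one (by linarith)]; linarith
  have hb1 : 2 * φ * v * ∑ i, φl i * Xf A h i ≤ 12 * (n:ℝ) ^ 2 * K ^ 2 * v ^ 2 * (n * φ ^ 2 + ∑ i, φl i ^ 2) := by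
    have : ∀ i, 2 * φ * v * (φl i * Xf A h i) ≤ 12 * (n:ℝ) ^ 2 * K ^ 2 * v ^ 2 * (φ ^ 2 + φl i ^ 2) := by
      intro i
      have X1 : |Xf A h i| ≤ 4 * (n:ℝ) ^ 2 * K * τ := Xf_bound A h i hAτ hh hτ.le
      have X2 : |Xf A h i| ≤ 12 * (n:ℝ) ^ 2 * K ^ 2 * v := by
        refine X1.trans ?_
        calc 4 * (n:ℝ) ^ 2 * K * τ ≤ 4 * (n:ℝ) ^ 2 * K * (3 * K * v) := by gcongr
          _ = _ := by ring
      have h1 : 2 * φ * φl i * Xf A h i ≤ (φ ^ 2 + φl i ^ 2) * (12 * (n:ℝ) ^ 2 * K ^ 2 * v) := by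
        refine (le_abs_self _).trans ?_
        rw [abs_mul]
        refine mul_le_mul ?_ X2 (abs_nonneg _) (by positivity)
        exact aux_young _ _
      calc 2 * φ * v * (φl i * Xf A h i) = v * (2 * φ * φl i * Xf A h i) := by ring
        _ ≤ v * ((φ ^ 2 + φl i ^ 2) * (12 * (n:ℝ) ^ 2 * K ^ 2 * v)) := by gcongr
        _ = _ := by ring
    rw [Finset.mul_sum]
    refine (Finset.sum_le_sum fun i _ => this i).trans (le_of_eq ?_)
    rw [← Finset.mul_sum, Finset.sum_add_distrib]; simp
  have hb2 : 12 * (n:ℝ) ^ 2 * K ^ 2 * v ^ 2 * (n * φ ^ 2 + ∑ i, φl i ^ 2)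
      ≤ 24 * (n:ℝ) ^ 3 * K ^ 2 * v ^ 3 * (φ ^ 2 + ∑ i, φl i ^ 2) := by
    calc _ ≤ 12 * (n:ℝ) ^ 2 * K ^ 2 * (2 * v ^ 3) * (n * φ ^ 2 + n * ∑ i, φl i ^ 2) := by
          gcongr
          exact le_mul_of_one_le_left hΦ0 hn
      _ = _ := by ring
  have h0 : 0 ≤ 24 * (n:ℝ) ^ 3 * K ^ 2 * v ^ 3 * (φ ^ 2 + ∑ i, φl i ^ 2) := by positivity
  exact (mul_le_mul_of_nonneg_left (hb1.trans hb2) hσ).trans (mul_le_of_le_one_left h0 hσ1)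

theorem lemS_fin {N K c s φ v Y ρ Φ C1 C2 C3 : ℝ} (hN : 1 ≤ N) (hK : 1 ≤ K) (hs : 1 ≤ s) (hv : 0 < v)
    (hC1 : 0 < C1) (hC2 : 0 < C2) (hC3 : 0 < C3) (hρ0 : 0 ≤ ρ) (hΦ0 : 0 ≤ Φ) :
    c * s * φ ^ 2 * Y - (N * C1 + C2 + C3 + (24 * K + 8 + 24 * N ^ 3 * K ^ 2) + 1) * (φ ^ 2 + Φ) * v ^ 3
        - (N * C1 + C2 + C3 + (24 * K + 8 + 24 * N ^ 3 * K ^ 2) + 1) * s * φ ^ 2 * ρ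
      ≤ φ ^ 2 * (c * s * Y - (N * C1 + C3) * v ^ 3 - C2 * s * ρ)
        - 24 * K * v ^ 3 * Φ - (φ ^ 2 * ρ + 8 * v ^ 3 * Φ)
        - 24 * N ^ 3 * K ^ 2 * v ^ 3 * (φ ^ 2 + Φ) := by
  have a1 : 0 ≤ (C2 + 1 + 24 * K + 8) * φ ^ 2 * v ^ 3 := by positivity
  have a2 : 0 ≤ (N * C1 + C2 + C3 + 1) * Φ * v ^ 3 := by positivity
  have a4 : φ ^ 2 * ρ ≤ s * (φ ^ 2 * ρ) := le_mul_of_one_le_left (by positivity) hs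
  have a3 : 0 ≤ (N * C1 + C3 + (24 * K + 8 + 24 * N ^ 3 * K ^ 2)) * s * φ ^ 2 * ρ := by positivity
  linarith

set_option maxHeartbeats 1000000 in
/-- The pointwise inequality behind the smooth estimate. -/
theorem lemS_point (n : ℕ) (K c0 : ℝ) (hn : 1 ≤ (n:ℝ)) (hK : 1 ≤ K) (hc0 : 0 < c0) :
    ∃ C : ℝ, 0 < C ∧ ∀ (s v φ e' k0 g τ lr lF TD2v : ℝ) (A Hh e2 lH : Fin n → Fin n → ℝ)
      (D h e1 dH : Fin n → Fin n → Fin n → ℝ) (dh : Fin n → Fin n → Fin n → Fin n → ℝ)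
      (vl φl r b t F dT : Fin n → ℝ),
      1 ≤ s → 1 / 2 ≤ v → 0 < τ → τ = ∑ i, A i i → (∀ i j, A i j = A j i) → v = τ + k0 → |k0| ≤ K →
      c0 ≤ g → τ ^ 2 - fdot A A = 2 * g →
      (∀ l, τ * t l - fdot A (D l) = F l + r l) → (∀ l, |F l| ≤ K * v) →
      (∀ i j, |Hh i j| ≤ K) → (∀ i j, |A i j + Hh i j| ≤ 2 * v) →
      (∀ a b c, |h a b c| ≤ K) → (∀ l a b c, |dh l a b c| ≤ K * v) → (∀ a b c, |e1 a b c| ≤ K) →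
      (∀ a b, |e2 a b| ≤ K * v ^ 2) → (∀ m, |b m| ≤ K) → |e'| ≤ K * v ^ 2 →
      (∀ l i j, dH l i j = ∑ m, h i j m * (A m l + Hh m l) + e1 i j l) →
      (∀ l, vl l = t l + ∑ i, dH l i i) →
      (∀ j, dT j = - ∑ i, dH j i i + ∑ i, dH i i j) →
      (∀ i j, lH i j = ∑ m, h i j m * vl m + e2 i j) →
      lF = ∑ m, b m * vl m + e' →
      TD2v = (lF + lr) + ∑ l, (fdot (D l) (D l) - t l ^ 2)
        + (τ * ∑ i, lH i i - ∑ i, ∑ j, A i j * lH i j) →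
      c0 / (6 * K) / 2 * s * φ ^ 2 * ∑ i, (vl i / v) ^ 2 - C * (φ ^ 2 + ∑ i, φl i ^ 2) * v ^ 3
        - C * s * φ ^ 2 * ∑ i, r i ^ 2
      ≤ φ ^ 2 * (s / v * Tq A vl vl + (∑ j, dT j * vl j + TD2v)) + 2 * φ * Tq A φl vl
        - (2 * φ * ∑ i, φl i * r i + φ ^ 2 * (s / v * ∑ i, vl i * r i + lr))
        - 1 / (s + 2) * (2 * φ * v * ∑ i, φl i * Xf A h i + φ ^ 2 * ((s + 1) * ∑ i, vl i * Xf A h i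
          + ∑ i, (v * Xf (D i) h i + v * Xf A (dh i) i))) := by
  set C1 : ℝ := 200 * (n:ℝ) ^ 4 * K ^ 3
        + 4 / (c0 / (6 * K)) * (9 * (n:ℝ) ^ 2 * K ^ 2) ^ 2 + 2 * K ^ 2 / c0
        + (4 * (n:ℝ) ^ 2 * K) ^ 2 / 2 with hC1
  set C2 : ℝ := 1 / (c0 / (6 * K)) + 1 / c0 with hC2
  have hC1p : 0 < C1 := by positivity
  have hC2p : 0 < C2 := by positivity
  set C3 : ℝ := 2 * K + 6 * (n:ℝ) ^ 2 * K ^ 2 with hC3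
  have hC3p : 0 < C3 := by positivity
  set C4 : ℝ := 24 * K + 8 + 24 * (n:ℝ) ^ 3 * K ^ 2 with hC4
  have hC4p : 0 < C4 := by positivity
  refine ⟨n * C1 + C2 + C3 + C4 + 1, by positivity, ?_⟩
  intro s v φ e' k0 g τ lr lF TD2v A Hh e2 lH D h e1 dH dh vl φl r b t F dT hs hv hτ hτA hAs hvτ
    hk0 hg hA hD hF hHh hu hh hdh he1 he2 hb he' hdH hvl hdT hlH hlF hT2
  have hv0 : 0 < v := by linarith
  have hg0 : 0 < g := by linarith
  have hv2 := pow_aux2 hv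
  have hv3 : 0 < v ^ 3 := by positivity
  have hτv : τ ≤ 3 * K * v := tau_le_aux hK hv hvτ hk0
  have hAτ : ∀ a b, |A a b| ≤ τ := fun a b => entry_le_tau A hτ hg0 hA a b
  -- the first order error terms
  set Er : Fin n → ℝ := fun j => - ∑ i, (∑ m, h i i m * Hh m j + e1 i i j)
          + ∑ i, (∑ m, h i j m * Hh m i + e1 i j i) with hEr
  have hErb : ∀ j, |Er j| ≤ 4 * (n:ℝ) ^ 2 * K ^ 2 := by
    intro j
    have q1 : ∀ (x y z w : Fin n → Fin n → ℝ) , (∀ a b, |x a b| ≤ K) → (∀ a b, |y a b| ≤ K) →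
        (∀ a b, |z a b| ≤ K) → |∑ i, (∑ m, x i m * y i m + z i i)| ≤ n * (n * (K * K) + K) := by
      intro x y z w hx hy hz
      refine abs_sum_le_of fun i => (abs_add_le _ _).trans (add_le_add (abs_sum_le_of fun m => ?_) (hz _ _))
      rw [abs_mul]; exact mul_le_mul (hx _ _) (hy _ _) (abs_nonneg _) (by linarith)
    have a1 := q1 (fun i m => h i i m) (fun i m => Hh m j) (fun i _ => e1 i i j) (fun _ _ => 0)
      (fun _ _ => hh _ _ _) (fun _ _ => hHh _ _) (fun _ _ => he1 _ _ _)
    have a2 := q1 (fun i m => h i j m) (fun i m => Hh m i) (fun i _ => e1 i j i) (fun _ _ => 0)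
      (fun _ _ => hh _ _ _) (fun _ _ => hHh _ _) (fun _ _ => he1 _ _ _)
    have a3 := aux_nK hn hK
    refine (abs_add_le _ _).trans ?_
    rw [abs_neg]
    linarith
  have hdHb : ∀ l i j, |dH l i j| ≤ 4 * n * K * v := by
    intro l i j
    rw [hdH]
    refine (abs_add_le _ _).trans ?_
    have : |∑ m, h i j m * (A m l + Hh m l)| ≤ n * (K * (2 * v)) := by
      refine abs_sum_le_of fun m => ?_
      rw [abs_mul]; exact mul_le_mul (hh _ _ _) (hu _ _) (abs_nonneg _) (by linarith)
    have h2 := he1 i j l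
    have h3 : K ≤ 2 * n * K * v := by
      have : 1 ≤ 2 * v := by linarith
      have : 1 ≤ n * (2 * v) := one_le_mul_of_one_le_of_one_le hn this
      calc K ≤ (n * (2 * v)) * K := le_mul_of_one_le_left (by linarith) this
        _ = _ := by ring
    linarith
  have hidx : ∀ i, - (c0 / (6 * K) / 2 * s * (vl i / v) ^ 2) - C1 * v ^ 3 - C2 * s * r i ^ 2
      ≤ - (s / v * (vl i * r i)) + (b i + Er i) * vl i + (fdot (D i) (D i) - t i ^ 2)
        - 1 / (s + 2) * (v * Xf (D i) h i - vl i * Xf A h i + v * Xf A (dh i) i) := by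
    intro i
    have hp : |∑ j, dH i j j| ≤ 4 * (n:ℝ) ^ 2 * K * v := by
      refine (abs_sum_le_of fun j => hdHb i j j).trans (le_of_eq (by ring))
    have hgi : (F i + r i) ^ 2 ≤ 2 * K ^ 2 * v ^ 2 + 2 * r i ^ 2 := by
      have := aux_sq (r := r i) (hF i)
      rw [mul_pow, ← mul_assoc] at this
      exact this
    have hβ : |b i + Er i| ≤ 5 * (n:ℝ) ^ 2 * K ^ 2 := by
      refine (abs_add_le _ _).trans ?_
      have h1 := hb i
      have h2 := hErb i
      have h3 : K ≤ (n:ℝ) ^ 2 * K ^ 2 := by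
        have : 1 ≤ (n:ℝ) ^ 2 * K := one_le_mul_of_one_le_of_one_le (one_le_pow₀ hn) hK
        calc K ≤ ((n:ℝ) ^ 2 * K) * K := le_mul_of_one_le_left (by linarith) this
          _ = _ := by ring
      linarith
    exact lemS_index hn hK hc0 hs hv hτ hvτ hk0 hg A (D i) h (dh i) i hA (hD i) hgi (hvl i) hp hh
      (hdh i) hβ
  have hsum := Finset.sum_le_sum (s := Finset.univ) fun i _ => hidx i
  simp only [Finset.sum_sub_distrib, Finset.sum_add_distrib, Finset.sum_neg_distrib, add_mul,
    ← Finset.mul_sum, Finset.sum_const, Finset.card_univ, Fintype.card_fin, nsmul_eq_mul] at hsum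
  -- second order terms
  have hTe : |τ * ∑ i, e2 i i - ∑ i, ∑ j, A i j * e2 i j| ≤ 6 * (n:ℝ) ^ 2 * K ^ 2 * v ^ 3 := by
    have h1 : |∑ i, e2 i i| ≤ n * (K * v ^ 2) := abs_sum_le_of fun i => he2 i i
    have h2 : |∑ i, ∑ j, A i j * e2 i j| ≤ n * (n * (τ * (K * v ^ 2))) := by
      refine abs_sum_le_of fun i => abs_sum_le_of fun j => ?_
      rw [abs_mul]; exact mul_le_mul (hAτ _ _) (he2 _ _) (abs_nonneg _) hτ.le
    refine (abs_sub _ _).trans ?_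
    rw [abs_mul, abs_of_pos hτ]
    calc τ * |∑ i, e2 i i| + |∑ i, ∑ j, A i j * e2 i j|
        ≤ τ * (n * (K * v ^ 2)) + n * (n * (τ * (K * v ^ 2))) := by gcongr
      _ = (n + n ^ 2) * (K * v ^ 2) * τ := by ring
      _ ≤ (n ^ 2 + n ^ 2) * (K * v ^ 2) * (3 * K * v) := by
        gcongr
        exact le_self_pow₀ hn (by norm_num)
      _ = _ := by ring
  have hlHs : τ * ∑ i, lH i i - ∑ i, ∑ j, A i j * lH i j
      = ((∑ i, A i i) * ∑ i, ∑ m, h i i m * vl m - ∑ i, ∑ j, A i j * ∑ m, h i j m * vl m)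
        + (τ * ∑ i, e2 i i - ∑ i, ∑ j, A i j * e2 i j) := by
    simp only [hlH, Finset.sum_add_distrib, mul_add, ← hτA]; ring
  have hfo := first_order_identity A h Hh e1 vl dT dH hdH hdT
  have hEvl : ∑ j, vl j * (- ∑ i, (∑ m, h i i m * Hh m j + e1 i i j)
          + ∑ i, (∑ m, h i j m * Hh m i + e1 i j i)) = ∑ i, Er i * vl i :=
    Finset.sum_congr rfl fun j _ => by rw [hEr]; ring
  rw [hEvl] at hfo
  have hTvv := lemS_hT hK hc0 hs hv0 hτ hg hτv A hτA hA vl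
  have hΦ0 : 0 ≤ ∑ i, φl i ^ 2 := Finset.sum_nonneg fun _ _ => sq_nonneg _
  have hcut := lemS_cut (φ := φ) hK hs hv hτ hg0 hτv A hAs hτA hA vl φl
  have hφr : 2 * φ * ∑ i, φl i * r i ≤ φ ^ 2 * ∑ i, r i ^ 2 + ∑ i, φl i ^ 2 := by
    simp only [Finset.mul_sum, ← Finset.sum_add_distrib]
    refine Finset.sum_le_sum fun i _ => ?_
    have h1 := le_trans (le_abs_self _) (aux_young (φ * r i) (φl i))
    rw [mul_pow] at h1
    linarith
  have hσ : 0 ≤ 1 / (s + 2) := by positivity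
  have hσ1 : 1 / (s + 2) ≤ 1 := by rw [div_le_one (by linarith)]; linarith
  have hX := lemS_X (φ := φ) hn hK hs hv hτ hτv A hAτ h hh φl
  have hsne : s + 2 ≠ 0 := by linarith
  have hXsum : 1 / (s + 2) * ((s + 1) * ∑ i, vl i * Xf A h i
          + ∑ i, (v * Xf (D i) h i + v * Xf A (dh i) i)) = ∑ i, vl i * Xf A h i
        + 1 / (s + 2) * (v * ∑ i, Xf (D i) h i - ∑ i, vl i * Xf A h i + v * ∑ i, Xf A (dh i) i) := by
    simp only [Finset.sum_add_distrib, ← Finset.mul_sum]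
    field_simp; ring
  have hsvv : s / v = s / (2 * v) + s / (2 * v) := by field_simp; ring
  -- combine the bracket
  set Y := ∑ i, (vl i / v) ^ 2 with hY
  set ρ := ∑ i, r i ^ 2 with hρ
  set Φ := ∑ i, φl i ^ 2 with hΦ
  have hY0 : 0 ≤ Y := Finset.sum_nonneg fun _ _ => sq_nonneg _
  have hρ0 : 0 ≤ ρ := Finset.sum_nonneg fun _ _ => sq_nonneg _
  have he'2 : |e'| ≤ 2 * K * v ^ 3 := he'.trans (by
    calc K * v ^ 2 ≤ K * (2 * v ^ 3) := by gcongr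
      _ = _ := by ring)
  have hbr : c0 / (6 * K) / 2 * s * Y - (n * C1 + C3) * v ^ 3 - C2 * s * ρ
      ≤ s / (2 * v) * Tq A vl vl + (∑ j, dT j * vl j + TD2v) - (s / v * ∑ i, vl i * r i + lr)
        - 1 / (s + 2) * ((s + 1) * ∑ i, vl i * Xf A h i
          + ∑ i, (v * Xf (D i) h i + v * Xf A (dh i) i)) := by
    rw [hXsum, hT2, hlHs, hlF, hC3]
    simp only [Finset.sum_sub_distrib] at *
    have := (abs_le.1 hTe).1
    have := (abs_le.1 he'2).1
    linarith
  have hbr2 := mul_le_mul_of_nonneg_left hbr (sq_nonneg φ)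
  have hΦv : Φ ≤ 8 * v ^ 3 * Φ := by
    refine le_mul_of_one_le_left hΦ0 ?_
    have := pow_aux1 hv
    linarith
  have hfin := lemS_fin (N := (n:ℝ)) (c := c0 / (6 * K) / 2) (φ := φ) (Y := Y) hn hK hs hv0 hC1p hC2p hC3p hρ0 hΦ0
  rw [← hC4] at hfin
  have hlast : φ ^ 2 * (s / v * Tq A vl vl) = φ ^ 2 * (s / (2 * v) * Tq A vl vl)
      + φ ^ 2 * (s / (2 * v) * Tq A vl vl) := by rw [hsvv]; ring
  linarith

open MeasureTheory Metric Set Matrix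

open scoped ContDiff

theorem sm_diff {n : ℕ} {f : (Fin n → ℝ) → ℝ} (hf : ContDiff ℝ ∞ f) (x : Fin n → ℝ) :
    DifferentiableAt ℝ f x := hf.differentiable (by simp) x

theorem sm_sum {n : ℕ} {ι : Type*} {s : Finset ι} {f : ι → (Fin n → ℝ) → ℝ}
    (hf : ∀ i, ContDiff ℝ ∞ (f i)) : ContDiff ℝ ∞ (fun x => ∑ i ∈ s, f i x) :=
  ContDiff.sum fun i _ => hf i

theorem pd_sum_sm {n : ℕ} {ι : Type*} {s : Finset ι} {f : ι → (Fin n → ℝ) → ℝ}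
    (hf : ∀ i, ContDiff ℝ ∞ (f i)) (l : Fin n) (x : Fin n → ℝ) :
    pd l (fun x => ∑ i ∈ s, f i x) x = ∑ i ∈ s, pd l (f i) x :=
  pd_sum s fun i _ => sm_diff (hf i) x

theorem pd_mul_sm {n : ℕ} {f g : (Fin n → ℝ) → ℝ} (hf : ContDiff ℝ ∞ f) (hg : ContDiff ℝ ∞ g)
    (l : Fin n) (x : Fin n → ℝ) :
    pd l (fun x => f x * g x) x = pd l f x * g x + f x * pd l g x :=
  pd_mul (sm_diff hf x) (sm_diff hg x)

theorem sm_fdot {n : ℕ} {A B : Fin n → Fin n → (Fin n → ℝ) → ℝ}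
    (hA : ∀ i j, ContDiff ℝ ∞ (A i j)) (hB : ∀ i j, ContDiff ℝ ∞ (B i j)) :
    ContDiff ℝ ∞ (fun x => fdot (fun i j => A i j x) (fun i j => B i j x)) := by
  unfold fdot
  exact sm_sum fun i => sm_sum fun j => (hA i j).mul (hB i j)

theorem pd_fdot {n : ℕ} {A B : Fin n → Fin n → (Fin n → ℝ) → ℝ}
    (hA : ∀ i j, ContDiff ℝ ∞ (A i j)) (hB : ∀ i j, ContDiff ℝ ∞ (B i j)) (l : Fin n)
    (x : Fin n → ℝ) :
    pd l (fun x => fdot (fun i j => A i j x) (fun i j => B i j x)) x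
      = fdot (fun i j => pd l (A i j) x) (fun i j => B i j x)
        + fdot (fun i j => A i j x) (fun i j => pd l (B i j) x) := by
  unfold fdot
  rw [pd_sum_sm fun i => sm_sum fun j => (hA i j).mul (hB i j)]
  simp only [← Finset.sum_add_distrib]
  refine Finset.sum_congr rfl fun i _ => ?_
  rw [pd_sum_sm fun j => (hA i j).mul (hB i j)]
  exact Finset.sum_congr rfl fun j _ => pd_mul_sm (hA i j) (hB i j) l x

theorem sm_Xf {n : ℕ} {A : Fin n → Fin n → (Fin n → ℝ) → ℝ}
    {h : Fin n → Fin n → Fin n → (Fin n → ℝ) → ℝ}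
    (hA : ∀ i j, ContDiff ℝ ∞ (A i j)) (hh : ∀ i j m, ContDiff ℝ ∞ (h i j m)) (c : Fin n) :
    ContDiff ℝ ∞ (fun x => Xf (fun i j => A i j x) (fun i j m => h i j m x) c) := by
  unfold Xf
  exact (((sm_sum fun a => (hA a c).mul (sm_sum fun i => hh i i a)).neg.add
    (sm_sum fun a => sm_sum fun b => (hA a b).mul (hh b c a))).add
    ((sm_sum fun i => hA i i).mul (sm_sum fun i => hh i i c))).sub
    (sm_sum fun a => sm_sum fun b => (hA a b).mul (hh a b c))

theorem pd_Xf {n : ℕ} {A : Fin n → Fin n → (Fin n → ℝ) → ℝ}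
    {h : Fin n → Fin n → Fin n → (Fin n → ℝ) → ℝ}
    (hA : ∀ i j, ContDiff ℝ ∞ (A i j)) (hh : ∀ i j m, ContDiff ℝ ∞ (h i j m)) (c l : Fin n)
    (x : Fin n → ℝ) :
    pd l (fun x => Xf (fun i j => A i j x) (fun i j m => h i j m x) c) x
      = Xf (fun i j => pd l (A i j) x) (fun i j m => h i j m x) c
        + Xf (fun i j => A i j x) (fun i j m => pd l (h i j m) x) c := by
  unfold Xf
  have s1 : ∀ a, ContDiff ℝ ∞ fun x => A a c x * ∑ i, h i i a x :=
    fun a => (hA a c).mul (sm_sum fun i => hh i i a)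
  have s2 : ∀ a, ContDiff ℝ ∞ fun x => ∑ b, A a b x * h b c a x :=
    fun a => sm_sum fun b => (hA a b).mul (hh b c a)
  have s3 := (sm_sum (s := Finset.univ) fun i => hA i i).mul (sm_sum (s := Finset.univ) fun i => hh i i c)
  have s4 : ∀ a, ContDiff ℝ ∞ fun x => ∑ b, A a b x * h a b c x :=
    fun a => sm_sum fun b => (hA a b).mul (hh a b c)
  have t1 := sm_sum (s := Finset.univ) s1
  have t2 := sm_sum (s := Finset.univ) s2
  have t4 := sm_sum (s := Finset.univ) s4
  have e0 : (fun x => -∑ a, A a c x * ∑ i, h i i a x) = fun x => (-1) * ∑ a, A a c x * ∑ i, h i i a x := by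
    ext x; ring
  rw [pd_sub (sm_diff ((t1.neg.add t2).add s3) x) (sm_diff t4 x),
    pd_add (sm_diff (t1.neg.add t2) x) (sm_diff s3 x), pd_add (sm_diff t1.neg x) (sm_diff t2 x),
    e0, pd_const_mul _ (sm_diff t1 x), pd_sum_sm s1, pd_sum_sm s2, pd_sum_sm s4,
    pd_mul_sm (sm_sum fun i => hA i i) (sm_sum fun i => hh i i c), pd_sum_sm fun i => hA i i,
    pd_sum_sm fun i => hh i i c]
  have q1 : ∀ a, pd l (fun x => A a c x * ∑ i, h i i a x) x = pd l (A a c) x * ∑ i, h i i a x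
      + A a c x * ∑ i, pd l (h i i a) x := by
    intro a
    rw [pd_mul_sm (hA a c) (sm_sum fun i => hh i i a), pd_sum_sm fun i => hh i i a]
  have q2 : ∀ a, pd l (fun x => ∑ b, A a b x * h b c a x) x = ∑ b, pd l (A a b) x * h b c a x
      + ∑ b, A a b x * pd l (h b c a) x := by
    intro a
    rw [pd_sum_sm fun b => (hA a b).mul (hh b c a), ← Finset.sum_add_distrib]
    exact Finset.sum_congr rfl fun b _ => pd_mul_sm (hA a b) (hh b c a) l x
  have q4 : ∀ a, pd l (fun x => ∑ b, A a b x * h a b c x) x = ∑ b, pd l (A a b) x * h a b c x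
      + ∑ b, A a b x * pd l (h a b c) x := by
    intro a
    rw [pd_sum_sm fun b => (hA a b).mul (hh a b c), ← Finset.sum_add_distrib]
    exact Finset.sum_congr rfl fun b _ => pd_mul_sm (hA a b) (hh a b c) l x
  simp only [q1, q2, q4, Finset.sum_add_distrib]
  ring

/-- Second variation of `σ₂`. -/
theorem lap_sigma {n : ℕ} {A : Fin n → Fin n → (Fin n → ℝ) → ℝ}
    (hA : ∀ i j, ContDiff ℝ ∞ (A i j)) (l : Fin n) (x : Fin n → ℝ) :
    (pd l (fun x => ((∑ i, A i i x) ^ 2 - fdot (fun i j => A i j x) (fun i j => A i j x)) / 2) x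
      = (∑ i, A i i x) * (∑ i, pd l (A i i) x)
        - fdot (fun i j => A i j x) (fun i j => pd l (A i j) x)) ∧
    (pd l (pd l (fun x => ((∑ i, A i i x) ^ 2 - fdot (fun i j => A i j x) (fun i j => A i j x)) / 2)) x
      = (∑ i, pd l (A i i) x) ^ 2 - fdot (fun i j => pd l (A i j) x) (fun i j => pd l (A i j) x)
        + ((∑ i, A i i x) * (∑ i, pd l (pd l (A i i)) x)
        - fdot (fun i j => A i j x) (fun i j => pd l (pd l (A i j)) x))) := by
  have st := sm_sum (s := Finset.univ) fun i => hA i i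
  have hD : ∀ i j, ContDiff ℝ ∞ (pd l (A i j)) := fun i j => contDiff_pd_top (hA i j)
  have sD := sm_sum (s := Finset.univ) fun i => hD i i
  have h1 : ∀ x, pd l (fun x => ((∑ i, A i i x) ^ 2 - fdot (fun i j => A i j x) (fun i j => A i j x)) / 2) x
      = (∑ i, A i i x) * (∑ i, pd l (A i i) x)
        - fdot (fun i j => A i j x) (fun i j => pd l (A i j) x) := by
    intro x
    have e : (fun x => ((∑ i, A i i x) ^ 2 - fdot (fun i j => A i j x) (fun i j => A i j x)) / 2)
      = fun x => (1 / 2) * ((∑ i, A i i x) * (∑ i, A i i x)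
        - fdot (fun i j => A i j x) (fun i j => A i j x)) := by ext x; ring
    rw [e, pd_const_mul _ (sm_diff ((st.mul st).sub (sm_fdot hA hA)) x),
      pd_sub (sm_diff (st.mul st) x) (sm_diff (sm_fdot hA hA) x), pd_mul_sm st st,
      pd_fdot hA hA, pd_sum_sm fun i => hA i i, fdot_comm (fun i j => pd l (A i j) x)]
    ring
  refine ⟨h1 x, ?_⟩
  rw [show pd l (fun x => ((∑ i, A i i x) ^ 2 - fdot (fun i j => A i j x) (fun i j => A i j x)) / 2)
    = _ from funext h1]
  rw [pd_sub (sm_diff (st.mul sD) x) (sm_diff (sm_fdot hA hD) x), pd_mul_sm st sD, pd_fdot hA hD,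
    pd_sum_sm fun i => hA i i, pd_sum_sm fun i => hD i i]
  ring

theorem integrable_tsupport {n : ℕ} {φ g : (Fin n → ℝ) → ℝ}
    (hφ : Continuous φ) (hc : HasCompactSupport φ) (hg : ∀ x ∈ tsupport φ, ContinuousAt g x) :
    Integrable (fun x => φ x * g x) :=
  (continuous_mul_tsupport hφ hg).integrable_of_hasCompactSupport hc.mul_right

open MeasureTheory Metric Set Matrix

open scoped ContDiff

theorem sm_two {n : ℕ} {f : (Fin n → ℝ) → ℝ} (hf : ContDiff ℝ ∞ f) : ContDiff ℝ 2 f := contDiff_infty.1 hf 2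

theorem sm_one {n : ℕ} {f : (Fin n → ℝ) → ℝ} (hf : ContDiff ℝ ∞ f) : ContDiff ℝ 1 f := contDiff_infty.1 hf 1

/-- Divergence of the vector field `T ∇v`. -/
theorem div_Tv {n : ℕ} {A : Fin n → Fin n → (Fin n → ℝ) → ℝ} {v : (Fin n → ℝ) → ℝ}
    (hA : ∀ i j, ContDiff ℝ ∞ (A i j)) (hv : ContDiff ℝ ∞ v) (x : Fin n → ℝ) :
    ∑ i, pd i (fun x => (∑ k, A k k x) * pd i v x - ∑ j, A i j x * pd j v x) x
      = ∑ j, (∑ k, pd j (A k k) x - ∑ i, pd i (A i j) x) * pd j v x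
        + ((∑ k, A k k x) * ∑ i, pd i (pd i v) x - ∑ i, ∑ j, A i j x * pd i (pd j v) x) := by
  have st := sm_sum (s := Finset.univ) fun i => hA i i
  have sv : ∀ i, ContDiff ℝ ∞ (pd i v) := fun i => contDiff_pd_top hv
  have h1 : ∀ i, pd i (fun x => (∑ k, A k k x) * pd i v x - ∑ j, A i j x * pd j v x) x
      = (∑ k, pd i (A k k) x) * pd i v x + (∑ k, A k k x) * pd i (pd i v) x
        - (∑ j, pd i (A i j) x * pd j v x + ∑ j, A i j x * pd i (pd j v) x) := by
    intro i
    rw [pd_sub (sm_diff (st.mul (sv i)) x) (sm_diff (sm_sum fun j => (hA i j).mul (sv j)) x),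
      pd_mul_sm st (sv i), pd_sum_sm fun j => (hA i j).mul (sv j), pd_sum_sm fun i => hA i i,
      ← Finset.sum_add_distrib]
    congr 1
    exact Finset.sum_congr rfl fun j _ => pd_mul_sm (hA i j) (sv j) i x
  simp only [h1, Finset.sum_sub_distrib, Finset.sum_add_distrib, sub_mul, Finset.mul_sum]
  simp only [Finset.sum_mul]
  rw [Finset.sum_comm (f := fun i j => pd i (A i j) x * pd j v x)]
  ring

theorem Tq_eq {n : ℕ} (A : Fin n → Fin n → ℝ) (ξ η : Fin n → ℝ) :
    Tq A ξ η = ∑ i, ξ i * ((∑ k, A k k) * η i - ∑ j, A i j * η j) := by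
  simp only [Tq, mul_sub, Finset.sum_sub_distrib, Finset.mul_sum]
  congr 1
  · exact Finset.sum_congr rfl fun i _ => by
      rw [Finset.sum_mul, Finset.sum_mul, Finset.mul_sum]
      exact Finset.sum_congr rfl fun j _ => by ring
  · exact Finset.sum_congr rfl fun i _ => Finset.sum_congr rfl fun j _ => by ring

set_option maxHeartbeats 1000000 in
/-- Quantitative estimate for smooth approximate solutions. -/
theorem lemS (n : ℕ) (K c0 : ℝ) (hn : 1 ≤ (n:ℝ)) (hK : 1 ≤ K) (hc0 : 0 < c0) :
    ∃ C : ℝ, 0 < C ∧ ∀ (s C₁ : ℝ) (φ u F v r : (Fin n → ℝ) → ℝ)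
      (Hf A : Fin n → Fin n → (Fin n → ℝ) → ℝ)
      (h : Fin n → Fin n → Fin n → (Fin n → ℝ) → ℝ) (b : Fin n → (Fin n → ℝ) → ℝ),
      1 ≤ s → ContDiff ℝ ∞ φ → HasCompactSupport φ → ContDiff ℝ ∞ u →
      (∀ i j, ContDiff ℝ ∞ (Hf i j)) → (∀ i j, Hf i j = Hf j i) →
      ContDiff ℝ ∞ F → (∀ i j m, ContDiff ℝ ∞ (h i j m)) →
      (∀ i j x, A i j x = pd i (pd j u) x - Hf i j x) →
      (∀ x, v x = lapl u x + C₁) →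
      (∀ x, r x = ((∑ i, A i i x) ^ 2 - fdot (fun i j => A i j x) (fun i j => A i j x)) / 2 - F x) →
      (∀ x ∈ tsupport φ, 1 / 2 ≤ v x ∧ 0 < ∑ i, A i i x ∧ |v x - ∑ i, A i i x| ≤ K ∧
        c0 ≤ ((∑ i, A i i x) ^ 2 - fdot (fun i j => A i j x) (fun i j => A i j x)) / 2 ∧
        (∀ l, |pd l F x| ≤ K * v x) ∧ (∀ i j, |Hf i j x| ≤ K) ∧
        (∀ i j, |pd i (pd j u) x| ≤ 2 * v x) ∧ (∀ i j m, |h i j m x| ≤ K) ∧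
        (∀ l i j m, |pd l (h i j m) x| ≤ K * v x) ∧
        (∀ l i j, |pd l (Hf i j) x - ∑ m, h i j m x * pd m (pd l u) x| ≤ K) ∧
        (∀ i j, |∑ l, pd l (pd l (Hf i j)) x - ∑ m, h i j m x * pd m v x| ≤ K * v x ^ 2) ∧
        (∀ m, |b m x| ≤ K) ∧
        |∑ l, pd l (pd l F) x - ∑ m, b m x * pd m v x| ≤ K * v x ^ 2) →
      c0 / (12 * K) * s * ∫ x, φ x ^ 2 * (v x ^ s * ∑ i, (pd i v x / v x) ^ 2)
        ≤ C * (∫ x, (φ x ^ 2 + ∑ i, pd i φ x ^ 2) * (v x ^ s * v x ^ 3))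
          + C * s * ∫ x, φ x ^ 2 * (v x ^ s * ∑ i, pd i r x ^ 2) := by
  obtain ⟨C, hC, hpt⟩ := lemS_point n K c0 hn hK hc0
  refine ⟨C, hC, ?_⟩
  intro s C₁ φ u F v r Hf A h b hs hφ hφc hu hHf hHs hF hh hA hv hr hyp
  have su2 : ∀ i j, ContDiff ℝ ∞ (pd i (pd j u)) := fun i j => contDiff_pd_top (contDiff_pd_top hu)
  have hA' : ∀ i j, A i j = fun x => pd i (pd j u) x - Hf i j x := fun i j => funext (hA i j)
  have sA : ∀ i j, ContDiff ℝ ∞ (A i j) := fun i j => by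
    rw [hA']; exact (su2 i j).sub (hHf i j)
  have hv' : v = fun x => lapl u x + C₁ := funext hv
  have sl : ContDiff ℝ ∞ (fun x => lapl u x) := by
    unfold lapl; exact sm_sum fun l => su2 l l
  have sv : ContDiff ℝ ∞ v := by rw [hv']; exact sl.add contDiff_const
  have svi : ∀ i, ContDiff ℝ ∞ (pd i v) := fun i => contDiff_pd_top sv
  have st := sm_sum (s := Finset.univ) fun i => sA i i
  set G : (Fin n → ℝ) → ℝ := fun x =>
    ((∑ i, A i i x) ^ 2 - fdot (fun i j => A i j x) (fun i j => A i j x)) / 2 with hG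
  have sG : ContDiff ℝ ∞ G := by
    have := ((st.pow 2).sub (sm_fdot sA sA)).div_const 2
    exact this
  have hr' : r = fun x => G x - F x := funext hr
  have sr : ContDiff ℝ ∞ r := by rw [hr']; exact sG.sub hF
  have sri : ∀ i, ContDiff ℝ ∞ (pd i r) := fun i => contDiff_pd_top sr
  have hvpos : ∀ x ∈ tsupport φ, 0 < v x := fun x hx => by
    have := (hyp x hx).1; linarith
  have svs : ∀ x ∈ tsupport φ, ContDiffAt ℝ ∞ (fun x => v x ^ s) x := fun x hx =>
    (sv.contDiffAt).rpow_const_of_ne (hvpos x hx).ne'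
  -- the vector field
  set V : Fin n → (Fin n → ℝ) → ℝ := fun i x =>
    ((∑ k, A k k x) * pd i v x - ∑ j, A i j x * pd j v x) - pd i r x
      - 1 / (s + 2) * (v x * Xf (fun i j => A i j x) (fun i j m => h i j m x) i) with hV
  have sT : ∀ i, ContDiff ℝ ∞ (fun x => (∑ k, A k k x) * pd i v x - ∑ j, A i j x * pd j v x) :=
    fun i => (st.mul (svi i)).sub (sm_sum fun j => (sA i j).mul (svi j))
  have sX : ∀ i, ContDiff ℝ ∞ (fun x => v x * Xf (fun i j => A i j x) (fun i j m => h i j m x) i) :=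
    fun i => sv.mul (sm_Xf sA hh i)
  have sV : ∀ i, ContDiff ℝ ∞ (V i) := fun i =>
    ((sT i).sub (sri i)).sub (contDiff_const.mul (sX i))
  set W : Fin n → (Fin n → ℝ) → ℝ := fun i x => φ x * (φ x * v x ^ s * V i x) with hW
  have sW : ∀ i, ContDiff ℝ ∞ (W i) := fun i => contDiff_mul_tsupport hφ fun x hx =>
    (hφ.contDiffAt.mul (svs x hx)).mul (sV i).contDiffAt
  have cW : ∀ i, HasCompactSupport (W i) := fun i => hφc.mul_right
  have hdiv := integral_div_eq_zero (W := W) (fun i => sm_one (sW i)) cW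
  have hcφ : Continuous φ := hφ.continuous
  have cpd : ∀ i, Continuous (pd i φ) := fun i => (contDiff_pd_top hφ).continuous
  have cvi : ∀ i, Continuous (pd i v) := fun i => (svi i).continuous
  have cri : ∀ i, Continuous (pd i r) := fun i => (sri i).continuous
  have cat : ∀ x ∈ tsupport φ, ContinuousAt (fun x => v x ^ s) x := fun x hx => (svs x hx).continuousAt
  have hts : tsupport (fun x => φ x ^ 2) ⊆ tsupport φ := by
    refine closure_mono ?_
    intro x hx hx0
    exact hx (by simp [hx0])
  have hc2 : HasCompactSupport (fun x => φ x ^ 2) :=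
    hφc.of_isClosed_subset (isClosed_tsupport _) hts
  have hts3 : tsupport (fun x => φ x ^ 2 + ∑ i, pd i φ x ^ 2) ⊆ tsupport φ := by
    refine closure_minimal ?_ (isClosed_tsupport φ)
    intro x hx
    by_contra hx0
    refine hx ?_
    simp [image_eq_zero_of_notMem_tsupport hx0, pd_eq_zero_of_notMem hx0]
  have hc3 : HasCompactSupport (fun x => φ x ^ 2 + ∑ i, pd i φ x ^ 2) :=
    hφc.of_isClosed_subset (isClosed_tsupport _) hts3
  have I1 : Integrable (fun x => φ x ^ 2 * (v x ^ s * ∑ i, (pd i v x / v x) ^ 2)) :=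
    integrable_tsupport (hcφ.pow 2) hc2 fun x hx => (cat x (hts hx)).mul
      (tendsto_finsetSum _ fun i _ => (((cvi i).continuousAt).div sv.continuous.continuousAt
        (hvpos x (hts hx)).ne').pow 2)
  have I2 : Integrable (fun x => (φ x ^ 2 + ∑ i, pd i φ x ^ 2) * (v x ^ s * v x ^ 3)) :=
    integrable_tsupport ((hcφ.pow 2).add (continuous_finsetSum _ fun i _ => (cpd i).pow 2)) hc3
      fun x hx => (cat x (hts3 hx)).mul (sv.continuous.continuousAt.pow 3)
  have I3 : Integrable (fun x => φ x ^ 2 * (v x ^ s * ∑ i, pd i r x ^ 2)) :=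
    integrable_tsupport (hcφ.pow 2) hc2 fun x hx => (cat x (hts hx)).mul
      (tendsto_finsetSum _ fun i _ => ((cri i).continuousAt).pow 2)
  have I4 : Integrable (fun x => ∑ i, pd i (W i) x) :=
    integrable_finsetSum _ fun i _ => ((contDiff_pd_top (sW i)).continuous).integrable_of_hasCompactSupport
      (hasCompactSupport_pd (cW i))
  have key : ∀ x, c0 / (12 * K) * s * (φ x ^ 2 * (v x ^ s * ∑ i, (pd i v x / v x) ^ 2))
      - C * ((φ x ^ 2 + ∑ i, pd i φ x ^ 2) * (v x ^ s * v x ^ 3))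
      - C * s * (φ x ^ 2 * (v x ^ s * ∑ i, pd i r x ^ 2)) ≤ ∑ i, pd i (W i) x := by
    intro x
    by_cases hx : x ∈ tsupport φ
    swap
    · have hW0 : ∀ i, pd i (W i) x = 0 := fun i => pd_eq_zero_of_notMem fun h' =>
        hx (tsupport_mul_subset_left h')
      simp [image_eq_zero_of_notMem_tsupport hx, pd_eq_zero_of_notMem hx, hW0]
    obtain ⟨y1, y2, y3, y4, y5, y6, y7, y8, y9, y10, y11, y12, y13⟩ := hyp x hx
    have hvx : 0 < v x := hvpos x hx
    have hP : 0 < v x ^ s := Real.rpow_pos_of_pos hvx s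
    have hAs : ∀ i j, A i j = A j i := fun i j => by
      rw [hA', hA', hHs, pd_comm (sm_two hu)]
    -- derivative of `W`
    have hWd : ∀ i, pd i (W i) x = v x ^ s * ((2 * φ x * pd i φ x + φ x ^ 2 * (s / v x) * pd i v x) * V i x
        + φ x ^ 2 * pd i (V i) x) := by
      intro i
      have d1 : DifferentiableAt ℝ (fun x => v x ^ s) x := (svs x hx).differentiableAt (by simp)
      have d2 : DifferentiableAt ℝ (fun y => φ y * v y ^ s) x := (sm_diff hφ x).mul d1
      have d3 : DifferentiableAt ℝ (fun y => φ y * v y ^ s * V i y) x := d2.mul (sm_diff (sV i) x)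
      rw [hW]
      simp only
      rw [pd_mul (sm_diff hφ x) d3, pd_mul d2 (sm_diff (sV i) x), pd_mul (sm_diff hφ x) d1,
        pd_rpow s (sm_diff sv x) hvx]
      ring
    have hVd : ∀ i, pd i (V i) x = pd i (fun x => (∑ k, A k k x) * pd i v x - ∑ j, A i j x * pd j v x) x
        - pd i (pd i r) x - 1 / (s + 2) * (pd i v x * Xf (fun i j => A i j x) (fun i j m => h i j m x) i
          + v x * (Xf (fun a b => pd i (A a b) x) (fun i j m => h i j m x) i
            + Xf (fun a b => A a b x) (fun a b c => pd i (h a b c) x) i)) := by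
      intro i
      rw [hV]
      simp only
      rw [pd_sub (sm_diff ((sT i).sub (sri i)) x) (sm_diff (contDiff_const.mul (sX i)) x),
        pd_sub (sm_diff (sT i) x) (sm_diff (sri i) x), pd_const_mul _ (sm_diff (sX i) x),
        pd_mul_sm sv (sm_Xf sA hh i), pd_Xf sA hh]
    have hpv : ∀ l, pd l v x = ∑ i, pd l (A i i) x + ∑ i, pd l (Hf i i) x := by
      intro l
      have e : v = fun x => ∑ i, (A i i x + Hf i i x) + C₁ := by
        ext y; rw [hv y]; simp [lapl, hA]
      rw [e, pd_add (sm_diff (sm_sum fun i => (sA i i).add (hHf i i)) x) (differentiableAt_const _),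
        pd_const, add_zero, pd_sum_sm fun i => (sA i i).add (hHf i i), ← Finset.sum_add_distrib]
      exact Finset.sum_congr rfl fun i _ => pd_add (sm_diff (sA i i) x) (sm_diff (hHf i i) x)
    have hpvv : ∀ i j, pd i (pd j v) x = ∑ l, pd l (pd l (A i j)) x + ∑ l, pd l (pd l (Hf i j)) x := by
      intro i j
      have c2 : ∀ {f : (Fin n → ℝ) → ℝ}, ContDiff ℝ ∞ f → ∀ a b, pd a (pd b f) = pd b (pd a f) :=
        fun hf a b => pd_comm (sm_two hf)
      have e1 : pd j v = fun y => ∑ l, pd l (pd l (pd j u)) y := by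
        ext y
        rw [hv', pd_add (sm_diff sl y) (differentiableAt_const _), pd_const, add_zero]
        simp only [lapl]
        rw [pd_sum_sm fun l => su2 l l]
        refine Finset.sum_congr rfl fun l _ => ?_
        rw [c2 (contDiff_pd_top hu) j l, c2 hu j l]
      have e2 : ∀ l, pd l (pd l (pd i (pd j u))) x = pd l (pd l (A i j)) x + pd l (pd l (Hf i j)) x := by
        intro l
        have : pd i (pd j u) = fun y => A i j y + Hf i j y := by ext y; rw [hA]; ring
        rw [this]
        have : pd l (fun y => A i j y + Hf i j y) = fun y => pd l (A i j) y + pd l (Hf i j) y := by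
          ext y; exact pd_add (sm_diff (sA i j) y) (sm_diff (hHf i j) y)
        rw [this]
        exact pd_add (sm_diff (contDiff_pd_top (sA i j)) x) (sm_diff (contDiff_pd_top (hHf i j)) x)
      rw [e1, pd_sum_sm fun l => contDiff_pd_top (contDiff_pd_top (contDiff_pd_top hu)),
        ← Finset.sum_add_distrib]
      refine Finset.sum_congr rfl fun l _ => ?_
      rw [← e2, c2 (contDiff_pd_top (contDiff_pd_top hu)) i l, c2 (contDiff_pd_top hu) i l]
    have hgl : ∀ l, (∑ i, A i i x) * (∑ i, pd l (A i i) x)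
        - fdot (fun i j => A i j x) (fun i j => pd l (A i j) x) = pd l F x + pd l r x := by
      intro l
      rw [← (lap_sigma sA l x).1, hr', pd_sub (sm_diff sG x) (sm_diff hF x)]
      ring
    have hgll : ∑ l, pd l (pd l G) x = ∑ l, pd l (pd l F) x + ∑ l, pd l (pd l r) x := by
      rw [← Finset.sum_add_distrib]
      refine Finset.sum_congr rfl fun l _ => ?_
      have : pd l r = fun y => pd l G y - pd l F y := by
        ext y; rw [hr', pd_sub (sm_diff sG y) (sm_diff hF y)]
      rw [this, pd_sub (sm_diff (contDiff_pd_top sG) x) (sm_diff (contDiff_pd_top hF) x)]; ring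
    have hfd : ∀ B : Fin n → Fin n → Fin n → ℝ, ∑ l, fdot (fun i j => A i j x) (B l)
        = ∑ i, ∑ j, A i j x * ∑ l, B l i j := by
      intro B
      simp only [fdot, Finset.mul_sum]
      rw [Finset.sum_comm]
      exact Finset.sum_congr rfl fun i _ => Finset.sum_comm
    have hT2 : (∑ k, A k k x) * ∑ i, pd i (pd i v) x - ∑ i, ∑ j, A i j x * pd i (pd j v) x
        = (∑ l, pd l (pd l F) x + ∑ l, pd l (pd l r) x)
          + ∑ l, (fdot (fun i j => pd l (A i j) x) (fun i j => pd l (A i j) x)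
              - (∑ i, pd l (A i i) x) ^ 2)
          + ((∑ k, A k k x) * ∑ i, (∑ l, pd l (pd l (Hf i i)) x)
            - ∑ i, ∑ j, A i j x * (∑ l, pd l (pd l (Hf i j)) x)) := by
      rw [← hgll]
      have e := Finset.sum_congr (rfl : (Finset.univ : Finset (Fin n)) = Finset.univ)
        fun l _ => (lap_sigma sA l x).2
      rw [show ∑ l, pd l (pd l G) x = _ from e]
      simp only [hpvv, Finset.sum_add_distrib, mul_add, Finset.sum_sub_distrib, ← Finset.mul_sum]
      rw [hfd, Finset.sum_comm (f := fun i l => pd l (pd l (A i i)) x)]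
      ring
    have hmain := hpt s (v x) (φ x) (∑ l, pd l (pd l F) x - ∑ m, b m x * pd m v x)
      (v x - ∑ i, A i i x) (G x) (∑ i, A i i x) (∑ l, pd l (pd l r) x) (∑ l, pd l (pd l F) x)
      ((∑ k, A k k x) * ∑ i, pd i (pd i v) x - ∑ i, ∑ j, A i j x * pd i (pd j v) x)
      (fun i j => A i j x) (fun i j => Hf i j x)
      (fun i j => ∑ l, pd l (pd l (Hf i j)) x - ∑ m, h i j m x * pd m v x)
      (fun i j => ∑ l, pd l (pd l (Hf i j)) x)
      (fun l i j => pd l (A i j) x) (fun i j m => h i j m x)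
      (fun i j l => pd l (Hf i j) x - ∑ m, h i j m x * pd m (pd l u) x)
      (fun l i j => pd l (Hf i j) x) (fun l i j m => pd l (h i j m) x)
      (fun l => pd l v x) (fun l => pd l φ x) (fun l => pd l r x) (fun m => b m x)
      (fun l => ∑ i, pd l (A i i) x) (fun l => pd l F x)
      (fun j => ∑ k, pd j (A k k) x - ∑ i, pd i (A i j) x)
      hs y1 y2 rfl (fun i j => by rw [hAs]) (by ring) y3 y4 (by rw [hG]; ring) hgl y5 y6
      (fun i j => by rw [hA]; simpa using y7 i j) y8 y9 (fun a b c => y10 c a b) y11 y12 y13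
      (fun l i j => by simp only [hA, sub_add_cancel]; ring) hpv
      (fun j => by
        have e1 : ∀ i, pd i (A i j) x = pd j (pd i (pd i u)) x - pd i (Hf i j) x := by
          intro i
          rw [hA', pd_sub (sm_diff (su2 i j) x) (sm_diff (hHf i j) x)]
          congr 1
          rw [pd_comm (sm_two hu) (i := i) (j := j),
            pd_comm (sm_two (contDiff_pd_top (i := i) hu)) (i := i) (j := j)]
        have e2 : ∀ i, pd j (A i i) x = pd j (pd i (pd i u)) x - pd j (Hf i i) x := by
          intro i
          rw [hA', pd_sub (sm_diff (su2 i i) x) (sm_diff (hHf i i) x)]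
        simp only [e1, e2, Finset.sum_sub_distrib]; ring)
      (fun i j => by ring) (by ring) hT2
    have hdV : ∑ i, pd i (V i) x = (∑ j, (∑ k, pd j (A k k) x - ∑ i, pd i (A i j) x) * pd j v x
        + ((∑ k, A k k x) * ∑ i, pd i (pd i v) x - ∑ i, ∑ j, A i j x * pd i (pd j v) x))
        - ∑ i, pd i (pd i r) x
        - 1 / (s + 2) * (∑ i, pd i v x * Xf (fun i j => A i j x) (fun i j m => h i j m x) i
          + ∑ i, (v x * Xf (fun a b => pd i (A a b) x) (fun i j m => h i j m x) i
            + v x * Xf (fun a b => A a b x) (fun a b c => pd i (h a b c) x) i)) := by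
      simp only [hVd, Finset.sum_sub_distrib, ← Finset.mul_sum, ← div_Tv sA sv,
        Finset.sum_add_distrib, mul_add]
    have hWs : ∑ i, pd i (W i) x = v x ^ s * (2 * φ x * ∑ i, pd i φ x * V i x
        + φ x ^ 2 * (s / v x) * ∑ i, pd i v x * V i x + φ x ^ 2 * ∑ i, pd i (V i) x) := by
      simp only [hWd, Finset.mul_sum, ← Finset.sum_add_distrib]
      exact Finset.sum_congr rfl fun i _ => by ring
    have hVq : ∀ ξ : Fin n → ℝ, ∑ i, ξ i * V i x = Tq (fun i j => A i j x) ξ (fun i => pd i v x)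
        - ∑ i, ξ i * pd i r x
        - 1 / (s + 2) * (v x * ∑ i, ξ i * Xf (fun i j => A i j x) (fun i j m => h i j m x) i) := by
      intro ξ
      rw [Tq_eq]
      simp only [Finset.mul_sum, ← Finset.sum_sub_distrib]
      refine Finset.sum_congr rfl fun i _ => ?_
      rw [hV]; simp only [Finset.mul_sum]; ring
    rw [hWs, hVq, hVq, hdV]
    have := mul_le_mul_of_nonneg_left hmain hP.le
    refine le_trans (le_of_eq ?_) (this.trans (le_of_eq ?_))
    · ring
    · field_simp; ring
  have hfin := integral_mono ((((I1.const_mul (c0 / (12 * K) * s)).sub (I2.const_mul C)).sub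
    (I3.const_mul (C * s)))) I4 key
  rw [hdiv] at hfin
  have e1 := integral_sub ((I1.const_mul (c0 / (12 * K) * s)).sub (I2.const_mul C)) (I3.const_mul (C * s))
  have e2 := integral_sub (I1.const_mul (c0 / (12 * K) * s)) (I2.const_mul C)
  simp only [Pi.sub_apply] at hfin e1 e2
  rw [e1, e2, integral_const_mul, integral_const_mul, integral_const_mul] at hfin
  linarith

open MeasureTheory Metric Set Matrix

open scoped ContDiff

/-- Sobolev and Hölder combined. -/
theorem sob_holder (n : ℕ) (hn : 3 ≤ n) : ∃ C : ℝ, 0 < C ∧ ∀ (U a k : (Fin n → ℝ) → ℝ),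
    ContDiff ℝ 1 U → HasCompactSupport U → AEStronglyMeasurable a → AEStronglyMeasurable k →
    (∀ x, 0 ≤ a x) → (∀ x, 0 ≤ k x) →
    (∀ x, ‖fderiv ℝ U x‖ ≤ a x * k x) →
    Integrable (fun x => a x ^ ((3:ℝ) * n)) → Integrable (fun x => k x ^ (2:ℝ)) →
    (∫ x, |U x| ^ (2 * ((3:ℝ) * n / (3 * n - 4)))) ^ ((2 * ((3:ℝ) * n / (3 * n - 4)))⁻¹)
      ≤ C * ((∫ x, a x ^ ((3:ℝ) * n)) ^ (((3:ℝ) * n)⁻¹) * (∫ x, k x ^ (2:ℝ)) ^ ((2:ℝ)⁻¹)) := by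
  have hn' : (3:ℝ) ≤ n := by exact_mod_cast hn
  have h4 : (0:ℝ) < 3 * n - 4 := by linarith
  have hβ : (0:ℝ) < 2 * ((3:ℝ) * n / (3 * n - 4)) := by positivity
  set p : NNReal := ⟨6 * n / (3 * n + 2), by positivity⟩ with hp
  set p' : NNReal := ⟨2 * ((3:ℝ) * n / (3 * n - 4)), hβ.le⟩ with hp'
  set t : NNReal := ⟨3 * n, by positivity⟩ with ht
  have pc : (p : ℝ) = 6 * n / (3 * n + 2) := rfl
  have p'c : (p' : ℝ) = 2 * ((3:ℝ) * n / (3 * n - 4)) := rfl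
  have tc : (t : ℝ) = 3 * n := rfl
  have t0 : t ≠ 0 := by rw [← NNReal.coe_ne_zero, tc]; positivity
  have p'0 : p' ≠ 0 := by rw [← NNReal.coe_ne_zero, p'c]; positivity
  have p0 : p ≠ 0 := by rw [← NNReal.coe_ne_zero, pc]; positivity
  have hol : ENNReal.HolderTriple (t : ENNReal) ((2:NNReal) : ENNReal) (p : ENNReal) := by
    refine ⟨?_⟩
    rw [← ENNReal.coe_inv t0, ← ENNReal.coe_inv two_ne_zero, ← ENNReal.coe_inv p0, ← ENNReal.coe_add,
      ENNReal.coe_inj, ← NNReal.coe_inj]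
    push_cast
    rw [tc, pc]
    field_simp
    ring
  set C0 := SNormLESNormFDerivOfEqConst ℝ (volume : Measure (Fin n → ℝ)) p with hC0
  refine ⟨C0 + 1, by positivity, ?_⟩
  intro U a k hU hUc ma mk ha hk hle ia ik
  have hsob := eLpNorm_le_eLpNorm_fderiv_of_eq (μ := (volume : Measure (Fin n → ℝ))) hU hUc
    (p := p) (p' := p') (by rw [← NNReal.coe_le_coe, pc]; push_cast; rw [le_div_iff₀ (by positivity)]; linarith)
    (by simp; omega) (by
      rw [NNReal.coe_inv, pc, p'c]; simp only [Module.finrank_fin_fun]; field_simp; ring)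
  have h1 : eLpNorm (fderiv ℝ U) p volume ≤ eLpNorm (fun x => a x * k x) p volume :=
    eLpNorm_mono fun x => by
      rw [Real.norm_of_nonneg (mul_nonneg (ha x) (hk x))]; exact hle x
  have h2 : eLpNorm (fun x => a x * k x) p volume
      ≤ eLpNorm a t volume * eLpNorm k (2:NNReal) volume := by
    have := eLpNorm_smul_le_mul_eLpNorm (p := (t:ENNReal)) (q := ((2:NNReal):ENNReal)) (r := (p:ENNReal)) mk ma
    exact this
  have ma' : MemLp a t volume := by
    rw [← integrable_norm_rpow_iff ma (by exact_mod_cast t0) ENNReal.coe_ne_top]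
    simpa [tc, Real.norm_of_nonneg (ha _)] using ia
  have mk' : MemLp k (2:NNReal) volume := by
    rw [← integrable_norm_rpow_iff mk (by simp) ENNReal.coe_ne_top]
    have : (fun x => ‖k x‖ ^ ((2:NNReal):ENNReal).toReal) = fun x => k x ^ (2:ℝ) := by
      ext x; rw [Real.norm_of_nonneg (hk x)]; simp
    rw [this]; exact ik
  have mU : MemLp U p' volume := hU.continuous.memLp_of_hasCompactSupport hUc
  have e1 := mU.eLpNorm_eq_integral_rpow_norm (by exact_mod_cast p'0) ENNReal.coe_ne_top
  have e2 := ma'.eLpNorm_eq_integral_rpow_norm (by exact_mod_cast t0) ENNReal.coe_ne_top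
  have e3 := mk'.eLpNorm_eq_integral_rpow_norm (by simp) ENNReal.coe_ne_top
  simp only [ENNReal.coe_toReal, p'c, tc, Real.norm_eq_abs, abs_of_nonneg (ha _), abs_of_nonneg (hk _),
    NNReal.coe_ofNat] at e1 e2 e3
  have h3 := hsob.trans (mul_le_mul_right (h1.trans h2) _)
  rw [e1, e2, e3, ← ENNReal.ofReal_mul (Real.rpow_nonneg (integral_nonneg fun x => Real.rpow_nonneg (ha x) _) _),
    ← ENNReal.ofReal_coe_nnreal, ← ENNReal.ofReal_mul (by positivity), ENNReal.ofReal_le_ofReal_iff] at h3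
  · refine h3.trans (mul_le_mul_of_nonneg_right (by linarith) ?_)
    exact mul_nonneg (Real.rpow_nonneg (integral_nonneg fun x => Real.rpow_nonneg (ha x) _) _)
      (Real.rpow_nonneg (integral_nonneg fun x => Real.rpow_nonneg (hk x) _) _)
  · exact mul_nonneg (by positivity) (mul_nonneg (Real.rpow_nonneg (integral_nonneg fun x => Real.rpow_nonneg (ha x) _) _)
      (Real.rpow_nonneg (integral_nonneg fun x => Real.rpow_nonneg (hk x) _) _))

theorem norm_fderiv_le_sum {n : ℕ} {U : (Fin n → ℝ) → ℝ} (x : Fin n → ℝ) :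
    ‖fderiv ℝ U x‖ ≤ ∑ i, |pd i U x| := by
  refine ContinuousLinearMap.opNorm_le_bound _ (Finset.sum_nonneg fun _ _ => abs_nonneg _) fun y => ?_
  have : y = ∑ i, y i • (Pi.single i 1 : Fin n → ℝ) := by
    ext j; simp [Finset.sum_apply, Pi.single_apply]
  conv_lhs => rw [this]
  rw [map_sum, Finset.sum_mul]
  refine (norm_sum_le _ _).trans (Finset.sum_le_sum fun i _ => ?_)
  rw [map_smul, norm_smul, mul_comm]
  exact mul_le_mul_of_nonneg_left (norm_le_pi_norm y i) (abs_nonneg _)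

theorem sq_sum_le {n : ℕ} (f g : Fin n → ℝ) (c : ℝ) :
    (∑ i, |f i + c * g i|) ^ 2 ≤ 2 * n * (∑ i, f i ^ 2 + c ^ 2 * ∑ i, g i ^ 2) := by
  have h1 := sq_sum_le_card_mul_sum_sq (s := Finset.univ) (f := fun i : Fin n => |f i + c * g i|)
  simp only [Finset.card_univ, Fintype.card_fin, sq_abs] at h1
  refine h1.trans ?_
  rw [mul_comm 2, mul_assoc]
  refine mul_le_mul_of_nonneg_left ?_ (by positivity)
  rw [Finset.mul_sum, ← Finset.sum_add_distrib, Finset.mul_sum]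
  exact Finset.sum_le_sum fun i _ => by nlinarith [sq_nonneg (f i - c * g i)]

/-- Weighted Sobolev inequality. -/
theorem sob_weighted (n : ℕ) (hn : 3 ≤ n) : ∃ C : ℝ, 0 < C ∧ ∀ (φ v : (Fin n → ℝ) → ℝ) (q : ℝ),
    1 ≤ q → ContDiff ℝ ∞ φ → HasCompactSupport φ → ContDiff ℝ ∞ v → (∀ x ∈ tsupport φ, 0 < v x) →
    (∫ x, (φ x ^ 2) ^ ((3:ℝ) * n / (3 * n - 4)) * v x ^ (((3:ℝ) * n / (3 * n - 4)) * q)) ^ (((3:ℝ) * n / (3 * n - 4))⁻¹)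
      ≤ C * (∫ x in tsupport φ, v x ^ ((3:ℝ) * n / 2)) ^ (2 * ((3:ℝ) * n)⁻¹) *
        ((∫ x, (∑ i, pd i φ x ^ 2) * v x ^ (q - 1))
          + q ^ 2 * ∫ x, φ x ^ 2 * (v x ^ (q - 1) * ∑ i, (pd i v x / v x) ^ 2)) := by
  obtain ⟨C, hC, hS⟩ := sob_holder n hn
  have hn' : (3:ℝ) ≤ n := by exact_mod_cast hn
  have h4 : (0:ℝ) < 3 * n - 4 := by linarith
  set β := (3:ℝ) * n / (3 * n - 4) with hβ
  have hβ0 : 0 < β := by rw [hβ]; positivity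
  refine ⟨C ^ 2 * (2 * n), by positivity, ?_⟩
  intro φ v q hq hφ hφc sv hv
  have svp : ∀ (s : ℝ), ∀ x ∈ tsupport φ, ContDiffAt ℝ ∞ (fun x => v x ^ s) x := fun s x hx =>
    (sv.contDiffAt).rpow_const_of_ne (hv x hx).ne'
  have cφ := hφ.continuous
  have cv := sv.continuous
  have cvi : ∀ i, Continuous (pd i v) := fun i => (contDiff_pd_top sv).continuous
  have cpi : ∀ i, Continuous (pd i φ) := fun i => (contDiff_pd_top hφ).continuous
  set U : (Fin n → ℝ) → ℝ := fun x => φ x * v x ^ (q / 2) with hU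
  set a : (Fin n → ℝ) → ℝ := (tsupport φ).indicator fun x => v x ^ ((1:ℝ) / 2) with ha
  set k : (Fin n → ℝ) → ℝ := fun x => ∑ i, |pd i φ x * v x ^ ((q - 1) / 2)
    + q / 2 * (φ x * (v x ^ ((q - 1) / 2) * (pd i v x / v x)))| with hk
  have hmt : MeasurableSet (tsupport φ) := (isClosed_tsupport φ).measurableSet
  have a0 : ∀ x, 0 ≤ a x := fun x => indicator_nonneg (fun x hx => Real.rpow_nonneg (hv x hx).le _) x
  have k0 : ∀ x, 0 ≤ k x := fun x => Finset.sum_nonneg fun _ _ => abs_nonneg _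
  have sU : ContDiff ℝ ∞ U := contDiff_mul_tsupport hφ (svp _)
  have ck : Continuous k := continuous_finsetSum _ fun i _ => by
    refine ((continuous_mul_tsupport (cpi i) fun x hx => (svp _ x (tsupport_pd_subset hx)).continuousAt).add
      (continuous_const.mul (continuous_mul_tsupport cφ fun x hx => (svp _ x hx).continuousAt.mul
        ((cvi i).continuousAt.div cv.continuousAt (hv x hx).ne')))).abs
  have ckc : HasCompactSupport k := by
    refine hφc.of_isClosed_subset (isClosed_tsupport _) (closure_minimal ?_ (isClosed_tsupport φ))
    intro x hx
    by_contra hx0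
    refine hx ?_
    simp [hk, image_eq_zero_of_notMem_tsupport hx0, pd_eq_zero_of_notMem hx0]
  have ea : (fun x => a x ^ ((3:ℝ) * n)) = (tsupport φ).indicator fun x => v x ^ ((3:ℝ) * n / 2) := by
    ext x
    by_cases hx : x ∈ tsupport φ
    · simp only [ha, indicator_of_mem hx]
      rw [← Real.rpow_mul (hv x hx).le]; congr 1; ring
    · simp only [ha, indicator_of_notMem hx]
      rw [Real.zero_rpow (by positivity)]
  have cvr : ∀ s : ℝ, 0 ≤ s → Continuous fun x => v x ^ s := fun s hs =>
    cv.rpow_const fun x => Or.inr hs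
  have ia : Integrable (fun x => a x ^ ((3:ℝ) * n)) := by
    rw [ea, integrable_indicator_iff hmt]
    exact ((cvr _ (by positivity)).continuousOn).integrableOn_compact hφc
  have ik : Integrable (fun x => k x ^ (2:ℝ)) := by
    simp only [Real.rpow_two]
    have := (ck.mul ck).integrable_of_hasCompactSupport (μ := volume) (ckc.mul_right)
    simp only [sq]; exact this
  have hfd : ∀ x, ‖fderiv ℝ U x‖ ≤ a x * k x := by
    intro x
    refine (norm_fderiv_le_sum x).trans ?_
    by_cases hx : x ∈ tsupport φ
    · have hvx := hv x hx
      simp only [ha, indicator_of_mem hx, hk]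
      rw [Finset.mul_sum]
      refine Finset.sum_le_sum fun i _ => le_of_eq ?_
      rw [← abs_of_nonneg (Real.rpow_nonneg hvx.le (1 / 2)), ← abs_mul]
      congr 1
      rw [hU, pd_mul (sm_diff hφ x) ((svp _ x hx).differentiableAt (by simp)), pd_rpow _ (sm_diff sv x) hvx]
      have : v x ^ (q / 2) = v x ^ ((1:ℝ) / 2) * v x ^ ((q - 1) / 2) := by
        rw [← Real.rpow_add hvx]; congr 1; ring
      rw [this]; ring
    · have : ∀ i, pd i U x = 0 := fun i => pd_eq_zero_of_notMem fun h => hx (tsupport_mul_subset_left h)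
      simp [this, ha, indicator_of_notMem hx]
  have main := hS U a k (sm_one sU) hφc.mul_right
    ((cvr _ (by norm_num)).aestronglyMeasurable.indicator hmt) ck.aestronglyMeasurable a0 k0 hfd ia ik
  have eU : (∫ x, |U x| ^ (2 * β)) = ∫ x, (φ x ^ 2) ^ β * v x ^ (β * q) := by
    refine integral_congr_ae (Filter.Eventually.of_forall fun x => ?_)
    simp only
    by_cases hx : x ∈ tsupport φ
    · have hvx := hv x hx
      rw [hU]
      simp only
      rw [Real.rpow_mul (abs_nonneg _), Real.rpow_two, sq_abs, mul_pow, Real.mul_rpow (sq_nonneg _) (sq_nonneg _)]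
      congr 1
      rw [← Real.rpow_two, ← Real.rpow_mul hvx.le, ← Real.rpow_mul hvx.le]; congr 1; ring
    · have h0 := image_eq_zero_of_notMem_tsupport hx
      simp only [hU, h0, zero_mul, abs_zero]
      rw [Real.zero_rpow (by positivity)]; simp [Real.zero_rpow hβ0.ne']
  have ea' : (∫ x, a x ^ ((3:ℝ) * n)) = ∫ x in tsupport φ, v x ^ ((3:ℝ) * n / 2) := by
    rw [ea, integral_indicator hmt]
  rw [eU, ea'] at main
  have I0 : 0 ≤ ∫ x, (φ x ^ 2) ^ β * v x ^ (β * q) := by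
    rw [← eU]; exact integral_nonneg fun x => Real.rpow_nonneg (abs_nonneg _) _
  have J0 : 0 ≤ ∫ x in tsupport φ, v x ^ ((3:ℝ) * n / 2) := by
    rw [← ea']; exact integral_nonneg fun x => Real.rpow_nonneg (a0 _) _
  have K0 : 0 ≤ ∫ x, k x ^ (2:ℝ) := integral_nonneg fun x => Real.rpow_nonneg (k0 x) _
  have hsq := pow_le_pow_left₀ (Real.rpow_nonneg I0 _) main 2
  rw [mul_pow, mul_pow, ← Real.rpow_two, ← Real.rpow_two (x := (∫ x, k x ^ (2:ℝ)) ^ (2:ℝ)⁻¹),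
    ← Real.rpow_two (x := (∫ x in tsupport φ, v x ^ ((3:ℝ) * n / 2)) ^ ((3:ℝ) * n)⁻¹),
    ← Real.rpow_mul I0, ← Real.rpow_mul K0, ← Real.rpow_mul J0] at hsq
  have e1 : (2 * β)⁻¹ * 2 = β⁻¹ := by field_simp
  rw [e1, inv_mul_cancel₀ two_ne_zero, Real.rpow_one, mul_comm (_⁻¹) (2:ℝ)] at hsq
  refine hsq.trans ?_
  have Ia : Integrable fun x => (∑ i, pd i φ x ^ 2) * v x ^ (q - 1) := by
    have := integrable_finsetSum (μ := volume) Finset.univ (f := fun (i : Fin n) x => pd i φ x * (pd i φ x * v x ^ (q - 1)))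
      fun i _ => integrable_tsupport (cpi i) (hasCompactSupport_pd hφc)
        fun x hx => ((cpi i).continuousAt).mul (svp _ x (tsupport_pd_subset hx)).continuousAt
    refine this.congr (Filter.Eventually.of_forall fun x => ?_)
    simp only [Finset.sum_mul]
    exact Finset.sum_congr rfl fun i _ => by ring
  have Ib : Integrable fun x => φ x ^ 2 * (v x ^ (q - 1) * ∑ i, (pd i v x / v x) ^ 2) := by
    have := integrable_tsupport (g := fun x => φ x * (v x ^ (q - 1) * ∑ i, (pd i v x / v x) ^ 2)) cφ hφc
      fun x hx => (cφ.continuousAt).mul ((svp (q - 1) x hx).continuousAt.mul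
        (tendsto_finsetSum _ fun i _ => ContinuousAt.tendsto (f := fun x => (pd i v x / v x) ^ 2)
          ((((cvi i).continuousAt).div cv.continuousAt (hv x hx).ne').pow 2)))
    refine this.congr (Filter.Eventually.of_forall fun x => ?_)
    simp only; ring
  have hkle : ∫ x, k x ^ (2:ℝ) ≤ 2 * n * ((∫ x, (∑ i, pd i φ x ^ 2) * v x ^ (q - 1))
      + q ^ 2 * ∫ x, φ x ^ 2 * (v x ^ (q - 1) * ∑ i, (pd i v x / v x) ^ 2)) := by
    rw [← integral_const_mul (q ^ 2), ← integral_add Ia (Ib.const_mul _), ← integral_const_mul]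
    refine integral_mono ik ((Ia.add (Ib.const_mul _)).const_mul _) fun x => ?_
    simp only [Real.rpow_two, Pi.add_apply]
    by_cases hx : x ∈ tsupport φ
    · refine (sq_sum_le _ _ _).trans ?_
      refine mul_le_mul_of_nonneg_left ?_ (by positivity)
      have hvx := hv x hx
      have e : (v x ^ ((q - 1) / 2)) ^ 2 = v x ^ (q - 1) := by
        rw [← Real.rpow_two, ← Real.rpow_mul hvx.le]; congr 1; ring
      simp only [mul_pow, e, ← Finset.sum_mul, ← Finset.mul_sum]
      have h5 : 0 ≤ φ x ^ 2 * (v x ^ (q - 1) * ∑ i, (pd i v x / v x) ^ 2) := by positivity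
      nlinarith
    · simp [hk, image_eq_zero_of_notMem_tsupport hx, pd_eq_zero_of_notMem hx]
  have := mul_le_mul_of_nonneg_left hkle
    (show 0 ≤ C ^ 2 * (∫ x in tsupport φ, v x ^ ((3:ℝ) * n / 2)) ^ (2 * ((3:ℝ) * n)⁻¹) from
      mul_nonneg (sq_nonneg _) (Real.rpow_nonneg J0 _))
  refine le_trans (le_of_eq ?_) (this.trans (le_of_eq ?_)) <;> ring

open MeasureTheory Metric Set Matrix

open scoped ContDiff

theorem smoothTransition_lip : ∃ L : ℝ, 0 < L ∧ ∀ s t : ℝ,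
    |Real.smoothTransition s - Real.smoothTransition t| ≤ L * |s - t| := by
  have hS : ContDiff ℝ 1 Real.smoothTransition := Real.smoothTransition.contDiff
  have hc : Continuous (deriv Real.smoothTransition) := hS.continuous_deriv (by norm_num)
  have hs : HasCompactSupport (deriv Real.smoothTransition) := by
    refine HasCompactSupport.intro (isCompact_Icc (a := (0:ℝ)) (b := 1)) ?_
    intro x hx
    rw [mem_Icc, not_and_or, not_le, not_le] at hx
    rcases hx with hx | hx
    · have : Real.smoothTransition =ᶠ[nhds x] fun _ => 0 := by
        filter_upwards [Iio_mem_nhds hx] with y hy using Real.smoothTransition.zero_of_nonpos (le_of_lt hy)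
      rw [this.deriv_eq]; simp
    · have : Real.smoothTransition =ᶠ[nhds x] fun _ => 1 := by
        filter_upwards [Ioi_mem_nhds hx] with y hy using Real.smoothTransition.one_of_one_le (le_of_lt hy)
      rw [this.deriv_eq]; simp
  obtain ⟨C, hC⟩ := hs.exists_bound_of_continuous hc
  have hC0 : 0 ≤ C := (norm_nonneg _).trans (hC 0)
  refine ⟨C + 1, by linarith, fun s t => ?_⟩
  have := Convex.norm_image_sub_le_of_norm_deriv_le (f := Real.smoothTransition) (C := C) (s := univ)
    (fun x _ => (hS.differentiable (by norm_num)) x) (fun x _ => hC x) convex_univ (mem_univ t) (mem_univ s)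
  rw [Real.norm_eq_abs, Real.norm_eq_abs] at this
  refine this.trans (mul_le_mul_of_nonneg_right (by linarith) (abs_nonneg _))

theorem prod_sub_prod_le {ι : Type*} (s : Finset ι) (a b : ι → ℝ)
    (ha : ∀ i, 0 ≤ a i ∧ a i ≤ 1) (hb : ∀ i, 0 ≤ b i ∧ b i ≤ 1) :
    |∏ i ∈ s, a i - ∏ i ∈ s, b i| ≤ ∑ i ∈ s, |a i - b i| := by
  classical
  induction s using Finset.induction_on with
  | empty => simp
  | insert i s hi ih =>
    rw [Finset.prod_insert hi, Finset.prod_insert hi, Finset.sum_insert hi]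
    have e : a i * ∏ j ∈ s, a j - b i * ∏ j ∈ s, b j
      = (a i - b i) * ∏ j ∈ s, a j + b i * (∏ j ∈ s, a j - ∏ j ∈ s, b j) := by ring
    rw [e]
    refine (abs_add_le _ _).trans (add_le_add ?_ ?_)
    · rw [abs_mul]
      refine mul_le_of_le_one_right (abs_nonneg _) ?_
      rw [abs_of_nonneg (Finset.prod_nonneg fun j _ => (ha j).1)]
      exact Finset.prod_le_one (fun j _ => (ha j).1) fun j _ => (ha j).2
    · rw [abs_mul, abs_of_nonneg (hb i).1]
      exact (mul_le_of_le_one_left (abs_nonneg _) (hb i).2).trans ih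

theorem cutoff (n : ℕ) : ∃ C : ℝ, 0 < C ∧ ∀ (x₀ : Fin n → ℝ) (r ρ : ℝ), 0 ≤ r → 0 < ρ →
    ∃ φ : (Fin n → ℝ) → ℝ, ContDiff ℝ ∞ φ ∧ HasCompactSupport φ ∧ tsupport φ ⊆ closedBall x₀ (r + ρ) ∧
      (∀ x ∈ closedBall x₀ r, φ x = 1) ∧ (∀ x, 0 ≤ φ x ∧ φ x ≤ 1) ∧
      (∀ i x, |pd i φ x| ≤ C / ρ) := by
  obtain ⟨L, hL, hLip⟩ := smoothTransition_lip
  refine ⟨n * (2 * L) + 1, by positivity, ?_⟩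
  intro x₀ r ρ hr hρ
  set a : Fin n → (Fin n → ℝ) → ℝ := fun i x => Real.smoothTransition ((r + ρ - (x i - x₀ i)) / ρ)
    * Real.smoothTransition ((r + ρ + (x i - x₀ i)) / ρ) with ha
  have hS : ContDiff ℝ ∞ Real.smoothTransition := Real.smoothTransition.contDiff
  have sa : ∀ i, ContDiff ℝ ∞ (a i) := fun i => by
    have h1 : ContDiff ℝ ∞ fun x : Fin n → ℝ => x i := contDiff_apply ℝ ℝ i
    exact (hS.comp ((contDiff_const.sub (h1.sub contDiff_const)).div_const ρ)).mul
      (hS.comp ((contDiff_const.add (h1.sub contDiff_const)).div_const ρ))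
  have a01 : ∀ i x, 0 ≤ a i x ∧ a i x ≤ 1 := fun i x =>
    ⟨mul_nonneg (Real.smoothTransition.nonneg _) (Real.smoothTransition.nonneg _),
      mul_le_one₀ (Real.smoothTransition.le_one _) (Real.smoothTransition.nonneg _) (Real.smoothTransition.le_one _)⟩
  have alip : ∀ i x y, |a i x - a i y| ≤ 2 * L / ρ * ‖x - y‖ := by
    intro i x y
    have h1 := norm_le_pi_norm (x - y) i
    rw [Real.norm_eq_abs, Pi.sub_apply] at h1
    have k1 := hLip ((r + ρ - (x i - x₀ i)) / ρ) ((r + ρ - (y i - x₀ i)) / ρ)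
    have k2 := hLip ((r + ρ + (x i - x₀ i)) / ρ) ((r + ρ + (y i - x₀ i)) / ρ)
    have e1 : (r + ρ - (x i - x₀ i)) / ρ - (r + ρ - (y i - x₀ i)) / ρ = -((x i - y i) / ρ) := by ring
    have e2 : (r + ρ + (x i - x₀ i)) / ρ - (r + ρ + (y i - x₀ i)) / ρ = (x i - y i) / ρ := by ring
    rw [e1, abs_neg, abs_div, abs_of_pos hρ] at k1
    rw [e2, abs_div, abs_of_pos hρ] at k2
    have k3 : L * (|x i - y i| / ρ) ≤ L * (‖x - y‖ / ρ) := by gcongr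
    have e : a i x - a i y = (Real.smoothTransition ((r + ρ - (x i - x₀ i)) / ρ)
        - Real.smoothTransition ((r + ρ - (y i - x₀ i)) / ρ)) * Real.smoothTransition ((r + ρ + (x i - x₀ i)) / ρ)
      + Real.smoothTransition ((r + ρ - (y i - x₀ i)) / ρ) * (Real.smoothTransition ((r + ρ + (x i - x₀ i)) / ρ)
        - Real.smoothTransition ((r + ρ + (y i - x₀ i)) / ρ)) := by rw [ha]; ring
    rw [e]
    refine (abs_add_le _ _).trans ?_
    rw [abs_mul, abs_mul, abs_of_nonneg (Real.smoothTransition.nonneg _), abs_of_nonneg (Real.smoothTransition.nonneg _)]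
    have m1 := mul_le_of_le_one_right (abs_nonneg (Real.smoothTransition ((r + ρ - (x i - x₀ i)) / ρ)
        - Real.smoothTransition ((r + ρ - (y i - x₀ i)) / ρ))) (Real.smoothTransition.le_one ((r + ρ + (x i - x₀ i)) / ρ))
    have m2 := mul_le_of_le_one_left (abs_nonneg (Real.smoothTransition ((r + ρ + (x i - x₀ i)) / ρ)
        - Real.smoothTransition ((r + ρ + (y i - x₀ i)) / ρ))) (Real.smoothTransition.le_one ((r + ρ - (y i - x₀ i)) / ρ))
    have e3 : 2 * L / ρ * ‖x - y‖ = L * (‖x - y‖ / ρ) + L * (‖x - y‖ / ρ) := by ring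
    rw [e3]; linarith
  have supp : Function.support (fun x => ∏ i, a i x) ⊆ closedBall x₀ (r + ρ) := by
    intro x hx
    rw [mem_closedBall, dist_pi_le_iff (by linarith)]
    intro i
    by_contra hlt
    refine hx ?_
    refine Finset.prod_eq_zero (Finset.mem_univ i) ?_
    rw [Real.dist_eq, not_le, lt_abs] at hlt
    rcases hlt with hlt | hlt
    · rw [ha]; simp only
      rw [Real.smoothTransition.zero_of_nonpos (x := (r + ρ - (x i - x₀ i)) / ρ)
        (div_nonpos_of_nonpos_of_nonneg (by linarith) hρ.le), zero_mul]
    · rw [ha]; simp only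
      rw [Real.smoothTransition.zero_of_nonpos (x := (r + ρ + (x i - x₀ i)) / ρ)
        (div_nonpos_of_nonpos_of_nonneg (by linarith) hρ.le), mul_zero]
  have tsupp : tsupport (fun x => ∏ i, a i x) ⊆ closedBall x₀ (r + ρ) :=
    closure_minimal supp isClosed_closedBall
  refine ⟨fun x => ∏ i, a i x, contDiff_prod fun i _ => sa i,
    (isCompact_closedBall x₀ (r + ρ)).of_isClosed_subset (isClosed_tsupport _) tsupp, tsupp, ?_, ?_, ?_⟩
  · intro x hx
    rw [mem_closedBall, dist_pi_le_iff hr] at hx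
    refine Finset.prod_eq_one fun i _ => ?_
    have := hx i
    rw [Real.dist_eq, abs_le] at this
    rw [ha]; simp only
    rw [Real.smoothTransition.one_of_one_le ((one_le_div hρ).2 (by linarith)),
      Real.smoothTransition.one_of_one_le ((one_le_div hρ).2 (by linarith)), one_mul]
  · intro x
    exact ⟨Finset.prod_nonneg fun i _ => (a01 i x).1, Finset.prod_le_one (fun i _ => (a01 i x).1) fun i _ => (a01 i x).2⟩
  · intro i x
    have hlip : LipschitzWith (Real.toNNReal (n * (2 * L) / ρ)) (fun x => ∏ i, a i x) := by
      refine LipschitzWith.of_dist_le_mul fun x y => ?_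
      rw [Real.dist_eq, dist_eq_norm, Real.coe_toNNReal _ (by positivity)]
      refine (prod_sub_prod_le _ _ _ (fun i => a01 i x) fun i => a01 i y).trans ?_
      refine (Finset.sum_le_sum fun i _ => alip i x y).trans (le_of_eq ?_)
      simp; ring
    have h1 := norm_fderiv_le_of_lipschitz ℝ hlip (x₀ := x)
    rw [Real.coe_toNNReal _ (by positivity)] at h1
    have h2 : ‖(Pi.single i 1 : Fin n → ℝ)‖ ≤ 1 := by
      rw [pi_norm_le_iff_of_nonneg zero_le_one]
      intro j
      by_cases hj : j = i
      · subst hj; simp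
      · simp [Pi.single_apply, hj]
    have h3 := (fderiv ℝ (fun x => ∏ i, a i x) x).le_opNorm_of_le h2
    rw [mul_one, Real.norm_eq_abs] at h3
    refine h3.trans (h1.trans ?_)
    gcongr
    linarith

open MeasureTheory Metric Set Matrix

open scoped ContDiff Convolution

section mollifier

variable {V : Type*} [NormedAddCommGroup V] [NormedSpace ℝ V] [FiniteDimensional ℝ V]
  [MeasureSpace V] [BorelSpace V] [(volume : Measure V).IsAddHaarMeasure]

/-- The standard bump of radius `1 / (j + 1)`. -/
noncomputable def bmp (V : Type*) [NormedAddCommGroup V] [NormedSpace ℝ V] (j : ℕ) : ContDiffBump (0 : V) where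
  rIn := 1 / (2 * ((j:ℝ) + 1))
  rOut := 1 / ((j:ℝ) + 1)
  rIn_pos := by positivity
  rIn_lt_rOut := by
    apply one_div_lt_one_div_of_lt <;> [positivity; linarith [(Nat.cast_nonneg j : (0:ℝ) ≤ j)]]

/-- The mollification kernel. -/
noncomputable def ker (V : Type*) [NormedAddCommGroup V] [NormedSpace ℝ V] [FiniteDimensional ℝ V]
    [MeasureSpace V] (j : ℕ) : V → ℝ := (bmp V j).normed volume

/-- Mollification. -/
noncomputable def mol (j : ℕ) (g : V → ℝ) (x : V) : ℝ := ∫ y, ker V j y * g (x - y)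

theorem mol_eq (j : ℕ) (g : V → ℝ) :
    mol j g = (ker V j ⋆[ContinuousLinearMap.lsmul ℝ ℝ, volume] g : V → ℝ) := rfl

theorem ker_nonneg (j : ℕ) (y : V) : 0 ≤ ker V j y := (bmp V j).nonneg_normed y

theorem ker_int (j : ℕ) : ∫ y, ker V j y = 1 := (bmp V j).integral_normed

theorem ker_smooth (j : ℕ) : ContDiff ℝ ∞ (ker V j) := (bmp V j).contDiff_normed

theorem ker_cpt (j : ℕ) : HasCompactSupport (ker V j) := (bmp V j).hasCompactSupport_normed

theorem ker_zero (j : ℕ) (y : V) (hy : 1 / ((j:ℝ) + 1) ≤ ‖y‖) : ker V j y = 0 := by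
  by_contra h
  have : y ∈ Function.support ((bmp V j).normed volume) := h
  rw [(bmp V j).support_normed_eq, mem_ball_zero_iff] at this
  exact absurd this (not_lt.2 hy)

theorem ker_integrable (j : ℕ) : Integrable (ker V j) :=
  (ker_smooth j).continuous.integrable_of_hasCompactSupport (ker_cpt j)

theorem mol_integrable (j : ℕ) {g : V → ℝ} (hg : Continuous g) (x : V) :
    Integrable (fun y => ker V j y * g (x - y)) :=
  ((ker_smooth j).continuous.mul (hg.comp (continuous_const.sub continuous_id))).integrable_of_hasCompactSupport
    (ker_cpt j).mul_right

theorem mol_smooth (j : ℕ) {g : V → ℝ} (hg : Continuous g) : ContDiff ℝ ∞ (mol j g) := by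
  rw [mol_eq]
  exact HasCompactSupport.contDiff_convolution_left _ (ker_cpt j) (ker_smooth j) hg.locallyIntegrable

theorem mol_add (j : ℕ) {g g' : V → ℝ} (hg : Continuous g) (hg' : Continuous g') (x : V) :
    mol j (fun y => g y + g' y) x = mol j g x + mol j g' x := by
  simp only [mol, mul_add]
  exact integral_add (mol_integrable j hg x) (mol_integrable j hg' x)

theorem mol_sub (j : ℕ) {g g' : V → ℝ} (hg : Continuous g) (hg' : Continuous g') (x : V) :
    mol j (fun y => g y - g' y) x = mol j g x - mol j g' x := by
  simp only [mol, mul_sub]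
  exact integral_sub (mol_integrable j hg x) (mol_integrable j hg' x)

theorem mol_const_mul (j : ℕ) (c : ℝ) (g : V → ℝ) (x : V) :
    mol j (fun y => c * g y) x = c * mol j g x := by
  simp only [mol, ← integral_const_mul]
  congr 1; ext y; ring

theorem mol_sum (j : ℕ) {ι : Type*} (s : Finset ι) {g : ι → V → ℝ} (hg : ∀ i, Continuous (g i)) (x : V) :
    mol j (fun y => ∑ i ∈ s, g i y) x = ∑ i ∈ s, mol j (g i) x := by
  simp only [mol, Finset.mul_sum]
  exact integral_finsetSum _ fun i _ => mol_integrable j (hg i) x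

theorem mol_const (j : ℕ) (c : ℝ) (x : V) : mol j (fun _ => c) x = c := by
  simp only [mol]; rw [integral_mul_const, ker_int, one_mul]

theorem mol_mono (j : ℕ) {g g' : V → ℝ} (hg : Continuous g) (hg' : Continuous g') (x : V)
    (h : ∀ y, ‖y‖ < 1 / ((j:ℝ) + 1) → g (x - y) ≤ g' (x - y)) : mol j g x ≤ mol j g' x := by
  refine integral_mono (mol_integrable j hg x) (mol_integrable j hg' x) fun y => ?_
  by_cases hy : ‖y‖ < 1 / ((j:ℝ) + 1)
  · exact mul_le_mul_of_nonneg_left (h y hy) (ker_nonneg j y)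
  · simp [ker_zero j y (not_lt.1 hy)]

theorem mol_abs_le (j : ℕ) {g : V → ℝ} (hg : Continuous g) (x : V) {c : ℝ}
    (h : ∀ y, ‖y‖ < 1 / ((j:ℝ) + 1) → |g (x - y)| ≤ c) : |mol j g x| ≤ c := by
  rw [abs_le]
  constructor
  · have := mol_mono j continuous_const hg x (g := fun _ => -c) fun y hy => (abs_le.1 (h y hy)).1
    rwa [mol_const] at this
  · have := mol_mono j hg continuous_const x (g' := fun _ => c) fun y hy => (abs_le.1 (h y hy)).2
    rwa [mol_const] at this

theorem mol_shift (j : ℕ) (g : V → ℝ) (a x : V) : mol j (fun y => g (y + a)) x = mol j g (x + a) := by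
  simp only [mol]
  congr 1; ext y; congr 2; abel

theorem mol_diff_le (j : ℕ) {g : V → ℝ} (hg : Continuous g) (x x' : V) {c : ℝ}
    (h : ∀ y, |g (x' - y) - g (x - y)| ≤ c) : |mol j g x' - mol j g x| ≤ c := by
  have e : mol j g x' = mol j (fun y => g (y + (x' - x))) x := by rw [mol_shift]; congr 1; abel
  have hc : Continuous fun y => g (y + (x' - x)) := hg.comp (continuous_id.add continuous_const)
  rw [e, ← mol_sub j hc hg]
  refine mol_abs_le j (hc.sub hg) x fun y _ => ?_
  show |g (x - y + (x' - x)) - g (x - y)| ≤ c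
  rw [show x - y + (x' - x) = x' - y by abel]
  exact h y

theorem mol_fderiv (j : ℕ) {g : V → ℝ} (hg : ContDiff ℝ 1 g) (hc : HasCompactSupport g) (x v : V) :
    fderiv ℝ (mol j g) x v = mol j (fun y => fderiv ℝ g y v) x := by
  have h := HasCompactSupport.hasFDerivAt_convolution_right (𝕜 := ℝ) (μ := (volume : Measure V))
    (ContinuousLinearMap.lsmul ℝ ℝ) hc (ker_smooth (V := V) j).continuous.locallyIntegrable hg x
  rw [mol_eq, h.fderiv, convolution_precompR_apply]
  · rfl
  · exact (ker_smooth j).continuous.locallyIntegrable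
  · exact hc.fderiv ℝ
  · exact hg.continuous_fderiv (by norm_num)

theorem mol_tendsto {g : V → ℝ} (hg : Continuous g) (hc : HasCompactSupport g) :
    ∀ δ > 0, ∃ J : ℕ, ∀ j ≥ J, ∀ x, |mol j g x - g x| ≤ δ := by
  intro δ hδ
  have hu := hc.uniformContinuous_of_continuous hg
  rw [Metric.uniformContinuous_iff] at hu
  obtain ⟨ε, hε, h⟩ := hu δ hδ
  obtain ⟨J, hJ⟩ := exists_nat_one_div_lt hε
  refine ⟨J, fun j hj x => ?_⟩
  have e : mol j g x - g x = mol j (fun y => g y - g x) x := by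
    rw [mol_sub j hg continuous_const, mol_const]
  rw [e]
  refine mol_abs_le j (hg.sub continuous_const) x fun y hy => ?_
  have hlt : ‖y‖ < ε := hy.trans_le (le_trans (one_div_le_one_div_of_le (by positivity)
    (by have : (J:ℝ) ≤ j := by exact_mod_cast hj
        linarith)) hJ.le)
  have := h (a := x - y) (b := x) (by simpa [dist_eq_norm] using hlt)
  rw [Real.dist_eq] at this
  exact this.le

/-- Jensen inequality for mollification. -/
theorem mol_sq_le (j : ℕ) {g : V → ℝ} (hg : Continuous g) (x : V) :
    mol j g x ^ 2 ≤ mol j (fun y => g y ^ 2) x := by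
  have h := mol_mono j continuous_const
    ((((hg.sub continuous_const)).pow 2)) x (g := fun _ => 0) (g' := fun y => (g y - mol j g x) ^ 2)
    fun y _ => sq_nonneg _
  rw [mol_const] at h
  have e : (fun y => (g y - mol j g x) ^ 2) = fun y => (g y ^ 2 - (2 * mol j g x) * g y) + mol j g x ^ 2 := by
    ext y; ring
  have c2 : Continuous fun y => g y ^ 2 := hg.pow 2
  have c3 : Continuous fun y => (2 * mol j g x) * g y := continuous_const.mul hg
  have c1 : Continuous fun y => g y ^ 2 - (2 * mol j g x) * g y := c2.sub c3
  rw [e, mol_add j c1 continuous_const, mol_const, mol_sub j c2 c3, mol_const_mul] at h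
  linarith

/-- Local `L¹` bound for mollification. -/
theorem mol_integral_le (j : ℕ) {g : V → ℝ} (hg : Continuous g) (hpos : ∀ x, 0 ≤ g x) {s t : Set V}
    (ht : IsCompact t) (hs : MeasurableSet s)
    (hst : ∀ x ∈ s, ∀ y, ‖y‖ < 1 / ((j:ℝ) + 1) → x - y ∈ t) :
    ∫ x in s, mol j g x ≤ ∫ x in t, g x := by
  have htm : MeasurableSet t := ht.isClosed.measurableSet
  have hi : Integrable (t.indicator g) := by
    rw [integrable_indicator_iff htm]; exact hg.continuousOn.integrableOn_compact ht
  have h1 := integral_convolution (μ := (volume : Measure V)) (ν := volume)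
    (ContinuousLinearMap.lsmul ℝ ℝ) (ker_integrable (V := V) j) hi
  have hintgr : Integrable (ker V j ⋆[ContinuousLinearMap.lsmul ℝ ℝ, volume] (t.indicator g) : V → ℝ) :=
    (ker_integrable (V := V) j).integrable_convolution _ hi
  have h2 : ∀ x ∈ s, mol j g x = mol j (t.indicator g) x := by
    intro x hx
    simp only [mol]
    congr 1; ext y
    by_cases hy : ‖y‖ < 1 / ((j:ℝ) + 1)
    · rw [indicator_of_mem (hst x hx y hy)]
    · simp [ker_zero j y (not_lt.1 hy)]
  rw [setIntegral_congr_fun hs h2, ← integral_indicator htm]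
  have h3 : ∫ x in s, mol j (t.indicator g) x ≤ ∫ x, mol j (t.indicator g) x := by
    refine setIntegral_le_integral hintgr (Filter.Eventually.of_forall fun x => ?_)
    exact integral_nonneg fun y => mul_nonneg (ker_nonneg j y) (indicator_nonneg (fun x _ => hpos x) _)
  refine h3.trans (le_of_eq ?_)
  rw [mol_eq, h1, ker_int]; simp

end mollifier

theorem mol_pd {n : ℕ} (j : ℕ) {g : (Fin n → ℝ) → ℝ} (hg : ContDiff ℝ 1 g) (hc : HasCompactSupport g)
    (i : Fin n) : pd i (mol j g) = mol j (pd i g) := by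
  ext x; exact mol_fderiv j hg hc x _

open MeasureTheory Metric Set Matrix
open scoped ContDiff

section cutdown
variable {V : Type*} [NormedAddCommGroup V] [NormedSpace ℝ V]

/-- Globally `C^{1,1}` with compact support and constant `L`. -/
structure C11c (G : V → ℝ) (L : ℝ) : Prop where
  cd : ContDiff ℝ 1 G
  cpt : HasCompactSupport G
  bd : ∀ y, |G y| ≤ L
  dbd : ∀ y, ‖fderiv ℝ G y‖ ≤ L
  lip : ∀ y z, ‖fderiv ℝ G y - fderiv ℝ G z‖ ≤ L * ‖y - z‖

theorem C11c.mono {G : V → ℝ} {L L' : ℝ} (h : C11c G L) (hL : L ≤ L') : C11c G L' :=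
  ⟨h.cd, h.cpt, fun y => (h.bd y).trans hL, fun y => (h.dbd y).trans hL, fun y z =>
    (h.lip y z).trans (mul_le_mul_of_nonneg_right hL (norm_nonneg _))⟩

/-- Locally `C^{1,1}` at a point. -/
def C11At (G : V → ℝ) (y : V) : Prop :=
  ∃ r > 0, ∃ K : ℝ, 0 ≤ K ∧ (∀ z ∈ ball y r, DifferentiableAt ℝ G z) ∧ (∀ z ∈ ball y r, |G z| ≤ K) ∧
    (∀ z ∈ ball y r, ‖fderiv ℝ G z‖ ≤ K) ∧ (∀ z ∈ ball y r, ∀ z' ∈ ball y r, |G z - G z'| ≤ K * ‖z - z'‖) ∧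
    ∀ z ∈ ball y r, ∀ z' ∈ ball y r, ‖fderiv ℝ G z - fderiv ℝ G z'‖ ≤ K * ‖z - z'‖

theorem C11At.mk' {G : V → ℝ} {y : V} {r K : ℝ} (hr : 0 < r) (hd : ∀ z ∈ ball y r, DifferentiableAt ℝ G z)
    (hl : ∀ z ∈ ball y r, ∀ z' ∈ ball y r, ‖fderiv ℝ G z - fderiv ℝ G z'‖ ≤ K * ‖z - z'‖) : C11At G y := by
  have hy : y ∈ ball y r := mem_ball_self hr
  set K1 := |K| with hK1
  have hK0 : 0 ≤ K1 := abs_nonneg _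
  have hKK : K ≤ K1 := le_abs_self _
  set K2 := ‖fderiv ℝ G y‖ + K1 * r with hK2
  have hK20 : 0 ≤ K2 := by positivity
  have b1 : ∀ z ∈ ball y r, ‖fderiv ℝ G z‖ ≤ K2 := by
    intro z hz
    have h1 := hl z hz y hy
    have h2 : ‖z - y‖ ≤ r := (mem_ball_iff_norm.1 hz).le
    have h3 : K * ‖z - y‖ ≤ K1 * r := mul_le_mul hKK h2 (norm_nonneg _) hK0
    have h4 := norm_le_norm_add_norm_sub' (fderiv ℝ G z) (fderiv ℝ G y)
    linarith
  have b2 : ∀ z ∈ ball y r, ∀ z' ∈ ball y r, |G z - G z'| ≤ K2 * ‖z - z'‖ := fun z hz z' hz' => by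
    have := (convex_ball y r).norm_image_sub_le_of_norm_fderiv_le hd b1 hz' hz
    rwa [Real.norm_eq_abs] at this
  set K3 := |G y| + K2 * r
  have b3 : ∀ z ∈ ball y r, |G z| ≤ K3 := by
    intro z hz
    have h1 := b2 z hz y hy
    have h2 : ‖z - y‖ ≤ r := (mem_ball_iff_norm.1 hz).le
    have h3 : K2 * ‖z - y‖ ≤ K2 * r := mul_le_mul_of_nonneg_left h2 hK20
    have h4 := abs_sub_abs_le_abs_sub (G z) (G y)
    simp only [K3]; linarith
  have hK3 : 0 ≤ K3 := by positivity
  refine ⟨r, hr, K1 + K2 + K3, by positivity, hd, fun z hz => (b3 z hz).trans (by linarith),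
    fun z hz => (b1 z hz).trans (by linarith), fun z hz z' hz' => (b2 z hz z' hz').trans ?_,
    fun z hz z' hz' => (hl z hz z' hz').trans ?_⟩ <;>
  exact mul_le_mul_of_nonneg_right (by linarith) (norm_nonneg _)

theorem C11At.congr {G G' : V → ℝ} {y : V} (h : C11At G y) (he : G' =ᶠ[nhds y] G) : C11At G' y := by
  obtain ⟨r, hr, K, hK, h1, h2, h3, h4, h5⟩ := h
  obtain ⟨r', hr', h0⟩ := Metric.eventually_nhds_iff_ball.1 he.eventually_nhds
  have h' : ∀ z ∈ ball y r', G' =ᶠ[nhds z] G := h0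
  have hs : ∀ z ∈ ball y (min r r'), z ∈ ball y r := fun z hz => ball_subset_ball (min_le_left _ _) hz
  have hs' : ∀ z ∈ ball y (min r r'), z ∈ ball y r' := fun z hz => ball_subset_ball (min_le_right _ _) hz
  refine C11At.mk' (r := min r r') (K := K) (lt_min hr hr') (fun z hz => ?_) fun z hz z' hz' => ?_
  · exact (h1 z (hs z hz)).congr_of_eventuallyEq (h' z (hs' z hz))
  · rw [(h' z (hs' z hz)).fderiv_eq, (h' z' (hs' z' hz')).fderiv_eq]
    exact h5 z (hs z hz) z' (hs z' hz')

theorem C11At.zero (y : V) : C11At (fun _ : V => (0:ℝ)) y :=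
  C11At.mk' (r := 1) (K := 0) one_pos (fun z _ => differentiableAt_const _) fun z _ z' _ => by simp

theorem C11At.mul {G G' : V → ℝ} {y : V} (h : C11At G y) (h' : C11At G' y) :
    C11At (fun z => G z * G' z) y := by
  obtain ⟨r, hr, K, hK, h1, h2, h3, h4, h5⟩ := h
  obtain ⟨r', hr', K', hK', h1', h2', h3', h4', h5'⟩ := h'
  have hs : ∀ z ∈ ball y (min r r'), z ∈ ball y r := fun z hz => ball_subset_ball (min_le_left _ _) hz
  have hs' : ∀ z ∈ ball y (min r r'), z ∈ ball y r' := fun z hz => ball_subset_ball (min_le_right _ _) hz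
  refine C11At.mk' (r := min r r') (K := 4 * (K * K')) (lt_min hr hr')
    (fun z hz => (h1 z (hs z hz)).mul (h1' z (hs' z hz))) fun z hz z' hz' => ?_
  have e : ∀ z ∈ ball y (min r r'), fderiv ℝ (fun z => G z * G' z) z = G z • fderiv ℝ G' z + G' z • fderiv ℝ G z :=
    fun z hz => fderiv_fun_mul (h1 z (hs z hz)) (h1' z (hs' z hz))
  rw [e z hz, e z' hz']
  have e2 : G z • fderiv ℝ G' z + G' z • fderiv ℝ G z - (G z' • fderiv ℝ G' z' + G' z' • fderiv ℝ G z')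
      = (G z • (fderiv ℝ G' z - fderiv ℝ G' z') + (G z - G z') • fderiv ℝ G' z')
        + (G' z • (fderiv ℝ G z - fderiv ℝ G z') + (G' z - G' z') • fderiv ℝ G z') := by
    simp only [smul_sub, sub_smul]; abel
  rw [e2]
  have n0 := norm_nonneg (z - z')
  have t1 : ‖G z • (fderiv ℝ G' z - fderiv ℝ G' z')‖ ≤ K * (K' * ‖z - z'‖) := by
    rw [norm_smul]; exact mul_le_mul (h2 z (hs z hz)) (h5' z (hs' z hz) z' (hs' z' hz')) (norm_nonneg _) hK
  have t2 : ‖(G z - G z') • fderiv ℝ G' z'‖ ≤ (K * ‖z - z'‖) * K' := by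
    rw [norm_smul]
    exact mul_le_mul (h4 z (hs z hz) z' (hs z' hz')) (h3' z' (hs' z' hz')) (norm_nonneg _) (by positivity)
  have t3 : ‖G' z • (fderiv ℝ G z - fderiv ℝ G z')‖ ≤ K' * (K * ‖z - z'‖) := by
    rw [norm_smul]; exact mul_le_mul (h2' z (hs' z hz)) (h5 z (hs z hz) z' (hs z' hz')) (norm_nonneg _) hK'
  have t4 : ‖(G' z - G' z') • fderiv ℝ G z'‖ ≤ (K' * ‖z - z'‖) * K := by
    rw [norm_smul]
    exact mul_le_mul (h4' z (hs' z hz) z' (hs' z' hz')) (h3 z' (hs z' hz')) (norm_nonneg _) (by positivity)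
  have := norm_add_le (G z • (fderiv ℝ G' z - fderiv ℝ G' z') + (G z - G z') • fderiv ℝ G' z')
    (G' z • (fderiv ℝ G z - fderiv ℝ G z') + (G' z - G' z') • fderiv ℝ G z')
  have := norm_add_le (G z • (fderiv ℝ G' z - fderiv ℝ G' z')) ((G z - G z') • fderiv ℝ G' z')
  have := norm_add_le (G' z • (fderiv ℝ G z - fderiv ℝ G z')) ((G' z - G' z') • fderiv ℝ G z')
  linarith

theorem C11At.of_smooth {G : V → ℝ} (h : ContDiff ℝ ∞ G) (y : V) : C11At G y := by
  have h1 : ContDiff ℝ 1 (fderiv ℝ G) := h.fderiv_right (by norm_cast)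
  obtain ⟨K, t, ht, hl⟩ := h1.contDiffAt.exists_lipschitzOnWith (x := y)
  obtain ⟨r, hr, hs⟩ := Metric.mem_nhds_iff.1 ht
  refine C11At.mk' (K := K) hr (fun z _ => (h.differentiable (by simp)) z) fun z hz z' hz' => ?_
  have := hl.dist_le_mul z (hs hz) z' (hs hz')
  rwa [dist_eq_norm, dist_eq_norm] at this

theorem C11At.of_on {G : V → ℝ} {s : Set V} (hs : IsOpen s) (h : C11On G s) {y : V} (hy : y ∈ s) :
    C11At G y := by
  obtain ⟨h1, h2⟩ := h
  obtain ⟨K, t, ht, hl⟩ := h2 y hy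
  rw [hs.nhdsWithin_eq hy] at ht
  obtain ⟨r, hr, hrt⟩ := Metric.mem_nhds_iff.1 (Filter.inter_mem ht (hs.mem_nhds hy))
  refine C11At.mk' (K := K) hr (fun z hz => ?_) fun z hz z' hz' => ?_
  · exact (h1.differentiableOn (by norm_num)).differentiableAt (hs.mem_nhds (hrt hz).2)
  · have := hl.dist_le_mul z (hrt hz).1 z' (hrt hz').1
    rwa [dist_eq_norm, dist_eq_norm, fderivWithin_of_isOpen hs (hrt hz).2,
      fderivWithin_of_isOpen hs (hrt hz').2] at this

theorem C11At.globalize [FiniteDimensional ℝ V] {G : V → ℝ} (h : ∀ y, C11At G y) (hc : HasCompactSupport G) :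
    ∃ L, 0 < L ∧ C11c G L := by
  have hd : Differentiable ℝ G := fun y => by
    obtain ⟨r, hr, K, hK, h1, h2, h3, h4, h5⟩ := h y; exact h1 y (mem_ball_self hr)
  have hll : LocallyLipschitz (fderiv ℝ G) := fun y => by
    obtain ⟨r, hr, K, hK, h1, h2, h3, h4, h5⟩ := h y
    refine ⟨⟨K, hK⟩, ball y r, ball_mem_nhds y hr, LipschitzOnWith.of_dist_le_mul fun z hz z' hz' => ?_⟩
    rw [dist_eq_norm, dist_eq_norm]; exact h5 z hz z' hz'
  have hcd : ContDiff ℝ 1 G := contDiff_one_iff_fderiv.2 ⟨hd, hll.continuous⟩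
  have hcd' := hc.fderiv ℝ
  obtain ⟨c1, hc1⟩ := hc.exists_bound_of_continuous hcd.continuous
  obtain ⟨c2, hc2⟩ := hcd'.exists_bound_of_continuous hll.continuous
  have hcp : IsCompact (cthickening 1 (tsupport (fderiv ℝ G))) := hcd'.isCompact.cthickening
  obtain ⟨K, hK⟩ := (hll.locallyLipschitzOn (s := cthickening 1 (tsupport (fderiv ℝ G)))).exists_lipschitzOnWith_of_compact hcp
  have c10 : 0 ≤ c1 := (norm_nonneg _).trans (hc1 0)
  have c20 : 0 ≤ c2 := (norm_nonneg _).trans (hc2 0)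
  have key : ∀ y ∈ tsupport (fderiv ℝ G), ∀ z, ‖fderiv ℝ G y - fderiv ℝ G z‖ ≤ (K + 2 * c2) * ‖y - z‖ := by
    intro y hy z
    by_cases hz : z ∈ cthickening 1 (tsupport (fderiv ℝ G))
    · have := hK.dist_le_mul y (self_subset_cthickening _ hy) z hz
      rw [dist_eq_norm, dist_eq_norm] at this
      refine this.trans (mul_le_mul_of_nonneg_right (by linarith) (norm_nonneg _))
    · have h1 : 1 ≤ ‖y - z‖ := by
        by_contra hlt
        push Not at hlt
        refine hz (mem_cthickening_of_dist_le z y 1 _ hy ?_)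
        rw [dist_comm, dist_eq_norm]; exact hlt.le
      have h2 := norm_sub_le (fderiv ℝ G y) (fderiv ℝ G z)
      have h3 := hc2 y
      have h4 := hc2 z
      have h5 : (K + 2 * c2) * 1 ≤ (K + 2 * c2) * ‖y - z‖ :=
        mul_le_mul_of_nonneg_left h1 (by positivity)
      have : (0:ℝ) ≤ K := K.2
      linarith
  refine ⟨c1 + c2 + (K + 2 * c2) + 1, by positivity, hcd, hc, fun y => ?_, fun y => ?_, fun y z => ?_⟩
  · have := hc1 y; rw [Real.norm_eq_abs] at this
    have : (0:ℝ) ≤ K := K.2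
    linarith
  · have := hc2 y
    have : (0:ℝ) ≤ K := K.2
    linarith
  · have hle : (K + 2 * c2) * ‖y - z‖ ≤ (c1 + c2 + (K + 2 * c2) + 1) * ‖y - z‖ :=
      mul_le_mul_of_nonneg_right (by linarith) (norm_nonneg _)
    by_cases hy : y ∈ tsupport (fderiv ℝ G)
    · exact (key y hy z).trans hle
    · by_cases hz : z ∈ tsupport (fderiv ℝ G)
      · rw [norm_sub_rev, norm_sub_rev y z]
        rw [norm_sub_rev y z] at hle
        exact (key z hz y).trans hle
      · rw [image_eq_zero_of_notMem_tsupport hy, image_eq_zero_of_notMem_tsupport hz]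
        simp only [sub_self, norm_zero]
        have : (0:ℝ) ≤ K := K.2
        positivity

/-- Multiplying a locally `C^{1,1}` function by a smooth cutoff. -/
theorem C11At.cut {G χ : V → ℝ} {s : Set V} (hs : IsOpen s) (h : C11On G s) (hχ : ContDiff ℝ ∞ χ)
    (hsup : tsupport χ ⊆ s) (y : V) : C11At (fun z => χ z * G z) y := by
  by_cases hy : y ∈ tsupport χ
  · exact (C11At.of_smooth hχ y).mul (C11At.of_on hs h (hsup hy))
  · refine (C11At.zero y).congr ?_
    have := notMem_tsupport_iff_eventuallyEq.1 hy
    filter_upwards [this] with z hz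
    rw [hz]; simp

end cutdown

open MeasureTheory Metric Set Matrix
open scoped ContDiff

/-- The jet map. -/
noncomputable def gam {n : ℕ} (u : (Fin n → ℝ) → ℝ) (x : Fin n → ℝ) : (Fin n → ℝ) × ℝ × (Fin n → ℝ) :=
  (x, u x, fun m => pd m u x)

/-- Partial derivative of the jet map. -/
noncomputable def dgam {n : ℕ} (u : (Fin n → ℝ) → ℝ) (l : Fin n) (x : Fin n → ℝ) :
    (Fin n → ℝ) × ℝ × (Fin n → ℝ) :=
  (Pi.single l 1, pd l u x, fun m => pd l (pd m u) x)

theorem gam_diff {n : ℕ} {u : (Fin n → ℝ) → ℝ} (hu : ContDiff ℝ 2 u) : ContDiff ℝ 1 (gam u) := by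
  refine contDiff_id.prodMk ((hu.of_le (by norm_num)).prodMk (contDiff_pi.2 fun m => ?_))
  exact contDiff_pd hu (k := 1) (by norm_num)

theorem gam_smooth {n : ℕ} {u : (Fin n → ℝ) → ℝ} (hu : ContDiff ℝ ∞ u) : ContDiff ℝ ∞ (gam u) := by
  refine contDiff_id.prodMk (hu.prodMk (contDiff_pi.2 fun m => ?_))
  exact contDiff_pd_top hu

theorem fderiv_gam {n : ℕ} {u : (Fin n → ℝ) → ℝ} (hu : ContDiff ℝ 2 u) (x : Fin n → ℝ) (l : Fin n) :
    fderiv ℝ (gam u) x (Pi.single l 1) = dgam u l x := by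
  have h1 : HasFDerivAt u (fderiv ℝ u x) x := ((hu.differentiable (by norm_num)) x).hasFDerivAt
  have h2 : HasFDerivAt (fun y => fun m => pd m u y) (ContinuousLinearMap.pi fun m => fderiv ℝ (pd m u) x) x :=
    hasFDerivAt_pi.2 fun m => (((contDiff_pd hu (k := 1) (by norm_num)).differentiable (by norm_num)) x).hasFDerivAt
  have h3 := (hasFDerivAt_id x).prodMk (h1.prodMk h2)
  have : fderiv ℝ (gam u) x = _ := h3.fderiv
  rw [this]
  rfl

theorem pd_comp_gam {n : ℕ} {u : (Fin n → ℝ) → ℝ} (hu : ContDiff ℝ 2 u)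
    {G : (Fin n → ℝ) × ℝ × (Fin n → ℝ) → ℝ} (hG : ContDiff ℝ 1 G) (l : Fin n) (x : Fin n → ℝ) :
    pd l (fun y => G (gam u y)) x = fderiv ℝ G (gam u x) (dgam u l x) := by
  rw [← fderiv_gam hu]
  have h := fderiv_comp x ((hG.differentiable (by norm_num)) (gam u x)) ((gam_diff hu).differentiable (by norm_num) x)
  unfold pd
  rw [show (fun y => G (gam u y)) = G ∘ gam u from rfl, h]
  rfl

theorem dgam_decomp {n : ℕ} (u : (Fin n → ℝ) → ℝ) (l : Fin n) (x : Fin n → ℝ) :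
    dgam u l x = (Pi.single l 1, 0, 0) + pd l u x • (0, 1, 0)
      + ∑ m, pd l (pd m u) x • ((0, 0, Pi.single m 1) : (Fin n → ℝ) × ℝ × (Fin n → ℝ)) := by
  have e : ∑ m, pd l (pd m u) x • ((0, 0, Pi.single m 1) : (Fin n → ℝ) × ℝ × (Fin n → ℝ))
      = (0, 0, fun m => pd l (pd m u) x) := by
    refine Prod.ext ?_ (Prod.ext ?_ ?_)
    · simp [Prod.fst_sum]
    · simp [Prod.fst_sum, Prod.snd_sum]
    · ext k
      simp [Prod.snd_sum, Finset.sum_apply, Pi.single_apply]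
  rw [e]; simp [dgam]

theorem pd_comp_gam' {n : ℕ} {u : (Fin n → ℝ) → ℝ} (hu : ContDiff ℝ 2 u)
    {G : (Fin n → ℝ) × ℝ × (Fin n → ℝ) → ℝ} (hG : ContDiff ℝ 1 G) (l : Fin n) (x : Fin n → ℝ) :
    pd l (fun y => G (gam u y)) x = fderiv ℝ G (gam u x) (Pi.single l 1, 0, 0)
      + pd l u x * fderiv ℝ G (gam u x) (0, 1, 0)
      + ∑ m, pd l (pd m u) x * fderiv ℝ G (gam u x) (0, 0, Pi.single m 1) := by
  rw [pd_comp_gam hu hG, dgam_decomp]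
  simp only [map_add, map_sum, map_smul, smul_eq_mul]

theorem norm_single_le {n : ℕ} (l : Fin n) : ‖(Pi.single l 1 : Fin n → ℝ)‖ ≤ 1 := by
  rw [Pi.norm_single]; simp

theorem norm_e1 {n : ℕ} (l : Fin n) : ‖((Pi.single l 1, 0, 0) : (Fin n → ℝ) × ℝ × (Fin n → ℝ))‖ ≤ 1 := by
  simp [Prod.norm_def, Pi.norm_single]

theorem norm_e2 {n : ℕ} : ‖((0, 1, 0) : (Fin n → ℝ) × ℝ × (Fin n → ℝ))‖ ≤ 1 := by
  simp [Prod.norm_def]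

theorem norm_e3 {n : ℕ} (l : Fin n) : ‖((0, 0, Pi.single l 1) : (Fin n → ℝ) × ℝ × (Fin n → ℝ))‖ ≤ 1 := by
  simp [Prod.norm_def, Pi.norm_single]

theorem norm_dgam_le {n : ℕ} (u : (Fin n → ℝ) → ℝ) (l : Fin n) (x : Fin n → ℝ) {c : ℝ} (h1 : 1 ≤ c)
    (h2 : |pd l u x| ≤ c) (h3 : ∀ m, |pd l (pd m u) x| ≤ c) : ‖dgam u l x‖ ≤ c := by
  unfold dgam
  rw [Prod.norm_def, Prod.norm_def]
  refine max_le ((norm_single_le l).trans h1) (max_le h2 ?_)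
  exact (pi_norm_le_iff_of_nonneg (by linarith)).2 h3

theorem abs_apply_le {V : Type*} [NormedAddCommGroup V] [NormedSpace ℝ V] (g : V →L[ℝ] ℝ) (e : V) {L c : ℝ}
    (hg : ‖g‖ ≤ L) (he : ‖e‖ ≤ c) : |g e| ≤ L * c := by
  have := g.le_opNorm e
  rw [Real.norm_eq_abs] at this
  exact this.trans (mul_le_mul hg he (norm_nonneg _) ((norm_nonneg _).trans hg))

theorem smooth_dir {V : Type*} [NormedAddCommGroup V] [NormedSpace ℝ V] {G : V → ℝ} (hG : ContDiff ℝ ∞ G)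
    (e : V) : ContDiff ℝ ∞ (fun y => fderiv ℝ G y e) :=
  (hG.fderiv_right (m := ∞) (by norm_cast)).clm_apply contDiff_const

/-- Derivative bounds along the jet map. -/
theorem chain_bounds {n : ℕ} {G : (Fin n → ℝ) × ℝ × (Fin n → ℝ) → ℝ} (hG : ContDiff ℝ ∞ G)
    {L : ℝ} (hL1 : ∀ y, ‖fderiv ℝ G y‖ ≤ L) (hL2 : ∀ e, ‖e‖ ≤ 1 → ∀ y, ‖fderiv ℝ (fun z => fderiv ℝ G z e) y‖ ≤ L)
    {u : (Fin n → ℝ) → ℝ} (hu : ContDiff ℝ ∞ u) (x : Fin n → ℝ) {v M C₁ : ℝ} (hM : 0 ≤ M) (hC₁ : |C₁| ≤ M)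
    (hv : 1 / 2 ≤ v) (hv' : v = lapl u x + C₁) (h1 : ∀ l, |pd l u x| ≤ M) (h2 : ∀ l m, |pd l (pd m u) x| ≤ 2 * v) :
    (∀ m, |fderiv ℝ G (gam u x) (0, 0, Pi.single m 1)| ≤ L) ∧
    (∀ l m, |pd l (fun y => fderiv ℝ G (gam u y) (0, 0, Pi.single m 1)) x| ≤ L * (2 * M + 2) * v) ∧
    (∀ l, |pd l (fun y => G (gam u y)) x - ∑ m, fderiv ℝ G (gam u x) (0, 0, Pi.single m 1) * pd m (pd l u) x|
      ≤ L * (1 + M)) ∧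
    (∀ l, |pd l (fun y => G (gam u y)) x| ≤ L * (2 * M + 2) * v) ∧
    |(∑ l, pd l (pd l (fun y => G (gam u y))) x)
      - ∑ m, fderiv ℝ G (gam u x) (0, 0, Pi.single m 1) * pd m (lapl u) x| ≤
        (n * (L * (2 * M + 2) * (2 + 2 * M + 2 * n)) + 2 * L * (1 + 2 * M)) * v ^ 2 := by
  have hu2 : ContDiff ℝ 2 u := contDiff_infty.1 hu 2
  have hL : 0 ≤ L := (norm_nonneg _).trans (hL1 0)
  have hMv : M ≤ M * (2 * v) := by nlinarith
  have hdg : ∀ l, ‖dgam u l x‖ ≤ (2 * M + 2) * v := fun l => by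
    refine norm_dgam_le u l x (by nlinarith) ((h1 l).trans (by nlinarith)) fun m => (h2 l m).trans (by nlinarith)
  have hcomp : ∀ e, ‖e‖ ≤ 1 → ∀ l, |pd l (fun y => fderiv ℝ G (gam u y) e) x| ≤ L * (2 * M + 2) * v := by
    intro e he l
    rw [pd_comp_gam hu2 (G := fun y => fderiv ℝ G y e) ((smooth_dir hG e).of_le (by norm_cast)) l x, mul_assoc]
    exact abs_apply_le _ _ (hL2 e he _) (hdg l)
  have hG1 : ContDiff ℝ 1 G := hG.of_le (by norm_cast)
  refine ⟨fun m => ?_, fun l m => hcomp _ (norm_e3 m) l, fun l => ?_, fun l => ?_, ?_⟩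
  · simpa using abs_apply_le _ _ (hL1 _) (norm_e3 m)
  · rw [pd_comp_gam' hu2 hG1]
    have e : ∀ m, pd l (pd m u) x = pd m (pd l u) x := fun m => congrFun (pd_comm hu2) x
    simp only [e]
    have e2 : ∑ m, pd m (pd l u) x * fderiv ℝ G (gam u x) (0, 0, Pi.single m 1)
        = ∑ m, fderiv ℝ G (gam u x) (0, 0, Pi.single m 1) * pd m (pd l u) x :=
      Finset.sum_congr rfl fun m _ => mul_comm _ _
    rw [e2, add_sub_cancel_right]
    have a1 := abs_apply_le _ _ (hL1 (gam u x)) (norm_e1 l)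
    have a2 := abs_apply_le _ _ (hL1 (gam u x)) (norm_e2 (n := n))
    refine (abs_add_le _ _).trans ?_
    rw [abs_mul]
    have := mul_le_mul (h1 l) a2 (abs_nonneg _) hM
    linarith
  · rw [pd_comp_gam hu2 hG1, mul_assoc]
    exact abs_apply_le _ _ (hL1 _) (hdg l)
  · -- second derivatives
    have s1 : ∀ e, ContDiff ℝ ∞ (fun y => fderiv ℝ G (gam u y) e) := fun e =>
      (smooth_dir hG e).comp (gam_smooth hu)
    have d1 : ∀ e, Differentiable ℝ (fun y => fderiv ℝ G (gam u y) e) := fun e =>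
      (s1 e).differentiable (by simp)
    have su : ∀ l, ContDiff ℝ ∞ (pd l u) := fun l => contDiff_pd_top hu
    have suu : ∀ l m, ContDiff ℝ ∞ (pd l (pd m u)) := fun l m => contDiff_pd_top (su m)
    have E : ∀ l, pd l (pd l (fun y => G (gam u y))) x =
        (pd l (fun y => fderiv ℝ G (gam u y) (Pi.single l 1, 0, 0)) x
        + (pd l (pd l u) x * fderiv ℝ G (gam u x) (0, 1, 0)
          + pd l u x * pd l (fun y => fderiv ℝ G (gam u y) (0, 1, 0)) x)
        + ∑ m, pd l (pd m u) x * pd l (fun y => fderiv ℝ G (gam u y) (0, 0, Pi.single m 1)) x)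
        + ∑ m, pd l (pd l (pd m u)) x * fderiv ℝ G (gam u x) (0, 0, Pi.single m 1) := by
      intro l
      have e1 : pd l (fun y => G (gam u y)) = fun y => fderiv ℝ G (gam u y) (Pi.single l 1, 0, 0)
        + pd l u y * fderiv ℝ G (gam u y) (0, 1, 0)
        + ∑ m, pd l (pd m u) y * fderiv ℝ G (gam u y) (0, 0, Pi.single m 1) := by
        ext y; exact pd_comp_gam' hu2 hG1 l y
      rw [e1]
      have t1 : ContDiff ℝ ∞ (fun y => pd l u y * fderiv ℝ G (gam u y) (0, 1, 0)) := (su l).mul (s1 _)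
      have t2 : ContDiff ℝ ∞ (fun y => fderiv ℝ G (gam u y) (Pi.single l 1, 0, 0)
        + pd l u y * fderiv ℝ G (gam u y) (0, 1, 0)) := (s1 _).add t1
      have t3 : ∀ m, ContDiff ℝ ∞ (fun y => pd l (pd m u) y * fderiv ℝ G (gam u y) (0, 0, Pi.single m 1)) :=
        fun m => (suu l m).mul (s1 _)
      rw [pd_add (sm_diff t2 x) (sm_diff (sm_sum t3) x), pd_add (sm_diff (s1 _) x) (sm_diff t1 x),
        pd_mul_sm (su l) (s1 _), pd_sum_sm t3]
      have e2 : ∀ m, pd l (fun y => pd l (pd m u) y * fderiv ℝ G (gam u y) (0, 0, Pi.single m 1)) x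
        = pd l (pd l (pd m u)) x * fderiv ℝ G (gam u x) (0, 0, Pi.single m 1)
          + pd l (pd m u) x * pd l (fun y => fderiv ℝ G (gam u y) (0, 0, Pi.single m 1)) x :=
        fun m => by rw [pd_mul_sm (suu l m) (s1 _)]
      simp only [e2, Finset.sum_add_distrib]
      ring
    have E3 : ∀ l m, pd l (pd l (pd m u)) x = pd m (pd l (pd l u)) x := fun l m => by
      rw [pd_comm hu2 (i := l) (j := m), pd_comm (sm_two (su l)) (i := l) (j := m)]
    have E4 : ∀ m, pd m (lapl u) x = ∑ l, pd m (pd l (pd l u)) x := fun m =>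
      pd_sum_sm (fun l => suu l l) m x
    set K := L * (2 * M + 2) with hK
    have hK0 : 0 ≤ K := by positivity
    have E5 : (∑ l, pd l (pd l (fun y => G (gam u y))) x)
      - ∑ m, fderiv ℝ G (gam u x) (0, 0, Pi.single m 1) * pd m (lapl u) x
      = (∑ l, (pd l (fun y => fderiv ℝ G (gam u y) (Pi.single l 1, 0, 0)) x
          + pd l u x * pd l (fun y => fderiv ℝ G (gam u y) (0, 1, 0)) x
          + ∑ m, pd l (pd m u) x * pd l (fun y => fderiv ℝ G (gam u y) (0, 0, Pi.single m 1)) x))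
        + (v - C₁) * fderiv ℝ G (gam u x) (0, 1, 0) := by
      rw [hv', add_sub_cancel_right]
      simp only [E, E4, Finset.sum_add_distrib, lapl, Finset.mul_sum, Finset.sum_mul]
      have : ∑ l, ∑ m, pd l (pd l (pd m u)) x * fderiv ℝ G (gam u x) (0, 0, Pi.single m 1)
        = ∑ m, ∑ l, fderiv ℝ G (gam u x) (0, 0, Pi.single m 1) * pd m (pd l (pd l u)) x := by
        rw [Finset.sum_comm]
        exact Finset.sum_congr rfl fun m _ => Finset.sum_congr rfl fun l _ => by rw [E3, mul_comm]
      rw [this]; ring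
    rw [E5]
    have hv0 : 0 ≤ v := by linarith
    have hvv : v ≤ 2 * v ^ 2 := by nlinarith
    have b1 : |(v - C₁) * fderiv ℝ G (gam u x) (0, 1, 0)| ≤ 2 * L * (1 + 2 * M) * v ^ 2 := by
      rw [abs_mul]
      have a1 : |v - C₁| ≤ (1 + 2 * M) * v := (abs_sub _ _).trans (by rw [abs_of_nonneg hv0]; linarith)
      have a2 := abs_apply_le _ _ (hL1 (gam u x)) (norm_e2 (n := n))
      refine (mul_le_mul a1 a2 (abs_nonneg _) (by positivity)).trans ?_
      have := mul_le_mul_of_nonneg_left hvv (by positivity : 0 ≤ L * (1 + 2 * M))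
      linarith
    have b2 : ∀ l, |pd l (fun y => fderiv ℝ G (gam u y) (Pi.single l 1, 0, 0)) x
          + pd l u x * pd l (fun y => fderiv ℝ G (gam u y) (0, 1, 0)) x
          + ∑ m, pd l (pd m u) x * pd l (fun y => fderiv ℝ G (gam u y) (0, 0, Pi.single m 1)) x|
          ≤ K * (2 + 2 * M + 2 * n) * v ^ 2 := by
      intro l
      have a1 := hcomp _ (norm_e1 l) l
      have a2 : |pd l u x * pd l (fun y => fderiv ℝ G (gam u y) (0, 1, 0)) x| ≤ M * (K * v) := by
        rw [abs_mul]; exact mul_le_mul (h1 l) (hcomp _ norm_e2 l) (abs_nonneg _) hM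
      have a3 : |∑ m, pd l (pd m u) x * pd l (fun y => fderiv ℝ G (gam u y) (0, 0, Pi.single m 1)) x|
          ≤ n * (2 * v * (K * v)) := by
        refine abs_sum_le_of fun m => ?_
        rw [abs_mul]; exact mul_le_mul (h2 l m) (hcomp _ (norm_e3 m) l) (abs_nonneg _) (by positivity)
      refine (abs_add_three _ _ _).trans ?_
      have := mul_le_mul_of_nonneg_left hvv (by positivity : 0 ≤ K * (1 + M))
      nlinarith
    have b3 := abs_sum_le_of b2
    refine (abs_add_le _ _).trans ?_
    nlinarith

section molC11
variable {V : Type*} [NormedAddCommGroup V] [NormedSpace ℝ V] [FiniteDimensional ℝ V]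
  [MeasureSpace V] [BorelSpace V] [(volume : Measure V).IsAddHaarMeasure]

theorem C11c.cont_dir {G : V → ℝ} {L : ℝ} (h : C11c G L) (e : V) : Continuous (fun y => fderiv ℝ G y e) :=
  (h.cd.continuous_fderiv (by norm_num)).clm_apply continuous_const

theorem C11c.mol_fderiv_le {G : V → ℝ} {L : ℝ} (hL : 0 ≤ L) (h : C11c G L) (j : ℕ) (y : V) :
    ‖fderiv ℝ (mol j G) y‖ ≤ L := by
  refine ContinuousLinearMap.opNorm_le_bound _ hL fun e => ?_
  rw [mol_fderiv j h.cd h.cpt, Real.norm_eq_abs]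
  exact mol_abs_le j (h.cont_dir e) y fun z _ => abs_apply_le _ _ (h.dbd _) le_rfl

theorem C11c.mol_fderiv2_le {G : V → ℝ} {L : ℝ} (hL : 0 ≤ L) (h : C11c G L) (j : ℕ) (e : V) (he : ‖e‖ ≤ 1) (y : V) :
    ‖fderiv ℝ (fun z => fderiv ℝ (mol j G) z e) y‖ ≤ L := by
  have e1 : (fun z => fderiv ℝ (mol j G) z e) = mol j (fun y => fderiv ℝ G y e) := by
    ext z; exact mol_fderiv j h.cd h.cpt z e
  rw [e1]
  have : LipschitzWith ⟨L, hL⟩ (mol j (fun y => fderiv ℝ G y e)) := by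
    refine LipschitzWith.of_dist_le_mul fun a b => ?_
    rw [Real.dist_eq, dist_eq_norm]
    refine mol_diff_le j (h.cont_dir e) b a fun z => ?_
    have := abs_apply_le (fderiv ℝ G (a - z) - fderiv ℝ G (b - z)) e (h.lip _ _) he
    rw [sub_sub_sub_cancel_right, mul_one] at this
    exact this
  exact norm_fderiv_le_of_lipschitz ℝ this

theorem C11c.mol_fderiv_sub_le {G : V → ℝ} {L : ℝ} (hL : 0 ≤ L) (h : C11c G L) (j : ℕ) (y : V) :
    ‖fderiv ℝ (mol j G) y - fderiv ℝ G y‖ ≤ L * (1 / ((j:ℝ) + 1)) := by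
  refine ContinuousLinearMap.opNorm_le_bound _ (by positivity) fun e => ?_
  rw [_root_.sub_apply, mol_fderiv j h.cd h.cpt, Real.norm_eq_abs]
  have e1 := mol_sub j (h.cont_dir e) (continuous_const (y := fderiv ℝ G y e)) y
  rw [mol_const] at e1
  rw [← e1]
  refine mol_abs_le j ((h.cont_dir e).sub continuous_const) y fun z hz => ?_
  refine abs_apply_le (fderiv ℝ G (y - z) - fderiv ℝ G y) e ((h.lip _ _).trans ?_) le_rfl
  refine mul_le_mul_of_nonneg_left ?_ hL
  simpa using hz.le

theorem C11c.mol_sub_le {G : V → ℝ} {L : ℝ} (hL : 0 ≤ L) (h : C11c G L) (j : ℕ) (y : V) :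
    |mol j G y - G y| ≤ L * (1 / ((j:ℝ) + 1)) := by
  have e1 := mol_sub j h.cd.continuous (continuous_const (y := G y)) y
  rw [mol_const] at e1
  rw [← e1]
  refine mol_abs_le j (h.cd.continuous.sub continuous_const) y fun z hz => ?_
  have := convex_univ.norm_image_sub_le_of_norm_fderiv_le (𝕜 := ℝ) (f := G) (C := L) (x := y) (y := y - z)
    (fun z _ => h.cd.differentiable (by norm_num) z) (fun z _ => h.dbd z) (mem_univ _) (mem_univ _)
  refine this.trans (mul_le_mul_of_nonneg_left ?_ hL)
  simpa using hz.le

end molC11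

open MeasureTheory Metric Set Matrix
open scoped ContDiff

instance jet_haar {n : ℕ} : (volume : Measure ((Fin n → ℝ) × ℝ × (Fin n → ℝ))).IsAddHaarMeasure := by
  have h1 : (volume : Measure (ℝ × (Fin n → ℝ))).IsAddHaarMeasure :=
    Measure.prod.instIsAddHaarMeasure (volume : Measure ℝ) (volume : Measure (Fin n → ℝ))
  exact Measure.prod.instIsAddHaarMeasure (volume : Measure (Fin n → ℝ)) (volume : Measure (ℝ × (Fin n → ℝ)))

theorem mol_ev {n : ℕ} {g : (Fin n → ℝ) → ℝ} (hg : Continuous g) (hc : HasCompactSupport g) {δ : ℝ} (hδ : 0 < δ) :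
    ∀ᶠ j : ℕ in Filter.atTop, ∀ x, |mol j g x - g x| ≤ δ := by
  obtain ⟨J, hJ⟩ := mol_tendsto hg hc δ hδ
  exact Filter.eventually_atTop.2 ⟨J, hJ⟩

theorem inv_ev {δ : ℝ} (hδ : 0 < δ) : ∀ᶠ j : ℕ in Filter.atTop, 1 / ((j:ℝ) + 1) ≤ δ := by
  have := tendsto_one_div_add_atTop_nhds_zero_nat (𝕜 := ℝ)
  exact (this.eventually (gt_mem_nhds hδ)).mono fun j hj => hj.le

theorem pd_mol {n : ℕ} {u : (Fin n → ℝ) → ℝ} (hu : ContDiff ℝ 2 u) (hc : HasCompactSupport u) (j : ℕ) (i : Fin n) :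
    pd i (mol j u) = mol j (pd i u) := mol_pd j (hu.of_le (by norm_num)) hc i

theorem pd_pd_mol {n : ℕ} {u : (Fin n → ℝ) → ℝ} (hu : ContDiff ℝ 2 u) (hc : HasCompactSupport u) (j : ℕ)
    (l i : Fin n) : pd l (pd i (mol j u)) = mol j (pd l (pd i u)) := by
  rw [pd_mol hu hc, mol_pd j (contDiff_pd hu (by norm_num)) (hasCompactSupport_pd hc)]

theorem cont_pd {n : ℕ} {u : (Fin n → ℝ) → ℝ} (hu : ContDiff ℝ 1 u) (i : Fin n) : Continuous (pd i u) :=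
  (contDiff_pd hu (k := 0) (by norm_num)).continuous

theorem cont_pd2 {n : ℕ} {u : (Fin n → ℝ) → ℝ} (hu : ContDiff ℝ 2 u) (l i : Fin n) : Continuous (pd l (pd i u)) :=
  cont_pd (contDiff_pd hu (by norm_num)) l

theorem conv_u {n : ℕ} {u : (Fin n → ℝ) → ℝ} (hu : ContDiff ℝ 2 u) (hc : HasCompactSupport u) {δ : ℝ} (hδ : 0 < δ) :
    ∀ᶠ j : ℕ in Filter.atTop, (∀ x, |mol j u x - u x| ≤ δ) ∧ (∀ m x, |pd m (mol j u) x - pd m u x| ≤ δ) ∧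
      (∀ l m x, |pd l (pd m (mol j u)) x - pd l (pd m u) x| ≤ δ) := by
  refine (mol_ev hu.continuous hc hδ).and (Filter.Eventually.and ?_ ?_)
  · rw [Filter.eventually_all]; intro m
    simp only [pd_mol hu hc]
    exact mol_ev (cont_pd (hu.of_le (by norm_num)) m) (hasCompactSupport_pd hc) hδ
  · rw [Filter.eventually_all]; intro l
    rw [Filter.eventually_all]; intro m
    simp only [pd_pd_mol hu hc]
    exact mol_ev (cont_pd2 hu l m) (hasCompactSupport_pd (hasCompactSupport_pd hc)) hδ

theorem conv_gam {n : ℕ} {u : (Fin n → ℝ) → ℝ} (hu : ContDiff ℝ 2 u) (hc : HasCompactSupport u) {δ : ℝ} (hδ : 0 < δ) :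
    ∀ᶠ j : ℕ in Filter.atTop, ∀ x, ‖gam (mol j u) x - gam u x‖ ≤ δ ∧
      ∀ l, ‖dgam (mol j u) l x - dgam u l x‖ ≤ δ := by
  filter_upwards [conv_u hu hc hδ] with j ⟨h1, h2, h3⟩ x
  refine ⟨?_, fun l => ?_⟩
  · refine norm_prod_le_iff.2 ⟨by simp [gam, hδ.le], norm_prod_le_iff.2 ⟨h1 x, ?_⟩⟩
    exact (pi_norm_le_iff_of_nonneg hδ.le).2 fun m => h2 m x
  · refine norm_prod_le_iff.2 ⟨by simp [dgam, hδ.le], norm_prod_le_iff.2 ⟨h2 l x, ?_⟩⟩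
    exact (pi_norm_le_iff_of_nonneg hδ.le).2 fun m => h3 l m x

theorem bdd_dgam {n : ℕ} {u : (Fin n → ℝ) → ℝ} (hu : ContDiff ℝ 2 u) (hc : HasCompactSupport u) :
    ∃ D, 1 ≤ D ∧ (∀ x, |u x| ≤ D) ∧ (∀ m x, |pd m u x| ≤ D) ∧ (∀ l m x, |pd l (pd m u) x| ≤ D) ∧
      ∀ l x, ‖dgam u l x‖ ≤ D := by
  obtain ⟨c0, h0⟩ := hc.exists_bound_of_continuous hu.continuous
  have h1 : ∀ m, ∃ C, ∀ x, ‖pd m u x‖ ≤ C := fun m =>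
    (hasCompactSupport_pd hc).exists_bound_of_continuous (cont_pd (hu.of_le (by norm_num)) m)
  have h2 : ∀ l m, ∃ C, ∀ x, ‖pd l (pd m u) x‖ ≤ C := fun l m =>
    (hasCompactSupport_pd (hasCompactSupport_pd hc)).exists_bound_of_continuous (cont_pd2 hu l m)
  choose c1 h1 using h1
  choose c2 h2 using h2
  have p0 : 0 ≤ |c0| := abs_nonneg _
  have p1 : ∀ m, |c1 m| ≤ ∑ m, |c1 m| := fun m =>
    Finset.single_le_sum (f := fun m => |c1 m|) (fun i _ => abs_nonneg _) (Finset.mem_univ m)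
  have p2 : ∀ l m, |c2 l m| ≤ ∑ l, ∑ m, |c2 l m| := fun l m =>
    (Finset.single_le_sum (f := fun m => |c2 l m|) (fun i _ => abs_nonneg _) (Finset.mem_univ m)).trans
    (Finset.single_le_sum (f := fun l => ∑ m, |c2 l m|) (fun i _ => Finset.sum_nonneg fun _ _ => abs_nonneg _)
      (Finset.mem_univ l))
  have q1 : 0 ≤ ∑ m, |c1 m| := Finset.sum_nonneg fun _ _ => abs_nonneg _
  have q2 : 0 ≤ ∑ l, ∑ m, |c2 l m| := Finset.sum_nonneg fun _ _ => Finset.sum_nonneg fun _ _ => abs_nonneg _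
  set D := 1 + |c0| + (∑ m, |c1 m|) + ∑ l, ∑ m, |c2 l m| with hD
  have r1 : ∀ m x, |pd m u x| ≤ D := fun m x =>
    ((h1 m x).trans (le_abs_self _)).trans ((p1 m).trans (by linarith))
  have r2 : ∀ l m x, |pd l (pd m u) x| ≤ D := fun l m x =>
    ((h2 l m x).trans (le_abs_self _)).trans ((p2 l m).trans (by linarith))
  refine ⟨D, by linarith, fun x => ((h0 x).trans (le_abs_self _)).trans (by linarith), r1, r2, fun l x => ?_⟩
  exact norm_dgam_le u l x (by linarith) (r1 l x) fun m => r2 l m x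

theorem C11c.lip0 {V : Type*} [NormedAddCommGroup V] [NormedSpace ℝ V] {G : V → ℝ} {L : ℝ} (h : C11c G L) (y z : V) :
    |G y - G z| ≤ L * ‖y - z‖ :=
  convex_univ.norm_image_sub_le_of_norm_fderiv_le (𝕜 := ℝ) (f := G) (C := L) (x := z) (y := y)
    (fun z _ => h.cd.differentiable (by norm_num) z) (fun z _ => h.dbd z) (mem_univ _) (mem_univ _)

theorem gam_cpt {n : ℕ} {u : (Fin n → ℝ) → ℝ} {G : (Fin n → ℝ) × ℝ × (Fin n → ℝ) → ℝ} (hG : HasCompactSupport G) :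
    HasCompactSupport (fun x => G (gam u x)) := by
  refine HasCompactSupport.intro (hG.isCompact.image continuous_fst) fun x hx => ?_
  by_contra h
  exact hx ⟨gam u x, subset_tsupport _ h, rfl⟩

theorem gam_cd {n : ℕ} {u : (Fin n → ℝ) → ℝ} (hu : ContDiff ℝ 2 u) {G : (Fin n → ℝ) × ℝ × (Fin n → ℝ) → ℝ}
    (hG : ContDiff ℝ 1 G) : ContDiff ℝ 1 (fun x => G (gam u x)) := hG.comp (gam_diff hu)

theorem conv_mol {n : ℕ} {g : (Fin n → ℝ) → ℝ} (hg : ContDiff ℝ 1 g) (hc : HasCompactSupport g) {δ : ℝ} (hδ : 0 < δ) :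
    ∀ᶠ j : ℕ in Filter.atTop, (∀ x, |mol j g x - g x| ≤ δ) ∧ ∀ l x, |pd l (mol j g) x - pd l g x| ≤ δ := by
  refine (mol_ev hg.continuous hc hδ).and ?_
  rw [Filter.eventually_all]; intro l
  simp only [mol_pd _ hg hc]
  exact mol_ev (cont_pd hg l) (hasCompactSupport_pd hc) hδ

theorem conv_G {n : ℕ} {u : (Fin n → ℝ) → ℝ} (hu : ContDiff ℝ 2 u) (hc : HasCompactSupport u)
    {G : (Fin n → ℝ) × ℝ × (Fin n → ℝ) → ℝ} {L : ℝ} (hG : C11c G L) {δ : ℝ} (hδ : 0 < δ) :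
    ∀ᶠ j : ℕ in Filter.atTop, (∀ x, |mol j G (gam (mol j u) x) - G (gam u x)| ≤ δ) ∧
      ∀ l x, |pd l (fun y => mol j G (gam (mol j u) y)) x - pd l (fun y => G (gam u y)) x| ≤ δ := by
  have hL : 0 ≤ L := (norm_nonneg _).trans (hG.dbd 0)
  obtain ⟨D, hD1, -, -, -, hD⟩ := bdd_dgam hu hc
  set δ' := min 1 (δ / (3 * (L + 1) * (D + 1))) with hδ'
  have hpos : 0 < δ' := lt_min one_pos (by positivity)
  have h1 : δ' ≤ 1 := min_le_left _ _
  have h2 : 3 * (L + 1) * (D + 1) * δ' ≤ δ := by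
    have : δ' ≤ δ / (3 * (L + 1) * (D + 1)) := min_le_right _ _
    rw [le_div_iff₀ (by positivity)] at this
    linarith
  filter_upwards [conv_gam hu hc hpos, inv_ev hpos] with j hg hj
  have hjL : L * (1 / ((j:ℝ) + 1)) ≤ L * δ' := mul_le_mul_of_nonneg_left hj hL
  have hLD : 0 ≤ L * D * δ' := by positivity
  have hLd : 0 ≤ L * δ' := by positivity
  have hDd : 0 ≤ D * δ' := by positivity
  refine ⟨fun x => ?_, fun l x => ?_⟩
  · have a1 := (hG.mol_sub_le hL j (gam (mol j u) x)).trans hjL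
    have a2 := (hG.lip0 (gam (mol j u) x) (gam u x)).trans (mul_le_mul_of_nonneg_left (hg x).1 hL)
    have := abs_sub_le (mol j G (gam (mol j u) x)) (G (gam (mol j u) x)) (G (gam u x))
    nlinarith
  · have hus : ContDiff ℝ ∞ (mol j u) := mol_smooth j hu.continuous
    have hGs : ContDiff ℝ ∞ (mol j G) := mol_smooth j hG.cd.continuous
    rw [pd_comp_gam (sm_two hus) (contDiff_infty.1 hGs 1), pd_comp_gam hu hG.cd]
    have e : fderiv ℝ (mol j G) (gam (mol j u) x) (dgam (mol j u) l x) - fderiv ℝ G (gam u x) (dgam u l x)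
      = (fderiv ℝ (mol j G) (gam (mol j u) x) - fderiv ℝ G (gam (mol j u) x)) (dgam (mol j u) l x)
        + (fderiv ℝ G (gam (mol j u) x) - fderiv ℝ G (gam u x)) (dgam (mol j u) l x)
        + fderiv ℝ G (gam u x) (dgam (mol j u) l x - dgam u l x) := by
      simp only [_root_.sub_apply, map_sub]; ring
    have hd : ‖dgam (mol j u) l x‖ ≤ D + 1 := by
      have := norm_le_norm_add_norm_sub' (dgam (mol j u) l x) (dgam u l x)
      have := (hg x).2 l
      have := hD l x
      linarith
    rw [e]
    have b1 := abs_apply_le _ _ ((hG.mol_fderiv_sub_le hL j (gam (mol j u) x)).trans hjL) hd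
    have b2 := abs_apply_le _ _ ((hG.lip (gam (mol j u) x) (gam u x)).trans
      (mul_le_mul_of_nonneg_left (hg x).1 hL)) hd
    have b3 := abs_apply_le _ _ (hG.dbd (gam u x)) ((hg x).2 l)
    refine (abs_add_three _ _ _).trans ?_
    nlinarith

open MeasureTheory Metric Set Matrix
open scoped ContDiff

/-- Polarised form of `2 σ₂`. -/
def TT {n : ℕ} (A B : Fin n → Fin n → ℝ) : ℝ := ftr A * ftr B - fdot A B

theorem TT_comm {n : ℕ} (A B : Fin n → Fin n → ℝ) : TT A B = TT B A := by
  unfold TT; rw [fdot_comm, mul_comm]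

theorem TT_add {n : ℕ} (A B D : Fin n → Fin n → ℝ) : TT A (fun i j => B i j + D i j) = TT A B + TT A D := by
  unfold TT ftr fdot
  simp only [mul_add, Finset.sum_add_distrib]; ring

theorem TT_sub {n : ℕ} (A B D : Fin n → Fin n → ℝ) : TT A (fun i j => B i j - D i j) = TT A B - TT A D := by
  unfold TT ftr fdot
  simp only [mul_sub, Finset.sum_sub_distrib]; ring

theorem TT_smul {n : ℕ} (c : ℝ) (A B : Fin n → Fin n → ℝ) : TT A (fun i j => c * B i j) = c * TT A B := by
  unfold TT ftr fdot
  have : ∑ i, ∑ j, A i j * (c * B i j) = c * ∑ i, ∑ j, A i j * B i j := by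
    simp only [Finset.mul_sum]
    exact Finset.sum_congr rfl fun i _ => Finset.sum_congr rfl fun j _ => by ring
  rw [this, ← Finset.mul_sum]; ring

theorem TT_sum {n : ℕ} (A : Fin n → Fin n → ℝ) (B : Fin n → Fin n → Fin n → ℝ) :
    TT A (fun i j => ∑ l, B l i j) = ∑ l, TT A (B l) := by
  unfold TT ftr fdot
  rw [Finset.sum_sub_distrib, ← Finset.mul_sum]
  congr 1
  · rw [Finset.sum_comm]
  · simp only [Finset.mul_sum]
    have : ∀ i, ∑ j, ∑ l, A i j * B l i j = ∑ l, ∑ j, A i j * B l i j := fun i => Finset.sum_comm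
    simp only [this]
    exact Finset.sum_comm

theorem ftr_sq_le {n : ℕ} (A : Fin n → Fin n → ℝ) : ftr A ^ 2 ≤ n * fdot A A := by
  have h := sq_sum_le_card_mul_sum_sq (s := (Finset.univ : Finset (Fin n))) (f := fun i => A i i)
  simp only [Finset.card_univ, Fintype.card_fin] at h
  refine h.trans (mul_le_mul_of_nonneg_left ?_ (Nat.cast_nonneg _))
  unfold fdot
  refine Finset.sum_le_sum fun i _ => ?_
  have := Finset.single_le_sum (f := fun j => A i j * A i j) (fun j _ => mul_self_nonneg _) (Finset.mem_univ i)
  simpa [sq] using this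

theorem TT_sq_le {n : ℕ} (A B : Fin n → Fin n → ℝ) :
    TT A B ^ 2 ≤ 2 * ((n:ℝ) ^ 2 + 1) * (fdot A A * fdot B B) := by
  have h1 := mul_le_mul (ftr_sq_le A) (ftr_sq_le B) (sq_nonneg _)
    (mul_nonneg (Nat.cast_nonneg n) (fdot_self_nonneg A))
  have h2 := fdot_cs A B
  have h3 : TT A B ^ 2 ≤ 2 * (ftr A ^ 2 * ftr B ^ 2) + 2 * fdot A B ^ 2 := by
    unfold TT; nlinarith [sq_nonneg (ftr A * ftr B + fdot A B)]
  nlinarith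

theorem fdot_le_of {n : ℕ} {A : Fin n → Fin n → ℝ} {c : ℝ} (h : ∀ i j, |A i j| ≤ c) : fdot A A ≤ (n:ℝ) ^ 2 * c ^ 2 := by
  unfold fdot
  have : ∀ i ∈ (Finset.univ : Finset (Fin n)), ∑ j, A i j * A i j ≤ n * c ^ 2 := fun i _ => by
    have : ∀ j ∈ (Finset.univ : Finset (Fin n)), A i j * A i j ≤ c ^ 2 := fun j _ => by
      rw [← sq, ← sq_abs]; exact pow_le_pow_left₀ (abs_nonneg _) (h i j) 2
    refine (Finset.sum_le_sum this).trans ?_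
    simp
  refine (Finset.sum_le_sum this).trans ?_
  simp only [Finset.sum_const, Finset.card_univ, Fintype.card_fin, nsmul_eq_mul]
  rw [sq (n:ℝ), mul_assoc]

theorem deficit_scalar {nn a g c gl y aa : ℝ} (hc : 0 < c) (hg : c ≤ g) (hn : 0 ≤ nn) (haa : aa ≤ a)
    (haa0 : 0 ≤ aa) (hy : (y * (2 * g) - gl) ^ 2 ≤ aa * nn) :
    y ^ 2 * aa ≤ a ^ 2 / (2 * c ^ 2) * nn + a / (2 * c ^ 2) * gl ^ 2 := by
  have h1 : y ^ 2 * (4 * g ^ 2) ≤ 2 * (aa * nn) + 2 * gl ^ 2 := by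
    nlinarith [sq_nonneg (y * (2 * g) - 2 * gl)]
  have h2 : c ^ 2 ≤ g ^ 2 := pow_le_pow_left₀ hc.le hg 2
  have h3 : y ^ 2 * (4 * c ^ 2) ≤ 2 * (a * nn) + 2 * gl ^ 2 := by
    have := mul_le_mul_of_nonneg_left h2 (sq_nonneg y)
    have := mul_le_mul_of_nonneg_right haa hn
    linarith
  have ha : 0 ≤ a := haa0.trans haa
  have h4 : y ^ 2 * aa ≤ y ^ 2 * a := mul_le_mul_of_nonneg_left haa (sq_nonneg _)
  have h5 : a ^ 2 / (2 * c ^ 2) * nn + a / (2 * c ^ 2) * gl ^ 2 = (a * (a * nn) + a * gl ^ 2) / (2 * c ^ 2) := by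
    field_simp
  rw [h5, le_div_iff₀ (by positivity)]
  have := mul_le_mul_of_nonneg_left h3 ha
  nlinarith

/-- Coercivity of `-σ₂` on almost tangential directions. -/
theorem deficit_coercive (n : ℕ) (a c : ℝ) (ha : 0 < a) (hc : 0 < c) : ∃ K K' : ℝ, 0 < K ∧ 0 < K' ∧
    ∀ (A B : Fin n → Fin n → ℝ) (g : ℝ), 0 < ftr A → c ≤ g → TT A A = 2 * g → fdot A A ≤ a →
      fdot B B ≤ K * (-TT B B) + K' * TT A B ^ 2 := by
  set k1 := 2 + a ^ 2 / c ^ 2 with hk1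
  have hk1p : 0 < k1 := by positivity
  refine ⟨k1, k1 / (2 * c) + a / c ^ 2, hk1p, by positivity, fun A B g hτ hg hA haA => ?_⟩
  have hgp : 0 < g := hc.trans_le hg
  set t := ftr B with ht
  set N := fun i j => B i j - t / ftr A * A i j with hN
  have hA' : ftr A ^ 2 - fdot A A = 2 * g := by rw [← hA]; unfold TT; ring
  have h1 := lorentz_deficit A B hτ hgp hA' (t := t) (gl := TT A B) rfl
  rw [← hN] at h1
  have hN0 := fdot_self_nonneg N
  have e1 : fdot A N = t / ftr A * (2 * g) - TT A B := by
    have : fdot A N = fdot A B - t / ftr A * fdot A A := by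
      rw [fdot_comm, hN, fdot_sub_left, fdot_smul_left, fdot_comm]
    rw [this]
    have h2 : fdot A A = ftr A ^ 2 - 2 * g := by linarith
    rw [h2]; unfold TT; field_simp; ring
  have h3 := fdot_cs A N
  rw [e1] at h3
  have h4 := deficit_scalar hc hg hN0 haA (fdot_self_nonneg A) h3
  have h5 : fdot B B ≤ 2 * fdot N N + 2 * ((t / ftr A) ^ 2 * fdot A A) := by
    have e2 : fdot N N = fdot B B - 2 * (t / ftr A) * fdot A B + (t / ftr A) ^ 2 * fdot A A :=
      fdot_sub_smul_sq _ _ _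
    have e3 := fdot_self_nonneg (fun i j => B i j - 2 * (t / ftr A) * A i j)
    rw [fdot_sub_smul_sq] at e3
    nlinarith
  have h6 : fdot B B ≤ k1 * fdot N N + a / c ^ 2 * TT A B ^ 2 := by
    have e1 : 2 * (a ^ 2 / (2 * c ^ 2) * fdot N N) = a ^ 2 / c ^ 2 * fdot N N := by field_simp
    have e2 : 2 * (a / (2 * c ^ 2) * TT A B ^ 2) = a / c ^ 2 * TT A B ^ 2 := by field_simp
    rw [hk1]; linarith
  have h7 : fdot N N ≤ - TT B B + TT A B ^ 2 / (2 * c) := by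
    have : TT A B ^ 2 / (2 * g) ≤ TT A B ^ 2 / (2 * c) :=
      div_le_div_of_nonneg_left (sq_nonneg _) (by positivity) (by linarith)
    have e : TT B B = t ^ 2 - fdot B B := by unfold TT; ring
    linarith
  have h8 := mul_le_mul_of_nonneg_left h7 hk1p.le
  have e : k1 * (TT A B ^ 2 / (2 * c)) = k1 / (2 * c) * TT A B ^ 2 := by field_simp
  linarith

open MeasureTheory Metric Set Matrix
open scoped ContDiff

/-- The augmented Hessian. -/
noncomputable def Am {n : ℕ} (u : (Fin n → ℝ) → ℝ) (Hc : Fin n → Fin n → (Fin n → ℝ) × ℝ × (Fin n → ℝ) → ℝ)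
    (x : Fin n → ℝ) (i j : Fin n) : ℝ := pd i (pd j u) x - Hc i j (gam u x)

/-- Globalised data. -/
structure Core {n : ℕ} (u : (Fin n → ℝ) → ℝ) (Fc : (Fin n → ℝ) × ℝ × (Fin n → ℝ) → ℝ)
    (Hc : Fin n → Fin n → (Fin n → ℝ) × ℝ × (Fin n → ℝ) → ℝ) (L c0 : ℝ) (x₀ : Fin n → ℝ) (R2 : ℝ) : Prop where
  hu : ContDiff ℝ 2 u
  hc : HasCompactSupport u
  hF : C11c Fc L
  hH : ∀ i j, C11c (Hc i j) L
  hsym : ∀ i j, Hc i j = Hc j i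
  c0pos : 0 < c0
  Lpos : 0 < L
  eq : ∀ x ∈ ball x₀ R2, TT (Am u Hc x) (Am u Hc x) = 2 * Fc (gam u x)
  tr : ∀ x ∈ ball x₀ R2, 0 < ftr (Am u Hc x)
  low : ∀ x ∈ ball x₀ R2, c0 ≤ Fc (gam u x)

theorem lip_of_C1 {n : ℕ} {V : Type*} [NormedAddCommGroup V] [NormedSpace ℝ V] {g : (Fin n → ℝ) → V}
    (hg : ContDiff ℝ 1 g) (hc : HasCompactSupport g) :
    ∃ C : ℝ, 0 ≤ C ∧ ∀ x y, ‖g x - g y‖ ≤ C * ‖x - y‖ := by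
  obtain ⟨C, hC⟩ := ContDiff.lipschitzWith_of_hasCompactSupport hc hg (by norm_num)
  exact ⟨C, C.2, fun x y => hC.norm_sub_le x y⟩

theorem second_diff {n : ℕ} {u : (Fin n → ℝ) → ℝ} (hu : ContDiff ℝ 2 u) (hc : HasCompactSupport u) :
    ∃ C : ℝ, 0 ≤ C ∧ ∀ (e x : Fin n → ℝ) , |u (x + e) - 2 * u x + u (x - e)| ≤ C * ‖e‖ ^ 2 := by
  obtain ⟨C, hC0, hC⟩ := lip_of_C1 (hu.fderiv_right (m := 1) (by norm_num)) (hc.fderiv ℝ)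
  refine ⟨C, hC0, fun e x => ?_⟩
  have hd : Differentiable ℝ u := hu.differentiable (by norm_num)
  have h1 := convex_univ.norm_image_sub_le_of_norm_fderiv_le (𝕜 := ℝ) (f := fun y => u (y + e) - u y)
    (C := C * ‖e‖) (x := x - e) (y := x)
    (fun z _ => ((hd _).comp z ((differentiableAt_id).add_const e)).sub (hd z)) (fun z _ => ?_) (mem_univ _) (mem_univ _)
  · rw [Real.norm_eq_abs] at h1
    have e1 : u (x + e) - u x - (u (x - e + e) - u (x - e)) = u (x + e) - 2 * u x + u (x - e) := by
      rw [sub_add_cancel]; ring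
    rw [e1] at h1
    refine h1.trans (le_of_eq ?_)
    rw [sub_sub_cancel]; ring
  · have : fderiv ℝ (fun y => u (y + e) - u y) z = fderiv ℝ u (z + e) - fderiv ℝ u z := by
      have hd1 : DifferentiableAt ℝ (fun y => u (y + e)) z := (hd _).comp z ((differentiableAt_id).add_const e)
      rw [fderiv_fun_sub hd1 (hd z), fderiv_comp_add_right]
    rw [this]
    refine (hC _ _).trans (le_of_eq ?_)
    rw [add_sub_cancel_left]

theorem gam_lip {n : ℕ} {u : (Fin n → ℝ) → ℝ} (hu : ContDiff ℝ 2 u) (hc : HasCompactSupport u) :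
    ∃ C : ℝ, 0 < C ∧ ∀ x y, ‖gam u x - gam u y‖ ≤ C * ‖x - y‖ := by
  obtain ⟨C1, h10, h1⟩ := lip_of_C1 (hu.of_le (by norm_num)) hc
  have h2 : ContDiff ℝ 1 (fun y => fun m => pd m u y) := contDiff_pi.2 fun m => contDiff_pd hu (by norm_num)
  have h3 : HasCompactSupport (fun y => fun m => pd m u y) := by
    refine HasCompactSupport.intro hc.isCompact fun x hx => ?_
    ext m; exact pd_eq_zero_of_notMem hx
  obtain ⟨C2, h20, h2⟩ := lip_of_C1 h2 h3
  refine ⟨1 + C1 + C2, by positivity, fun x y => ?_⟩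
  have n0 := norm_nonneg (x - y)
  refine norm_prod_le_iff.2 ⟨?_, norm_prod_le_iff.2 ⟨(h1 x y).trans ?_, (h2 x y).trans ?_⟩⟩
  · show ‖x - y‖ ≤ _
    nlinarith [mul_nonneg h10 n0, mul_nonneg h20 n0]
  · exact mul_le_mul_of_nonneg_right (by linarith) n0
  · exact mul_le_mul_of_nonneg_right (by linarith) n0

theorem C11c.taylor {V : Type*} [NormedAddCommGroup V] [NormedSpace ℝ V] {G : V → ℝ} {L : ℝ} (hL : 0 ≤ L)
    (h : C11c G L) (y z : V) :
    |G z - G y - fderiv ℝ G y (z - y)| ≤ L * ‖z - y‖ ^ 2 := by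
  have := (convex_closedBall y ‖z - y‖).norm_image_sub_le_of_norm_fderiv_le' (𝕜 := ℝ) (f := G)
    (φ := fderiv ℝ G y) (C := L * ‖z - y‖) (x := y) (y := z)
    (fun w _ => h.cd.differentiable (by norm_num) w) (fun w hw => ?_) (by simp) (by simp [dist_eq_norm])
  · rw [Real.norm_eq_abs] at this
    refine this.trans (le_of_eq ?_); ring
  · refine (h.lip w y).trans (mul_le_mul_of_nonneg_left ?_ hL)
    rwa [mem_closedBall, dist_eq_norm] at hw

theorem dd_bound {n : ℕ} {u : (Fin n → ℝ) → ℝ} (hu : ContDiff ℝ 2 u) (hc : HasCompactSupport u) {L : ℝ} (hL : 0 ≤ L) :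
    ∃ C : ℝ, 0 < C ∧ (∀ h x, h ≠ 0 → |∑ l, ddq l h u x| ≤ C) ∧
      ∀ (G : (Fin n → ℝ) × ℝ × (Fin n → ℝ) → ℝ), C11c G L → ∀ h x, h ≠ 0 →
      |∑ l, ddq l h (fun y => G (gam u y)) x| ≤ C * (1 + ∑ m, |∑ l, ddq l h (pd m u) x|) := by
  obtain ⟨C1, h10, h1⟩ := second_diff hu hc
  obtain ⟨Γ, hΓ0, hΓ⟩ := gam_lip hu hc
  have hw : ∀ h x, h ≠ 0 → |∑ l, ddq l h u x| ≤ n * C1 := by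
    intro h x hh
    refine abs_sum_le_of fun l => ?_
    unfold ddq
    rw [abs_div, abs_of_pos (by positivity : 0 < h ^ 2), div_le_iff₀ (by positivity)]
    refine (h1 _ x).trans (mul_le_mul_of_nonneg_left ?_ h10)
    rw [norm_smul, mul_pow, Real.norm_eq_abs, sq_abs]
    have : ‖(Pi.single l 1 : Fin n → ℝ)‖ ^ 2 ≤ 1 := pow_le_one₀ (norm_nonneg _) (norm_single_le l)
    nlinarith [sq_nonneg h]
  refine ⟨1 + n * C1 + (L * (n * C1) + n * (2 * L * Γ ^ 2) + L), by positivity, fun h x hh => (hw h x hh).trans ?_, ?_⟩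
  · have : 0 ≤ L * (n * C1) + n * (2 * L * Γ ^ 2) + L := by positivity
    linarith
  intro G hG h x hh
  have h2 : 0 < h ^ 2 := by positivity
  set g := fderiv ℝ G (gam u x) with hg
  have e0 : ∀ l, |ddq l h (fun y => G (gam u y)) x - g (0, ddq l h u x, fun m => ddq l h (pd m u) x)| ≤ 2 * L * Γ ^ 2 := by
    intro l
    set e := h • (Pi.single l 1 : Fin n → ℝ) with he
    have hen : ‖e‖ ≤ |h| := by
      rw [he, norm_smul, Real.norm_eq_abs]
      exact mul_le_of_le_one_right (abs_nonneg _) (norm_single_le l)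
    have t1 := hG.taylor hL (gam u x) (gam u (x + e))
    have t2 := hG.taylor hL (gam u x) (gam u (x - e))
    have b : ∀ z, ‖z - x‖ ≤ |h| → L * ‖gam u z - gam u x‖ ^ 2 ≤ L * (Γ ^ 2 * h ^ 2) := by
      intro z hz
      refine mul_le_mul_of_nonneg_left ?_ hL
      have : ‖gam u z - gam u x‖ ≤ Γ * |h| := (hΓ z x).trans (mul_le_mul_of_nonneg_left hz hΓ0.le)
      calc _ ≤ (Γ * |h|) ^ 2 := pow_le_pow_left₀ (norm_nonneg _) this 2
        _ = _ := by rw [mul_pow, sq_abs]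
    have b1 := b (x + e) (by simpa using hen)
    have b2 := b (x - e) (by simpa using hen)
    have hz : (h ^ 2) • ((0, ddq l h u x, fun m => ddq l h (pd m u) x) : (Fin n → ℝ) × ℝ × (Fin n → ℝ))
        = (gam u (x + e) - gam u x) + (gam u (x - e) - gam u x) := by
      refine Prod.ext ?_ (Prod.ext ?_ ?_)
      · ext k; simp [gam]
      · simp only [gam, ddq, Prod.smul_mk, Prod.snd_add, Prod.fst_add, Prod.fst_sub, Prod.snd_sub, smul_eq_mul, ← he]
        field_simp; ring
      · ext k
        simp only [gam, ddq, Prod.smul_mk, Prod.snd_add, Prod.snd_sub, Pi.smul_apply, Pi.add_apply, Pi.sub_apply,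
          smul_eq_mul, ← he]
        field_simp; ring
    have hg2 : h ^ 2 * g (0, ddq l h u x, fun m => ddq l h (pd m u) x)
        = g (gam u (x + e) - gam u x) + g (gam u (x - e) - gam u x) := by
      rw [← map_add, ← hz, map_smul, smul_eq_mul]
    have hq : h ^ 2 * ddq l h (fun y => G (gam u y)) x
        = (G (gam u (x + e)) - G (gam u x)) + (G (gam u (x - e)) - G (gam u x)) := by
      simp only [ddq, ← he]; field_simp; ring
    have hfin : h ^ 2 * |ddq l h (fun y => G (gam u y)) x - g (0, ddq l h u x, fun m => ddq l h (pd m u) x)|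
        ≤ h ^ 2 * (2 * L * Γ ^ 2) := by
      rw [← abs_of_pos h2, ← abs_mul, abs_of_pos h2, mul_sub, hq, hg2]
      have := abs_add_le (G (gam u (x + e)) - G (gam u x) - g (gam u (x + e) - gam u x))
        (G (gam u (x - e)) - G (gam u x) - g (gam u (x - e) - gam u x))
      rw [show G (gam u (x + e)) - G (gam u x) + (G (gam u (x - e)) - G (gam u x)) -
        (g (gam u (x + e) - gam u x) + g (gam u (x - e) - gam u x))
        = (G (gam u (x + e)) - G (gam u x) - g (gam u (x + e) - gam u x))
        + (G (gam u (x - e)) - G (gam u x) - g (gam u (x - e) - gam u x)) by ring]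
      linarith
    exact le_of_mul_le_mul_left hfin h2
  have e1 := abs_sum_le_of e0
  rw [Finset.sum_sub_distrib, ← map_sum] at e1
  have e2 : ∑ l, ((0, ddq l h u x, fun m => ddq l h (pd m u) x) : (Fin n → ℝ) × ℝ × (Fin n → ℝ))
      = (0, ∑ l, ddq l h u x, fun m => ∑ l, ddq l h (pd m u) x) := by
    refine Prod.ext ?_ (Prod.ext ?_ ?_)
    · simp [Prod.fst_sum]
    · simp [Prod.fst_sum, Prod.snd_sum]
    · ext k; simp [Prod.snd_sum, Finset.sum_apply]
  rw [e2] at e1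
  set S := ∑ m, |∑ l, ddq l h (pd m u) x| with hS
  have hS0 : 0 ≤ S := Finset.sum_nonneg fun _ _ => abs_nonneg _
  have hnC : 0 ≤ (n:ℝ) * C1 := by positivity
  have e3 : ‖((0, ∑ l, ddq l h u x, fun m => ∑ l, ddq l h (pd m u) x) : (Fin n → ℝ) × ℝ × (Fin n → ℝ))‖ ≤ n * C1 + S := by
    refine norm_prod_le_iff.2 ⟨by simp only [norm_zero]; linarith, norm_prod_le_iff.2 ⟨?_, ?_⟩⟩
    · have := hw h x hh
      show |∑ l, ddq l h u x| ≤ _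
      linarith
    · refine (pi_norm_le_iff_of_nonneg (by linarith)).2 fun m => ?_
      have : |∑ l, ddq l h (pd m u) x| ≤ S :=
        Finset.single_le_sum (f := fun m => |∑ l, ddq l h (pd m u) x|) (fun _ _ => abs_nonneg _) (Finset.mem_univ m)
      show |∑ l, ddq l h (pd m u) x| ≤ _
      linarith
  have e4 := abs_apply_le g _ (hG.dbd _) e3
  have e5 := abs_sub_abs_le_abs_sub (∑ l, ddq l h (fun y => G (gam u y)) x)
    (g (0, ∑ l, ddq l h u x, fun m => ∑ l, ddq l h (pd m u) x))
  have e6 : 0 ≤ (1 + n * C1 + (L * (n * C1) + n * (2 * L * Γ ^ 2))) * S := by positivity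
  linarith

open MeasureTheory Metric Set Matrix
open scoped ContDiff

/-- Difference quotient of the augmented Hessian. -/
noncomputable def Bq {n : ℕ} (u : (Fin n → ℝ) → ℝ) (Hc : Fin n → Fin n → (Fin n → ℝ) × ℝ × (Fin n → ℝ) → ℝ)
    (l : Fin n) (h : ℝ) (x : Fin n → ℝ) (i j : Fin n) : ℝ := dq l h (fun y => Am u Hc y i j) x

/-- Sum of the second difference quotients. -/
noncomputable def wq {n : ℕ} (u : (Fin n → ℝ) → ℝ) (h : ℝ) (x : Fin n → ℝ) : ℝ := ∑ l, ddq l h u x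

section
variable {n : ℕ} {u : (Fin n → ℝ) → ℝ} {Fc : (Fin n → ℝ) × ℝ × (Fin n → ℝ) → ℝ}
    {Hc : Fin n → Fin n → (Fin n → ℝ) × ℝ × (Fin n → ℝ) → ℝ} {L c0 : ℝ} {x₀ : Fin n → ℝ} {R2 : ℝ}

theorem Core.Acont (hC : Core u Fc Hc L c0 x₀ R2) (i j : Fin n) : Continuous (fun x => Am u Hc x i j) :=
  (cont_pd2 hC.hu i j).sub (gam_cd hC.hu (hC.hH i j).cd).continuous

theorem Core.Acpt (hC : Core u Fc Hc L c0 x₀ R2) (i j : Fin n) : HasCompactSupport (fun x => Am u Hc x i j) :=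
  (hasCompactSupport_pd (hasCompactSupport_pd hC.hc)).sub (gam_cpt (hC.hH i j).cpt)

theorem Core.Asym (hC : Core u Fc Hc L c0 x₀ R2) (x : Fin n → ℝ) (i j : Fin n) : Am u Hc x i j = Am u Hc x j i := by
  unfold Am
  rw [hC.hsym i j, pd_comm hC.hu (i := i) (j := j)]

theorem Core.Abd (hC : Core u Fc Hc L c0 x₀ R2) : ∃ a, 1 ≤ a ∧ ∀ x i j, |Am u Hc x i j| ≤ a := by
  have : ∀ i j, ∃ C, ∀ x, ‖Am u Hc x i j‖ ≤ C := fun i j => (hC.Acpt i j).exists_bound_of_continuous (hC.Acont i j)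
  choose C hCC using this
  refine ⟨1 + ∑ i, ∑ j, |C i j|, ?_, fun x i j => ?_⟩
  · have : 0 ≤ ∑ i, ∑ j, |C i j| := Finset.sum_nonneg fun _ _ => Finset.sum_nonneg fun _ _ => abs_nonneg _
    linarith
  · have h1 := Finset.single_le_sum (f := fun j => |C i j|) (fun j _ => abs_nonneg _) (Finset.mem_univ j)
    have h2 := Finset.single_le_sum (f := fun i => ∑ j, |C i j|)
      (fun j _ => Finset.sum_nonneg fun _ _ => abs_nonneg _) (Finset.mem_univ i)
    have h3 := hCC i j x
    rw [Real.norm_eq_abs] at h3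
    have h4 := le_abs_self (C i j)
    linarith

theorem Core.Auc (hC : Core u Fc Hc L c0 x₀ R2) {ε : ℝ} (hε : 0 < ε) :
    ∃ δ, 0 < δ ∧ ∀ x y, ‖x - y‖ < δ → ∀ i j, |Am u Hc x i j - Am u Hc y i j| ≤ ε := by
  have : ∀ i j, ∃ δ, 0 < δ ∧ ∀ x y, ‖x - y‖ < δ → |Am u Hc x i j - Am u Hc y i j| ≤ ε := fun i j => by
    have := (hC.Acpt i j).uniformContinuous_of_continuous (hC.Acont i j)
    obtain ⟨δ, h0, h⟩ := Metric.uniformContinuous_iff.1 this ε hε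
    refine ⟨δ, h0, fun x y hxy => ?_⟩
    have := h (a := x) (b := y) (by rwa [dist_eq_norm])
    rw [dist_eq_norm, Real.norm_eq_abs] at this
    exact this.le
  choose δ hδ0 hδ using this
  have hfin : ∃ d, 0 < d ∧ ∀ p : Fin n × Fin n, d ≤ δ p.1 p.2 := by
    have := (Filter.eventually_all (l := nhdsWithin (0:ℝ) (Ioi 0)) (p := fun (p : Fin n × Fin n) d => d ≤ δ p.1 p.2)).2
      (fun p => Filter.Eventually.filter_mono nhdsWithin_le_nhds (Iic_mem_nhds (hδ0 p.1 p.2)))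
    obtain ⟨d, h1, h2⟩ := (this.and self_mem_nhdsWithin).exists
    exact ⟨d, h2, h1⟩
  obtain ⟨d, hd, hdl⟩ := hfin
  exact ⟨d, hd, fun x y hxy i j => hδ i j x y (hxy.trans_le (hdl (i, j)))⟩

theorem Core.Aa (hC : Core u Fc Hc L c0 x₀ R2) : ∃ a, 0 < a ∧ ∀ x, fdot (Am u Hc x) (Am u Hc x) ≤ a := by
  obtain ⟨a, ha, h⟩ := hC.Abd
  refine ⟨(n:ℝ) ^ 2 * a ^ 2 + 1, by positivity, fun x => ?_⟩
  have := fdot_le_of (h x)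
  linarith

theorem Am_shift (l : Fin n) {h : ℝ} (h0 : h ≠ 0) (x : Fin n → ℝ) :
    Am u Hc (x + h • (Pi.single l 1 : Fin n → ℝ)) = fun i j => Am u Hc x i j + h * Bq u Hc l h x i j := by
  ext i j
  simp only [Bq, dq]
  field_simp; ring

theorem TT_shift (A B : Fin n → Fin n → ℝ) (h : ℝ) :
    TT (fun i j => A i j + h * B i j) (fun i j => A i j + h * B i j) = TT A A + 2 * h * TT A B + h ^ 2 * TT B B := by
  rw [TT_add, TT_comm _ A, TT_add, TT_smul, TT_smul, TT_comm (fun i j => A i j + h * B i j) B, TT_add, TT_smul,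
    TT_comm B A]
  ring

theorem norm_h_single (l : Fin n) (h : ℝ) : ‖h • (Pi.single l 1 : Fin n → ℝ)‖ ≤ |h| := by
  rw [norm_smul, Real.norm_eq_abs]
  exact mul_le_of_le_one_right (abs_nonneg _) (norm_single_le l)

theorem shift_mem {r' : ℝ} {h : ℝ} (hh : |h| < R2 - r') {x : Fin n → ℝ} (hx : x ∈ closedBall x₀ r') (l : Fin n) :
    x + h • (Pi.single l 1 : Fin n → ℝ) ∈ ball x₀ R2 := by
  rw [mem_closedBall, dist_eq_norm] at hx
  rw [mem_ball, dist_eq_norm, add_sub_right_comm]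
  have := norm_add_le (x - x₀) (h • (Pi.single l 1 : Fin n → ℝ))
  have := norm_h_single l h
  linarith

theorem Core.pw_B (hC : Core u Fc Hc L c0 x₀ R2) {r' : ℝ} (hr : r' < R2) :
    ∃ K C h0 : ℝ, 0 < K ∧ 0 < C ∧ 0 < h0 ∧ ∀ h, h ≠ 0 → |h| < h0 → ∀ l, ∀ x ∈ closedBall x₀ r',
      fdot (Bq u Hc l h x) (Bq u Hc l h x) ≤ K * (-TT (Bq u Hc l h x) (Bq u Hc l h x)) + C := by
  obtain ⟨a, ha, hA⟩ := hC.Aa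
  obtain ⟨K, K', hK, hK', hco⟩ := deficit_coercive n a c0 ha hC.c0pos
  obtain ⟨Γ, hΓ0, hΓ⟩ := gam_lip hC.hu hC.hc
  set N : ℝ := K' * (((n:ℝ) ^ 2 + 1) * (n:ℝ) ^ 2) with hN
  have hN0 : 0 ≤ N := by positivity
  set ε : ℝ := 1 / (2 * N + 1) with hε
  have hε0 : 0 < ε := by positivity
  have hε1 : N * ε ^ 2 ≤ 1 / 2 := by
    have h1 : ε ≤ 1 := by rw [hε, div_le_one (by positivity)]; linarith
    have h2 : N * ε ≤ 1 / 2 := by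
      rw [hε, mul_one_div, div_le_iff₀ (by positivity)]; linarith
    nlinarith
  obtain ⟨δ, hδ0, hδ⟩ := hC.Auc hε0
  refine ⟨2 * K, 4 * K' * (L * Γ) ^ 2, min δ (R2 - r'), by positivity, by have := hC.Lpos; positivity,
    lt_min hδ0 (by linarith), fun h h0 hh l x hx => ?_⟩
  have hxb : x ∈ ball x₀ R2 := closedBall_subset_ball hr hx
  have hx' := shift_mem (hh.trans_le (min_le_right _ _)) hx l
  set e := h • (Pi.single l 1 : Fin n → ℝ) with he
  set A := Am u Hc x with hAd
  set B := Bq u Hc l h x with hB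
  have e1 := hC.eq x hxb
  have e2 := hC.eq _ hx'
  rw [Am_shift l h0 x, TT_shift, ← hAd, ← hB] at e2
  rw [← hAd] at e1
  have hF := hC.hF.lip0 (gam u (x + e)) (gam u x)
  have hg := hΓ (x + e) x
  rw [add_sub_cancel_left] at hg
  have hen : ‖e‖ ≤ |h| := norm_h_single l h
  set DF := Fc (gam u (x + e)) - Fc (gam u x) with hDF
  have hDF1 : |DF| ≤ (L * Γ) * |h| := by
    refine hF.trans ?_
    rw [mul_assoc]
    exact mul_le_mul_of_nonneg_left (hg.trans (mul_le_mul_of_nonneg_left hen hΓ0.le)) hC.Lpos.le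
  have hDF2 : DF ^ 2 ≤ (L * Γ) ^ 2 * h ^ 2 := by
    rw [← sq_abs DF, ← sq_abs h, ← mul_pow]; exact pow_le_pow_left₀ (abs_nonneg _) hDF1 2
  have e3 : h * TT A B = DF - h * (h * TT B B / 2) := by rw [hDF]; linarith
  have hTB : (h * TT B B) ^ 2 ≤ 2 * ((n:ℝ) ^ 2 + 1) * ((n:ℝ) ^ 2 * ε ^ 2 * fdot B B) := by
    have h1 : h * TT B B = TT B (fun i j => h * B i j) := (TT_smul _ _ _).symm
    rw [h1, TT_comm]
    refine (TT_sq_le _ _).trans (mul_le_mul_of_nonneg_left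
      (mul_le_mul_of_nonneg_right (fdot_le_of fun i j => ?_) (fdot_self_nonneg _)) (by positivity))
    have := hδ (x + e) x (by rw [add_sub_cancel_left]; exact hen.trans_lt (hh.trans_le (min_le_left _ _))) i j
    rw [Am_shift l h0 x] at this
    simpa using this
  have e4 : h ^ 2 * TT A B ^ 2 ≤ h ^ 2 * (2 * (L * Γ) ^ 2 + (h * TT B B) ^ 2 / 2) := by
    have : h ^ 2 * TT A B ^ 2 = (DF - h * (h * TT B B / 2)) ^ 2 := by rw [← e3]; ring
    rw [this]
    nlinarith [sq_nonneg (DF + h * (h * TT B B / 2))]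
  have e5 : TT A B ^ 2 ≤ 2 * (L * Γ) ^ 2 + (h * TT B B) ^ 2 / 2 := le_of_mul_le_mul_left e4 (by positivity)
  have e6 := hco A B (Fc (gam u x)) (hC.tr x hxb) (hC.low x hxb) e1 (hA x)
  have hB0 := fdot_self_nonneg B
  have e7 : K' * TT A B ^ 2 ≤ K' * (2 * (L * Γ) ^ 2 + ((n:ℝ) ^ 2 + 1) * ((n:ℝ) ^ 2 * ε ^ 2 * fdot B B)) :=
    mul_le_mul_of_nonneg_left (by linarith) hK'.le
  have e8 : K' * (((n:ℝ) ^ 2 + 1) * ((n:ℝ) ^ 2 * ε ^ 2 * fdot B B)) ≤ 1 / 2 * fdot B B := by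
    have : K' * (((n:ℝ) ^ 2 + 1) * ((n:ℝ) ^ 2 * ε ^ 2 * fdot B B)) = N * ε ^ 2 * fdot B B := by rw [hN]; ring
    rw [this]; exact mul_le_mul_of_nonneg_right hε1 hB0
  linarith

theorem fderiv_ddq {v : (Fin n → ℝ) → ℝ} (hv : ContDiff ℝ 1 v) (l i : Fin n) (h : ℝ) :
    pd i (ddq l h v) = ddq l h (pd i v) := by
  ext x
  have hd : Differentiable ℝ v := hv.differentiable (by norm_num)
  have h1 : ∀ e : Fin n → ℝ, DifferentiableAt ℝ (fun y => v (y + e)) x := fun e =>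
    (hd _).comp x ((differentiableAt_id).add_const e)
  have h2 : ∀ e : Fin n → ℝ, pd i (fun y => v (y + e)) x = pd i v (x + e) := fun e => by
    unfold pd; rw [fderiv_comp_add_right]
  have h3 : ddq l h v = fun y => (h ^ 2)⁻¹ * ((v (y + h • (Pi.single l 1 : Fin n → ℝ)) - 2 * v y)
      + v (y + -(h • (Pi.single l 1 : Fin n → ℝ)))) := by
    ext y; unfold ddq; rw [div_eq_inv_mul, sub_eq_add_neg y]
  rw [h3]
  have h4 : DifferentiableAt ℝ (fun y => 2 * v y) x := (hd x).const_mul 2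
  have h5 : DifferentiableAt ℝ (fun y => v (y + h • (Pi.single l 1 : Fin n → ℝ)) - 2 * v y) x := (h1 _).sub h4
  have h6 : DifferentiableAt ℝ (fun y => (v (y + h • (Pi.single l 1 : Fin n → ℝ)) - 2 * v y)
      + v (y + -(h • (Pi.single l 1 : Fin n → ℝ)))) x := h5.add (h1 _)
  rw [pd_const_mul _ h6, pd_add h5 (h1 _), pd_sub (h1 _) h4, pd_const_mul _ (hd x), h2, h2]
  unfold ddq
  rw [div_eq_inv_mul, sub_eq_add_neg x]

theorem contDiff_ddq {v : (Fin n → ℝ) → ℝ} {k : ℕ∞} (hv : ContDiff ℝ k v) (l : Fin n) (h : ℝ) :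
    ContDiff ℝ k (ddq l h v) := by
  have h1 : ∀ e : Fin n → ℝ, ContDiff ℝ k (fun y => v (y + e)) := fun e => hv.comp (contDiff_id.add contDiff_const)
  have h2 : ∀ e : Fin n → ℝ, ContDiff ℝ k (fun y => v (y - e)) := fun e => hv.comp (contDiff_id.sub contDiff_const)
  unfold ddq
  exact (((h1 _).sub (contDiff_const.mul hv)).add (h2 _)).div_const _

theorem wq_cd (hu : ContDiff ℝ 2 u) (h : ℝ) : ContDiff ℝ 2 (wq u h) := by
  unfold wq
  exact ContDiff.sum fun l _ => contDiff_ddq (k := 2) hu l h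

theorem pd_wq (hu : ContDiff ℝ 1 u) (h : ℝ) (i : Fin n) : pd i (wq u h) = wq (pd i u) h := by
  ext x
  unfold wq
  rw [pd_sum _ fun l _ => ((contDiff_ddq (k := 1) hu l h).differentiable (by norm_num)) x]
  exact Finset.sum_congr rfl fun l _ => by rw [fderiv_ddq hu]

theorem pd_pd_wq (hu : ContDiff ℝ 2 u) (h : ℝ) (i j : Fin n) : pd i (pd j (wq u h)) = wq (pd i (pd j u)) h := by
  rw [pd_wq (hu.of_le (by norm_num)), pd_wq (contDiff_pd hu (by norm_num))]

theorem Core.lower_w (hC : Core u Fc Hc L c0 x₀ R2) {r' : ℝ} (hr : r' < R2) :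
    ∃ κ C h0 : ℝ, 0 < κ ∧ 0 < C ∧ 0 < h0 ∧ ∀ h, h ≠ 0 → |h| < h0 → (∀ x, |wq u h x| ≤ C) ∧ ∀ x ∈ closedBall x₀ r',
      κ * ∑ l, fdot (Bq u Hc l h x) (Bq u Hc l h x) ≤
        TT (Am u Hc x) (fun i j => pd i (pd j (wq u h)) x) + C * (1 + ∑ m, |pd m (wq u h) x|) := by
  obtain ⟨K, C1, h0, hK, hC1, hh0, hpw⟩ := hC.pw_B hr
  obtain ⟨a, ha, hA⟩ := hC.Aa
  obtain ⟨D, hD, hD1, hD2⟩ := dd_bound hC.hu hC.hc hC.Lpos.le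
  set E : ℝ := Real.sqrt (2 * ((n:ℝ) ^ 2 + 1) * (a * ((n:ℝ) ^ 2 * D ^ 2))) with hE
  have hE0 : 0 ≤ E := Real.sqrt_nonneg _
  refine ⟨1 / (2 * K), D + E + n * (C1 / K), min h0 (R2 - r'), by positivity, by positivity, lt_min hh0 (by linarith),
    fun h hne hh => ⟨fun x => ?_, fun x hx => ?_⟩⟩
  · have := hD1 h x hne
    have h2 : 0 ≤ n * (C1 / K) := by positivity
    unfold wq; linarith
  have hxb : x ∈ ball x₀ R2 := closedBall_subset_ball hr hx
  set S := 1 + ∑ m, |pd m (wq u h) x| with hS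
  have hS0 : 1 ≤ S := by
    have : 0 ≤ ∑ m, |pd m (wq u h) x| := Finset.sum_nonneg fun _ _ => abs_nonneg _
    linarith
  have hSe : 1 + ∑ m, |∑ l, ddq l h (pd m u) x| = S := by
    rw [hS]; simp only [pd_wq (hC.hu.of_le (by norm_num))]; rfl
  set A := Am u Hc x with hAd
  -- per-direction identity
  have hl : ∀ l, TT A (fun i j => ddq l h (fun y => Am u Hc y i j) x) =
      ddq l h (fun y => Fc (gam u y)) x - (TT (Bq u Hc l h x) (Bq u Hc l h x)
        + TT (Bq u Hc l (-h) x) (Bq u Hc l (-h) x)) / 2 := by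
    intro l
    have hhR : |h| < R2 - r' := hh.trans_le (min_le_right _ _)
    have e1 := hC.eq x hxb
    have e2 := hC.eq _ (shift_mem hhR hx l)
    have e3 := hC.eq _ (shift_mem (h := -h) (by rwa [abs_neg]) hx l)
    rw [Am_shift l hne x, TT_shift, ← hAd] at e2
    rw [Am_shift l (neg_ne_zero.2 hne) x, TT_shift, ← hAd] at e3
    have e4 : (fun i j => ddq l h (fun y => Am u Hc y i j) x)
        = fun i j => h⁻¹ * (Bq u Hc l h x i j - Bq u Hc l (-h) x i j) := by
      ext i j
      simp only [ddq, Bq, dq]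
      rw [sub_eq_add_neg x, neg_smul]
      field_simp; ring
    rw [e4, TT_smul, TT_sub]
    have e5 : ddq l h (fun y => Fc (gam u y)) x
        = (Fc (gam u (x + h • (Pi.single l 1 : Fin n → ℝ))) - 2 * Fc (gam u x) + Fc (gam u (x + (-h) • (Pi.single l 1 : Fin n → ℝ)))) / h ^ 2 := by
      simp only [ddq]; rw [sub_eq_add_neg x, neg_smul]
    rw [e5]
    field_simp
    linarith
  have hw : TT A (fun i j => pd i (pd j (wq u h)) x) = ∑ l, TT A (fun i j => ddq l h (fun y => Am u Hc y i j) x)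
      + TT A (fun i j => ∑ l, ddq l h (fun y => Hc i j (gam u y)) x) := by
    rw [← TT_sum, ← TT_add]
    congr 1
    ext i j
    rw [pd_pd_wq hC.hu, ← Finset.sum_add_distrib]
    unfold wq
    refine Finset.sum_congr rfl fun l _ => ?_
    simp only [ddq, Am]
    ring
  have hHt : |TT A (fun i j => ∑ l, ddq l h (fun y => Hc i j (gam u y)) x)| ≤ E * S := by
    refine abs_le_of_sq_le_sq ?_ (by positivity)
    refine (TT_sq_le _ _).trans ?_
    rw [mul_pow, hE, Real.sq_sqrt (by positivity)]
    have h1 := fdot_le_of (A := fun i j => ∑ l, ddq l h (fun y => Hc i j (gam u y)) x) (c := D * S)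
      (fun i j => by rw [← hSe]; exact hD2 _ (hC.hH i j) h x hne)
    have h2 := mul_le_mul (hA x) h1 (fdot_self_nonneg _) ha.le
    have h3 := mul_le_mul_of_nonneg_left h2 (show 0 ≤ 2 * ((n:ℝ) ^ 2 + 1) by positivity)
    refine h3.trans (le_of_eq ?_); ring
  have hFt := hD2 Fc hC.hF h x hne
  rw [hSe] at hFt
  have hsum : ∑ l, TT A (fun i j => ddq l h (fun y => Am u Hc y i j) x) ≥ ∑ l, ddq l h (fun y => Fc (gam u y)) x
      + 1 / (2 * K) * ∑ l, fdot (Bq u Hc l h x) (Bq u Hc l h x) - n * (C1 / K) := by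
    have : ∀ l ∈ (Finset.univ : Finset (Fin n)), ddq l h (fun y => Fc (gam u y)) x
        + 1 / (2 * K) * fdot (Bq u Hc l h x) (Bq u Hc l h x) - C1 / K
        ≤ TT A (fun i j => ddq l h (fun y => Am u Hc y i j) x) := by
      intro l _
      rw [hl l]
      have hh1 := hh.trans_le (min_le_left _ _)
      have p1 := hpw h hne hh1 l x hx
      have p2 := hpw (-h) (neg_ne_zero.2 hne) (by rwa [abs_neg]) l x hx
      have p3 := fdot_self_nonneg (Bq u Hc l (-h) x)
      set b1 := fdot (Bq u Hc l h x) (Bq u Hc l h x)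
      set b2 := fdot (Bq u Hc l (-h) x) (Bq u Hc l (-h) x)
      set t1 := TT (Bq u Hc l h x) (Bq u Hc l h x)
      set t2 := TT (Bq u Hc l (-h) x) (Bq u Hc l (-h) x)
      have q1 : 1 / (2 * K) * b1 - C1 / K ≤ - ((t1 + t2) / 2) := by
        have : 1 / (2 * K) * b1 - C1 / K = (b1 - 2 * C1) / (2 * K) := by field_simp
        rw [this, div_le_iff₀ (by positivity)]
        linarith
      linarith
    have := Finset.sum_le_sum this
    rw [Finset.sum_sub_distrib, Finset.sum_add_distrib, ← Finset.mul_sum] at this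
    simp only [Finset.sum_const, Finset.card_univ, Fintype.card_fin, nsmul_eq_mul] at this
    linarith
  have a1 := neg_le_of_abs_le hHt
  have a2 := neg_le_of_abs_le hFt
  have a3 : n * (C1 / K) ≤ n * (C1 / K) * S := le_mul_of_one_le_right (by positivity) hS0
  rw [hw]
  linarith
end

open MeasureTheory Metric Set Matrix
open scoped ContDiff

theorem int_cc {n : ℕ} {f : (Fin n → ℝ) → ℝ} (hf : Continuous f) (hc : HasCompactSupport f) : Integrable f :=
  hf.integrable_of_hasCompactSupport hc

theorem ibp {n : ℕ} {a η : (Fin n → ℝ) → ℝ} (ha : ContDiff ℝ 1 a) (hη : ContDiff ℝ 1 η) (hc : HasCompactSupport η)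
    (j : Fin n) : ∫ x, a x * pd j η x = - ∫ x, pd j a x * η x := by
  have h1 : ∀ x, pd j (fun y => a y * η y) x = pd j a x * η x + a x * pd j η x := fun x =>
    pd_mul (ha.differentiable (by norm_num) x) (hη.differentiable (by norm_num) x)
  have h2 : ∫ x, pd j (fun y => a y * η y) x = 0 := integral_pd_eq_zero (ha.mul hη) hc.mul_left
  simp only [h1] at h2
  have i1 : Integrable fun x => pd j a x * η x := int_cc ((cont_pd ha j).mul hη.continuous) hc.mul_left
  have i2 : Integrable fun x => a x * pd j η x :=
    int_cc (ha.continuous.mul (cont_pd hη j)) (hasCompactSupport_pd hc).mul_left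
  rw [integral_add i1 i2] at h2
  linarith

theorem weak_C1 {n : ℕ} {a : Fin n → Fin n → (Fin n → ℝ) → ℝ} (ha : ∀ i j, ContDiff ℝ 1 (a i j))
    {η : Fin n → (Fin n → ℝ) → ℝ} (hη : ∀ j, ContDiff ℝ 1 (η j)) (hc : ∀ j, HasCompactSupport (η j)) :
    ∫ x, TT (fun i j => a i j x) (fun i j => pd i (η j) x)
      = - ∫ x, ∑ i, ∑ j, (pd j (a i i) x * η j x - pd i (a i j) x * η j x) := by
  have e1 : ∀ x, TT (fun i j => a i j x) (fun i j => pd i (η j) x)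
      = ∑ i, ∑ j, (a i i x * pd j (η j) x - a i j x * pd i (η j) x) := by
    intro x
    unfold TT ftr fdot
    simp only [Finset.sum_sub_distrib, Finset.sum_mul_sum]
  have I1 : ∀ i j k m, Integrable (fun x => a i k x * pd m (η j) x) := fun i j k m =>
    int_cc ((ha i k).continuous.mul (cont_pd (hη j) m)) (hasCompactSupport_pd (hc j)).mul_left
  have I2 : ∀ i j k m, Integrable (fun x => pd m (a i k) x * η j x) := fun i j k m =>
    int_cc ((cont_pd (ha i k) m).mul (hη j).continuous) (hc j).mul_left
  have I3 : ∀ i j, Integrable (fun x => a i i x * pd j (η j) x - a i j x * pd i (η j) x) := fun i j =>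
    (I1 i j i j).sub (I1 i j j i)
  have I4 : ∀ i j, Integrable (fun x => pd j (a i i) x * η j x - pd i (a i j) x * η j x) := fun i j =>
    (I2 i j i j).sub (I2 i j j i)
  simp only [e1]
  rw [integral_finsetSum _ fun i _ => integrable_finsetSum _ fun j _ => I3 i j,
    integral_finsetSum _ fun i _ => integrable_finsetSum _ fun j _ => I4 i j,
    ← Finset.sum_neg_distrib]
  refine Finset.sum_congr rfl fun i _ => ?_
  rw [integral_finsetSum _ fun j _ => I3 i j,
    integral_finsetSum _ fun j _ => I4 i j, ← Finset.sum_neg_distrib]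
  refine Finset.sum_congr rfl fun j _ => ?_
  rw [integral_sub (I1 i j i j) (I1 i j j i), integral_sub (I2 i j i j) (I2 i j j i), ibp (ha i i) (hη j) (hc j),
    ibp (ha i j) (hη j) (hc j)]
  ring

theorem cont_TT {n : ℕ} {X : Type*} [TopologicalSpace X] {A B : X → Fin n → Fin n → ℝ}
    (hA : ∀ i j, Continuous fun x => A x i j) (hB : ∀ i j, Continuous fun x => B x i j) :
    Continuous fun x => TT (A x) (B x) := by
  unfold TT ftr fdot
  exact ((continuous_finsetSum _ fun i _ => hA i i).mul (continuous_finsetSum _ fun i _ => hB i i)).sub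
    (continuous_finsetSum _ fun i _ => continuous_finsetSum _ fun j _ => (hA i j).mul (hB i j))

theorem cont_fdot {n : ℕ} {X : Type*} [TopologicalSpace X] {A B : X → Fin n → Fin n → ℝ}
    (hA : ∀ i j, Continuous fun x => A x i j) (hB : ∀ i j, Continuous fun x => B x i j) :
    Continuous fun x => fdot (A x) (B x) := by
  unfold fdot
  exact continuous_finsetSum _ fun i _ => continuous_finsetSum _ fun j _ => (hA i j).mul (hB i j)

theorem TT_zero {n : ℕ} (A : Fin n → Fin n → ℝ) : TT A (fun _ _ => 0) = 0 := by
  unfold TT ftr fdot; simp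

theorem cpt_family {n : ℕ} {η : Fin n → (Fin n → ℝ) → ℝ} (hc : ∀ j, HasCompactSupport (η j)) :
    ∃ K : Set (Fin n → ℝ), IsCompact K ∧ ∀ x ∉ K, ∀ j, η j x = 0 ∧ ∀ i, pd i (η j) x = 0 := by
  refine ⟨⋃ j, tsupport (η j), isCompact_iUnion fun j => hc j, fun x hx j => ?_⟩
  have : x ∉ tsupport (η j) := fun h => hx (mem_iUnion.2 ⟨j, h⟩)
  exact ⟨image_eq_zero_of_notMem_tsupport this, fun i => pd_eq_zero_of_notMem this⟩

theorem weak_D2 {n : ℕ} {u : (Fin n → ℝ) → ℝ} (hu : ContDiff ℝ 2 u) (hcu : HasCompactSupport u)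
    {η : Fin n → (Fin n → ℝ) → ℝ} (hη : ∀ j, ContDiff ℝ 1 (η j)) (hc : ∀ j, HasCompactSupport (η j)) :
    ∫ x, TT (fun i j => pd i (pd j u) x) (fun i j => pd i (η j) x) = 0 := by
  obtain ⟨K, hK, hK0⟩ := cpt_family hc
  have cB : ∀ i j, Continuous fun x => pd i (η j) x := fun i j => cont_pd (hη j) i
  have z : ∀ x ∉ K, (fun i j => pd i (η j) x) = fun _ _ => (0:ℝ) := fun x hx => by
    ext i j; exact (hK0 x hx j).2 i
  have IT : ∀ A : (Fin n → ℝ) → Fin n → Fin n → ℝ, (∀ i j, Continuous fun x => A x i j) →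
      Integrable fun x => TT (A x) (fun i j => pd i (η j) x) := fun A hA =>
    int_cc (cont_TT hA cB) (HasCompactSupport.intro hK fun x hx => by rw [z x hx, TT_zero])
  set G : (Fin n → ℝ) → ℝ := fun x => Real.sqrt (2 * ((n:ℝ) ^ 2 + 1) * ((n:ℝ) ^ 2 *
    fdot (fun i j => pd i (η j) x) (fun i j => pd i (η j) x))) with hG
  have hGi : Integrable G := int_cc (Real.continuous_sqrt.comp (continuous_const.mul (continuous_const.mul (cont_fdot cB cB))))
    (HasCompactSupport.intro hK fun x hx => by simp only [hG]; rw [z x hx]; simp [fdot])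
  have key : ∀ δ, 0 < δ → |∫ x, TT (fun i j => pd i (pd j u) x) (fun i j => pd i (η j) x)| ≤ δ * ∫ x, G x := by
    intro δ hδ
    obtain ⟨m, hm⟩ := (conv_u hu hcu hδ).exists
    have hus : ContDiff ℝ ∞ (mol m u) := mol_smooth m hu.continuous
    have h0 : ∫ x, TT (fun i j => pd i (pd j (mol m u)) x) (fun i j => pd i (η j) x) = 0 := by
      rw [weak_C1 (a := fun i j => pd i (pd j (mol m u)))
        (fun i j => sm_one (contDiff_pd_top (contDiff_pd_top hus))) hη hc]
      rw [neg_eq_zero]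
      have : ∀ x, ∑ i, ∑ j, (pd j (pd i (pd i (mol m u))) x * η j x - pd i (pd i (pd j (mol m u))) x * η j x) = 0 := by
        intro x
        refine Finset.sum_eq_zero fun i _ => Finset.sum_eq_zero fun j _ => ?_
        rw [pd_comm (sm_two hus) (i := i) (j := j), pd_comm (sm_two (contDiff_pd_top hus)) (i := i) (j := j), sub_self]
      simp only [this, integral_zero]
    have h1 : ∫ x, TT (fun i j => pd i (pd j u) x) (fun i j => pd i (η j) x)
        = ∫ x, TT (fun i j => pd i (pd j u) x - pd i (pd j (mol m u)) x) (fun i j => pd i (η j) x) := by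
      have : ∀ x, TT (fun i j => pd i (pd j u) x - pd i (pd j (mol m u)) x) (fun i j => pd i (η j) x)
          = TT (fun i j => pd i (pd j u) x) (fun i j => pd i (η j) x)
          - TT (fun i j => pd i (pd j (mol m u)) x) (fun i j => pd i (η j) x) := by
        intro x; rw [TT_comm, TT_sub, TT_comm, TT_comm (fun i j => pd i (η j) x)]
      simp only [this]
      rw [integral_sub (IT _ fun i j => cont_pd2 hu i j) (IT _ fun i j => cont_pd2 (sm_two hus) i j), h0, sub_zero]
    rw [h1, ← integral_const_mul]
    refine (abs_integral_le_integral_abs).trans (integral_mono_of_nonneg (Filter.Eventually.of_forall fun x => abs_nonneg _)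
      (hGi.const_mul δ) (Filter.Eventually.of_forall fun x => ?_))
    refine abs_le_of_sq_le_sq ?_ (mul_nonneg hδ.le (Real.sqrt_nonneg _))
    refine (TT_sq_le _ _).trans ?_
    have f0 := fdot_self_nonneg (fun i j => pd i (η j) x)
    rw [mul_pow, hG, Real.sq_sqrt (by positivity)]
    have := fdot_le_of (A := fun i j => pd i (pd j u) x - pd i (pd j (mol m u)) x) (c := δ) fun i j => by
      rw [abs_sub_comm]; exact hm.2.2 i j x
    have h2 := mul_le_mul_of_nonneg_left (mul_le_mul_of_nonneg_right this f0) (show 0 ≤ 2 * ((n:ℝ) ^ 2 + 1) by positivity)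
    refine h2.trans (le_of_eq ?_); ring
  have hG0 : 0 ≤ ∫ x, G x := integral_nonneg fun x => Real.sqrt_nonneg _
  by_contra hne
  have hp : 0 < |∫ x, TT (fun i j => pd i (pd j u) x) (fun i j => pd i (η j) x)| := abs_pos.2 hne
  set I := |∫ x, TT (fun i j => pd i (pd j u) x) (fun i j => pd i (η j) x)|
  have := key (I / (2 * ((∫ x, G x) + 1))) (by positivity)
  rw [div_mul_eq_mul_div, le_div_iff₀ (by positivity)] at this
  nlinarith

theorem Core.weak {n : ℕ} {u : (Fin n → ℝ) → ℝ} {Fc : (Fin n → ℝ) × ℝ × (Fin n → ℝ) → ℝ}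
    {Hc : Fin n → Fin n → (Fin n → ℝ) × ℝ × (Fin n → ℝ) → ℝ} {L c0 : ℝ} {x₀ : Fin n → ℝ} {R2 : ℝ}
    (hC : Core u Fc Hc L c0 x₀ R2)
    {η : Fin n → (Fin n → ℝ) → ℝ} (hη : ∀ j, ContDiff ℝ 1 (η j)) (hc : ∀ j, HasCompactSupport (η j)) :
    ∫ x, (TT (Am u Hc x) (fun i j => pd i (η j) x) - ∑ i, ∑ j, (pd j (fun y => Hc i i (gam u y)) x * η j x
      - pd i (fun y => Hc i j (gam u y)) x * η j x)) = 0 := by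
  obtain ⟨K, hK, hK0⟩ := cpt_family hc
  have cB : ∀ i j, Continuous fun x => pd i (η j) x := fun i j => cont_pd (hη j) i
  have IT : ∀ A : (Fin n → ℝ) → Fin n → Fin n → ℝ, (∀ i j, Continuous fun x => A x i j) →
      Integrable fun x => TT (A x) (fun i j => pd i (η j) x) := fun A hA =>
    int_cc (cont_TT hA cB) (HasCompactSupport.intro hK fun x hx => by
      have : (fun i j => pd i (η j) x) = fun _ _ => (0:ℝ) := by ext i j; exact (hK0 x hx j).2 i
      rw [this, TT_zero])
  have hH1 : ∀ i j, ContDiff ℝ 1 (fun y => Hc i j (gam u y)) := fun i j => gam_cd hC.hu (hC.hH i j).cd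
  have I2 : Integrable fun x => ∑ i, ∑ j, (pd j (fun y => Hc i i (gam u y)) x * η j x
      - pd i (fun y => Hc i j (gam u y)) x * η j x) :=
    integrable_finsetSum _ fun i _ => integrable_finsetSum _ fun j _ =>
      (int_cc ((cont_pd (hH1 i i) j).mul (hη j).continuous) (hc j).mul_left).sub
      (int_cc ((cont_pd (hH1 i j) i).mul (hη j).continuous) (hc j).mul_left)
  rw [integral_sub (IT _ hC.Acont) I2]
  have e : ∀ x, TT (Am u Hc x) (fun i j => pd i (η j) x) = TT (fun i j => pd i (pd j u) x) (fun i j => pd i (η j) x)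
      - TT (fun i j => Hc i j (gam u x)) (fun i j => pd i (η j) x) := by
    intro x
    rw [TT_comm (fun i j => pd i (pd j u) x), TT_comm (fun i j => Hc i j (gam u x)), ← TT_sub, TT_comm]
    rfl
  simp only [e]
  rw [integral_sub (IT _ fun i j => cont_pd2 hC.hu i j) (IT _ fun i j => (hH1 i j).continuous), weak_D2 hC.hu hC.hc hη hc,
    weak_C1 hH1 hη hc]
  ring

open MeasureTheory Metric Set Matrix
open scoped ContDiff

theorem TT_rank_one {n : ℕ} (A : Fin n → Fin n → ℝ) (ξ η : Fin n → ℝ) :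
    TT A (fun i j => ξ i * η j) = Tq A ξ η := by
  unfold TT Tq ftr fdot
  simp only [mul_assoc]

theorem stage1_scalar {a1 S m X Y Z φ ψ Λ C κ E2 c2 C3 P : ℝ} (hφ0 : 0 ≤ φ) (hφ1 : φ ≤ 1) (hS : 0 ≤ S) (hm : 0 ≤ m)
    (hκ : 0 < κ) (hC : 0 < C) (hc2 : 0 < c2) (hC3 : 0 ≤ C3) (hΛ : 1 ≤ Λ)
    (hψ1 : φ ^ 2 ≤ ψ) (hψ2 : ψ ≤ Λ * φ ^ 2)
    (ha : κ * S ≤ a1 + C * (1 + m)) (hX : |X| ≤ Λ * φ * (E2 * m)) (hY : c2 * m ^ 2 ≤ Y) (hZ : |Z| ≤ ψ * (C3 * m))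
    (hP : P = ψ * a1 + (2 * X + φ ^ 2 * Y) - Z) :
    κ * (φ ^ 2 * S) - (Λ * C + (Λ * (C + C3) + 2 * Λ * E2) ^ 2 / (4 * c2)) ≤ P := by
  have hψ0 : 0 ≤ ψ := (sq_nonneg φ).trans hψ1
  have hp2 : φ ^ 2 ≤ φ := by nlinarith
  have hp3 : φ ^ 2 ≤ 1 := hp2.trans hφ1
  have h1 : ψ * (κ * S) ≤ ψ * (a1 + C * (1 + m)) := mul_le_mul_of_nonneg_left ha hψ0
  have h2 : φ ^ 2 * (κ * S) ≤ ψ * (κ * S) := mul_le_mul_of_nonneg_right hψ1 (by positivity)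
  have h3 : ψ * C ≤ Λ * C := by
    refine mul_le_mul_of_nonneg_right (hψ2.trans ?_) hC.le
    exact mul_le_of_le_one_right (by linarith) hp3
  have h4 : ψ * ((C + C3) * m) ≤ Λ * (C + C3) * (φ * m) := by
    have : ψ ≤ Λ * φ := hψ2.trans (mul_le_mul_of_nonneg_left hp2 (by linarith))
    calc _ ≤ Λ * φ * ((C + C3) * m) := mul_le_mul_of_nonneg_right this (by positivity)
      _ = _ := by ring
  have h5 : φ ^ 2 * (c2 * m ^ 2) ≤ φ ^ 2 * Y := mul_le_mul_of_nonneg_left hY (sq_nonneg _)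
  set Q := Λ * (C + C3) + 2 * Λ * E2 with hQ
  have h6 : Q * (φ * m) ≤ c2 * (φ * m) ^ 2 + Q ^ 2 / (4 * c2) := by
    have : c2 * (φ * m) ^ 2 + Q ^ 2 / (4 * c2) - Q * (φ * m) = (2 * c2 * (φ * m) - Q) ^ 2 / (4 * c2) := by
      field_simp; ring
    have h0 : 0 ≤ (2 * c2 * (φ * m) - Q) ^ 2 / (4 * c2) := by positivity
    linarith
  have h7 := neg_le_of_abs_le hX
  have h8 := le_of_abs_le hZ
  have h9 : Q * (φ * m) = Λ * (C + C3) * (φ * m) + 2 * (Λ * φ * (E2 * m)) := by rw [hQ]; ring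
  have h10 : φ ^ 2 * (c2 * m ^ 2) = c2 * (φ * m) ^ 2 := by ring
  have h11 : ψ * (a1 + C * (1 + m)) + ψ * (C3 * m) = ψ * a1 + ψ * C + ψ * ((C + C3) * m) + 0 := by ring
  rw [hP]
  linarith

theorem Core.stage1 {n : ℕ} {u : (Fin n → ℝ) → ℝ} {Fc : (Fin n → ℝ) × ℝ × (Fin n → ℝ) → ℝ}
    {Hc : Fin n → Fin n → (Fin n → ℝ) × ℝ × (Fin n → ℝ) → ℝ} {L c0 : ℝ} {x₀ : Fin n → ℝ} {R2 : ℝ}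
    (hC : Core u Fc Hc L c0 x₀ R2) {rb : ℝ} (hr0 : 0 ≤ rb) (hrb : rb < R2) :
    ∃ C h0 : ℝ, 0 < C ∧ 0 < h0 ∧ ∀ h, h ≠ 0 → |h| < h0 → ∀ l,
      ∫ x in closedBall x₀ rb, fdot (Bq u Hc l h x) (Bq u Hc l h x) ≤ C := by
  set r' := (rb + R2) / 2 with hr'
  have hr'R : r' < R2 := by rw [hr']; linarith
  obtain ⟨Cφ, hCφ, hcut⟩ := cutoff n
  obtain ⟨φ, φs, φc, φsup, φ1, φ01, φd⟩ := hcut x₀ rb (r' - rb) hr0 (by rw [hr']; linarith)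
  rw [add_sub_cancel] at φsup
  set Dφ := Cφ / (r' - rb) with hDφ
  have hDφ0 : 0 < Dφ := div_pos hCφ (by rw [hr']; linarith)
  obtain ⟨κ, C, h0, hκ, hCp, hh0, hlow⟩ := hC.lower_w hr'R
  obtain ⟨a, ha, hA⟩ := hC.Aa
  obtain ⟨D, hD1, -, -, -, hD⟩ := bdd_dgam hC.hu hC.hc
  have hHd : ∀ i j k x, |pd k (fun y => Hc i j (gam u y)) x| ≤ L * D := fun i j k x => by
    rw [pd_comp_gam hC.hu (hC.hH i j).cd]
    exact abs_apply_le _ _ ((hC.hH i j).dbd _) (hD k x)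
  set T : ℝ := Real.sqrt (n * a) + 1 with hT
  have hT0 : 0 < T := by positivity
  have htr : ∀ x, ftr (Am u Hc x) ≤ T := fun x => by
    have h1 : ftr (Am u Hc x) ≤ Real.sqrt (n * a) := Real.le_sqrt_of_sq_le
      ((ftr_sq_le _).trans (mul_le_mul_of_nonneg_left (hA x) (Nat.cast_nonneg n)))
    linarith
  set c2 : ℝ := c0 / T / (n + 1) with hc2
  have hc2p : 0 < c2 := by have := hC.c0pos; positivity
  set E2 : ℝ := Real.sqrt (2 * ((n:ℝ) ^ 2 + 1) * (a * ((n:ℝ) ^ 2 * Dφ ^ 2))) with hE2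
  have hE20 : 0 ≤ E2 := Real.sqrt_nonneg _
  set C3 : ℝ := n * (2 * (L * D)) with hC3
  have hLD : 0 ≤ L * D := mul_nonneg hC.Lpos.le (by linarith)
  have hC30 : 0 ≤ C3 := by positivity
  set Λ : ℝ := 2 * C + 1 with hΛ
  set Q : ℝ := Λ * C + (Λ * (C + C3) + 2 * Λ * E2) ^ 2 / (4 * c2) with hQ
  have hQ0 : 0 ≤ Q := by positivity
  set vol := (volume (closedBall x₀ r')).toReal with hvol
  refine ⟨Q * vol / κ + 1, h0, by positivity, hh0, fun h hne hh l => ?_⟩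
  obtain ⟨hwb, hlw⟩ := hlow h hne hh
  set w := wq u h with hw
  have hwcd : ContDiff ℝ 2 w := wq_cd hC.hu h
  have hwd : Differentiable ℝ w := hwcd.differentiable (by norm_num)
  set ψ : (Fin n → ℝ) → ℝ := fun x => φ x ^ 2 * (w x + (C + 1)) with hψ
  have ψcd : ContDiff ℝ 1 ψ := ((φs.of_le (by norm_cast)).pow 2 |>.of_le (by norm_cast)).mul ((hwcd.of_le (by norm_num)).add contDiff_const)
  have pψ : ∀ i x, pd i ψ x = 2 * (φ x * (w x + (C + 1))) * pd i φ x + φ x ^ 2 * pd i w x := by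
    intro i x
    have d1 : DifferentiableAt ℝ φ x := sm_diff φs x
    have d2 : DifferentiableAt ℝ (fun y => w y + (C + 1)) x := (hwd x).add_const _
    have d3 : DifferentiableAt ℝ (fun y => φ y * φ y) x := d1.mul d1
    have e : ψ = fun y => (φ y * φ y) * (w y + (C + 1)) := by ext y; simp only [hψ]; ring
    rw [e, pd_mul d3 d2, pd_mul d1 d1, pd_add (hwd x) (differentiableAt_const _), pd_const]
    ring
  have ψc : HasCompactSupport ψ := by
    refine HasCompactSupport.intro φc fun x hx => ?_
    simp only [hψ]; rw [image_eq_zero_of_notMem_tsupport hx]; ring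
  set η : Fin n → (Fin n → ℝ) → ℝ := fun j x => ψ x * pd j w x with hη
  have wjcd : ∀ j, ContDiff ℝ 1 (pd j w) := fun j => contDiff_pd hwcd (by norm_num)
  have ηcd : ∀ j, ContDiff ℝ 1 (η j) := fun j => ψcd.mul (wjcd j)
  have ηc : ∀ j, HasCompactSupport (η j) := fun j => ψc.mul_right
  have hweak := hC.weak ηcd ηc
  set P : (Fin n → ℝ) → ℝ := fun x => TT (Am u Hc x) (fun i j => pd i (η j) x)
    - ∑ i, ∑ j, (pd j (fun y => Hc i i (gam u y)) x * η j x - pd i (fun y => Hc i j (gam u y)) x * η j x) with hP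
  have hH1 : ∀ i j, ContDiff ℝ 1 (fun y => Hc i j (gam u y)) := fun i j => gam_cd hC.hu (hC.hH i j).cd
  have Pcont : Continuous P := (cont_TT hC.Acont fun i j => cont_pd (ηcd j) i).sub
    (continuous_finsetSum _ fun i _ => continuous_finsetSum _ fun j _ =>
      ((cont_pd (hH1 i i) j).mul (ηcd j).continuous).sub ((cont_pd (hH1 i j) i).mul (ηcd j).continuous))
  have Pz : ∀ x ∉ closedBall x₀ r', P x = 0 := by
    intro x hx
    have hx' : x ∉ tsupport φ := fun h => hx (φsup h)
    have z1 : ∀ j, η j =ᶠ[nhds x] fun _ => 0 := fun j => by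
      filter_upwards [(isClosed_tsupport φ).isOpen_compl.mem_nhds hx'] with y hy
      simp only [hη, hψ]; rw [image_eq_zero_of_notMem_tsupport hy]; ring
    have z2 : (fun i j => pd i (η j) x) = fun _ _ => (0:ℝ) := by
      ext i j; rw [pd_congr_of_eventuallyEq (z1 j), pd_const]
    have z3 : ∀ j, η j x = 0 := fun j => (z1 j).self_of_nhds
    simp only [hP]
    rw [z2, TT_zero]; simp [z3]
  have hPint : ∫ x in closedBall x₀ r', P x = 0 := by
    rw [setIntegral_eq_integral_of_forall_compl_eq_zero Pz]; exact hweak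
  set S : (Fin n → ℝ) → ℝ := fun x => ∑ l, fdot (Bq u Hc l h x) (Bq u Hc l h x) with hS
  have cB : ∀ l i j, Continuous fun x => Bq u Hc l h x i j := fun l i j => by
    have h1 := hC.Acont i j
    unfold Bq dq
    exact ((h1.comp (continuous_id.add continuous_const)).sub h1).div_const _
  have Sc : Continuous S := continuous_finsetSum _ fun l _ => cont_fdot (cB l) (cB l)
  have S0 : ∀ x, 0 ≤ S x := fun x => Finset.sum_nonneg fun l _ => fdot_self_nonneg _
  have hpt : ∀ x ∈ closedBall x₀ r', κ * (φ x ^ 2 * S x) - Q ≤ P x := by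
    intro x hx
    have hxb := closedBall_subset_ball hr'R hx
    have hwx := abs_le.1 (hwb x)
    set m := ∑ k, |pd k w x| with hm
    have hm0 : 0 ≤ m := Finset.sum_nonneg fun _ _ => abs_nonneg _
    have hmk : ∀ k, |pd k w x| ≤ m := fun k =>
      Finset.single_le_sum (f := fun k => |pd k w x|) (fun _ _ => abs_nonneg _) (Finset.mem_univ k)
    have hφ := φ01 x
    refine stage1_scalar (a1 := TT (Am u Hc x) (fun i j => pd i (pd j w) x)) (m := m)
      (X := φ x * (w x + (C + 1)) * Tq (Am u Hc x) (fun i => pd i φ x) (fun i => pd i w x))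
      (Y := Tq (Am u Hc x) (fun i => pd i w x) (fun i => pd i w x))
      (Z := ∑ i, ∑ j, (pd j (fun y => Hc i i (gam u y)) x * η j x - pd i (fun y => Hc i j (gam u y)) x * η j x))
      (ψ := ψ x) (P := P x) hφ.1 hφ.2 (S0 x) hm0 hκ hCp hc2p hC30 (by rw [hΛ]; linarith) ?_ ?_ (hlw x hx) ?_ ?_ ?_ ?_
    · simp only [hψ]; exact le_mul_of_one_le_right (sq_nonneg _) (by linarith)
    · simp only [hψ]; rw [mul_comm]; exact mul_le_mul_of_nonneg_right (by rw [hΛ]; linarith) (sq_nonneg _)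
    · rw [abs_mul, abs_mul, abs_of_nonneg hφ.1, abs_of_nonneg (by linarith : 0 ≤ w x + (C + 1))]
      refine mul_le_mul ?_ ?_ (abs_nonneg _) (by rw [hΛ]; have := hφ.1; positivity)
      · rw [mul_comm]; exact mul_le_mul_of_nonneg_right (by rw [hΛ]; linarith) hφ.1
      · rw [← TT_rank_one]
        refine abs_le_of_sq_le_sq ?_ (by positivity)
        refine (TT_sq_le _ _).trans ?_
        rw [mul_pow, hE2, Real.sq_sqrt (by positivity)]
        have h1 := fdot_le_of (A := fun i j => pd i φ x * pd j w x) (c := Dφ * m) fun i j => by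
          rw [abs_mul]; exact mul_le_mul (φd i x) (hmk j) (abs_nonneg _) hDφ0.le
        have h2 := mul_le_mul (hA x) h1 (fdot_self_nonneg _) ha.le
        have h3 := mul_le_mul_of_nonneg_left h2 (show 0 ≤ 2 * ((n:ℝ) ^ 2 + 1) by positivity)
        refine h3.trans (le_of_eq ?_); ring
    · have e1 := hC.eq x hxb
      have htx := hC.tr x hxb
      have hlx := hC.low x hxb
      have hg : 0 < Fc (gam u x) := hC.c0pos.trans_le hlx
      have e2 := newton_lower (Am u Hc x) htx hg (by unfold TT at e1; rw [sq]; exact e1) (fun i => pd i w x)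
      have e3 : Tq (Am u Hc x) (fun i => pd i w x) (fun i => pd i w x) =
          ftr (Am u Hc x) * ∑ i, pd i w x ^ 2 - ∑ i, ∑ j, Am u Hc x i j * pd i w x * pd j w x := by
        unfold Tq ftr; simp only [sq]
      rw [e3]
      refine le_trans ?_ e2
      set W := ∑ i, pd i w x ^ 2 with hW
      have hW0 : 0 ≤ W := Finset.sum_nonneg fun _ _ => sq_nonneg _
      have h1 : m ^ 2 ≤ (n + 1) * W := by
        have := sq_sum_le_card_mul_sum_sq (s := (Finset.univ : Finset (Fin n))) (f := fun i => |pd i w x|)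
        simp only [Finset.card_univ, Fintype.card_fin, sq_abs] at this
        linarith
      have h2 : c0 / T ≤ Fc (gam u x) / ftr (Am u Hc x) := div_le_div₀ hg.le hlx htx (htr x)
      calc c2 * m ^ 2 ≤ c2 * ((n + 1) * W) := mul_le_mul_of_nonneg_left h1 hc2p.le
        _ = c0 / T * W := by rw [hc2]; field_simp
        _ ≤ _ := mul_le_mul_of_nonneg_right h2 hW0
    · have hψ0 : 0 ≤ ψ x := by simp only [hψ]; exact mul_nonneg (sq_nonneg _) (by linarith)
      have e1 : ψ x * (C3 * m) = n * (2 * (L * D) * (ψ x * m)) := by rw [hC3]; ring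
      rw [e1]
      refine abs_sum_le_of fun i => ?_
      refine (Finset.abs_sum_le_sum_abs _ _).trans ?_
      rw [hm, Finset.mul_sum, Finset.mul_sum]
      refine Finset.sum_le_sum fun j _ => ?_
      rw [← sub_mul, abs_mul]
      simp only [hη]
      rw [abs_mul (ψ x), abs_of_nonneg hψ0]
      refine mul_le_mul_of_nonneg_right ?_ (mul_nonneg hψ0 (abs_nonneg _))
      have b1 := hHd i i j x
      have b2 := hHd i j i x
      have b3 := abs_sub (pd j (fun y => Hc i i (gam u y)) x) (pd i (fun y => Hc i j (gam u y)) x)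
      linarith
    · simp only [hP]
      congr 1
      have e1 : (fun i j => pd i (η j) x) = fun i j => ψ x * pd i (pd j w) x
          + ((2 * (φ x * (w x + (C + 1)))) * (pd i φ x * pd j w x) + φ x ^ 2 * (pd i w x * pd j w x)) := by
        ext i j
        have : pd i (η j) x = pd i ψ x * pd j w x + ψ x * pd i (pd j w) x :=
          pd_mul (ψcd.differentiable (by norm_num) x) ((wjcd j).differentiable (by norm_num) x)
        rw [this, pψ]; ring
      rw [e1, TT_add, TT_add, TT_smul, TT_smul, TT_smul, TT_rank_one, TT_rank_one]
      ring
  have hcp := isCompact_closedBall x₀ r'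
  have φcont := φs.continuous
  have Fcont : Continuous fun x => κ * (φ x ^ 2 * S x) := continuous_const.mul ((φcont.pow 2).mul Sc)
  have i1 : IntegrableOn (fun x => κ * (φ x ^ 2 * S x)) (closedBall x₀ r') := Fcont.continuousOn.integrableOn_compact hcp
  have i2 : IntegrableOn (fun _ : Fin n → ℝ => Q) (closedBall x₀ r') := continuous_const.continuousOn.integrableOn_compact hcp
  have i3 : IntegrableOn (fun x => κ * (φ x ^ 2 * S x) - Q) (closedBall x₀ r') := i1.sub i2
  have hmono := setIntegral_mono_on i3 (Pcont.continuousOn.integrableOn_compact hcp) measurableSet_closedBall hpt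
  have hsub : ∫ x in closedBall x₀ r', (κ * (φ x ^ 2 * S x) - Q)
      = κ * (∫ x in closedBall x₀ r', φ x ^ 2 * S x) - Q * vol := by
    rw [integral_sub i1 i2, integral_const_mul, setIntegral_const, smul_eq_mul, mul_comm Q]; rfl
  rw [hsub, hPint] at hmono
  have hfin : ∫ x in closedBall x₀ r', φ x ^ 2 * S x ≤ Q * vol / κ := by
    rw [le_div_iff₀ hκ]; linarith
  have hcmp : ∫ x in closedBall x₀ rb, fdot (Bq u Hc l h x) (Bq u Hc l h x) ≤ ∫ x in closedBall x₀ r', φ x ^ 2 * S x := by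
    have c1 : Continuous fun x => φ x ^ 2 * S x := (φcont.pow 2).mul Sc
    refine (setIntegral_mono_on ((cont_fdot (cB l) (cB l)).continuousOn.integrableOn_compact (isCompact_closedBall x₀ rb))
      (c1.continuousOn.integrableOn_compact (isCompact_closedBall x₀ rb)) measurableSet_closedBall fun x hx => ?_).trans
      (setIntegral_mono_set (c1.continuousOn.integrableOn_compact hcp)
        (Filter.Eventually.of_forall fun x => mul_nonneg (sq_nonneg _) (S0 x))
        (Filter.Eventually.of_forall (closedBall_subset_closedBall (by rw [hr']; linarith))))
    rw [φ1 x hx, one_pow, one_mul]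
    exact Finset.single_le_sum (f := fun l => fdot (Bq u Hc l h x) (Bq u Hc l h x))
      (fun l _ => fdot_self_nonneg _) (Finset.mem_univ l)
  linarith

open MeasureTheory Metric Set Matrix
open scoped ContDiff

theorem dq_tendsto {n : ℕ} {g : (Fin n → ℝ) → ℝ} (hg : ContDiff ℝ 1 g) (l : Fin n) (x : Fin n → ℝ) :
    Filter.Tendsto (fun k => dq l k g x) (nhdsWithin 0 {0}ᶜ) (nhds (pd l g x)) := by
  have h1 : HasFDerivAt g (fderiv ℝ g x) x := (hg.differentiable (by norm_num) x).hasFDerivAt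
  have h2 : HasLineDerivAt ℝ g (fderiv ℝ g x (Pi.single l 1)) x (Pi.single l 1) := h1.hasLineDerivAt _
  have h3 := h2.tendsto_slope_zero
  refine h3.congr fun k => ?_
  unfold dq; rw [smul_eq_mul, div_eq_inv_mul]

theorem dq_bound {n : ℕ} {g : (Fin n → ℝ) → ℝ} (hg : ContDiff ℝ 1 g) (l : Fin n) (x₀ : Fin n → ℝ) (r : ℝ) :
    ∃ D, ∀ k, k ≠ 0 → |k| ≤ 1 → ∀ x ∈ closedBall x₀ r, |dq l k g x| ≤ D := by
  obtain ⟨D, hD⟩ := (isCompact_closedBall x₀ (r + 1)).exists_bound_of_continuousOn (f := fderiv ℝ g)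
    (hg.continuous_fderiv (by norm_num)).continuousOn
  refine ⟨D, fun k hk hk1 x hx => ?_⟩
  have hx1 : x ∈ closedBall x₀ (r + 1) := closedBall_subset_closedBall (by linarith) hx
  have hx2 : x + k • (Pi.single l 1 : Fin n → ℝ) ∈ closedBall x₀ (r + 1) := by
    rw [mem_closedBall, dist_eq_norm] at hx ⊢
    rw [add_sub_right_comm]
    have := norm_add_le (x - x₀) (k • (Pi.single l 1 : Fin n → ℝ))
    have := norm_h_single l k
    linarith
  have h := (convex_closedBall x₀ (r + 1)).norm_image_sub_le_of_norm_fderiv_le (𝕜 := ℝ) (f := g)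
    (fun z _ => hg.differentiable (by norm_num) z) hD hx1 hx2
  rw [add_sub_cancel_left, Real.norm_eq_abs] at h
  have hD0 : 0 ≤ D := (norm_nonneg _).trans (hD x hx1)
  unfold dq
  rw [abs_div, div_le_iff₀ (abs_pos.2 hk)]
  exact h.trans (mul_le_mul_of_nonneg_left (norm_h_single l k) hD0)

theorem dq_cont {n : ℕ} {g : (Fin n → ℝ) → ℝ} (hg : Continuous g) (l : Fin n) (k : ℝ) : Continuous (dq l k g) := by
  unfold dq
  exact ((hg.comp (continuous_id.add continuous_const)).sub hg).div_const _

theorem dq_limit {n : ℕ} {Φ : (Fin n → ℝ) → (Fin n → Fin n → ℝ) → ℝ → ℝ}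
    (hΦ : Continuous fun p : (Fin n → ℝ) × (Fin n → Fin n → ℝ) × ℝ => Φ p.1 p.2.1 p.2.2)
    {g : Fin n → Fin n → (Fin n → ℝ) → ℝ} (hg : ∀ i j, ContDiff ℝ 1 (g i j)) {f : (Fin n → ℝ) → ℝ} (hf : ContDiff ℝ 1 f)
    (l : Fin n) (x₀ : Fin n → ℝ) (r c h0 : ℝ) (hh0 : 0 < h0)
    (hb : ∀ k, k ≠ 0 → |k| < h0 → ∫ x in closedBall x₀ r, Φ x (fun i j => dq l k (g i j) x) (dq l k f x) ≤ c) :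
    ∫ x in closedBall x₀ r, Φ x (fun i j => pd l (g i j) x) (pd l f x) ≤ c := by
  have h1 := fun i j => dq_bound (hg i j) l x₀ r
  choose D hD using h1
  obtain ⟨Df, hDf⟩ := dq_bound hf l x₀ r
  set E : ℝ := ∑ i, ∑ j, |D i j| with hE
  have hEij : ∀ i j, D i j ≤ E := fun i j => by
    have h1 := Finset.single_le_sum (f := fun j => |D i j|) (fun j _ => abs_nonneg _) (Finset.mem_univ j)
    have h2 := Finset.single_le_sum (f := fun i => ∑ j, |D i j|)
      (fun j _ => Finset.sum_nonneg fun _ _ => abs_nonneg _) (Finset.mem_univ i)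
    have h4 := le_abs_self (D i j)
    linarith
  have hE0 : 0 ≤ E := Finset.sum_nonneg fun _ _ => Finset.sum_nonneg fun _ _ => abs_nonneg _
  obtain ⟨B, hB⟩ := ((isCompact_closedBall x₀ r).prod ((isCompact_closedBall (0 : Fin n → Fin n → ℝ) E).prod
    (isCompact_closedBall (0:ℝ) Df))).exists_bound_of_continuousOn hΦ.continuousOn
  have hfil : ∀ᶠ k : ℝ in nhdsWithin 0 {0}ᶜ, k ≠ 0 ∧ |k| < h0 ∧ |k| ≤ 1 := by
    have m1 : ∀ᶠ k : ℝ in nhdsWithin 0 {0}ᶜ, k ≠ 0 := self_mem_nhdsWithin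
    have m2 : ∀ᶠ k : ℝ in nhds 0, |k| < min h0 1 := by
      have := Metric.ball_mem_nhds (0:ℝ) (lt_min hh0 one_pos)
      filter_upwards [this] with k hk
      rwa [mem_ball, dist_zero_right, Real.norm_eq_abs] at hk
    filter_upwards [m1, m2.filter_mono nhdsWithin_le_nhds] with k a b
    exact ⟨a, b.trans_le (min_le_left _ _), (b.trans_le (min_le_right _ _)).le⟩
  have hc1 : ∀ k, Continuous fun x => Φ x (fun i j => dq l k (g i j) x) (dq l k f x) := fun k =>
    hΦ.comp (continuous_id.prodMk ((continuous_pi fun i => continuous_pi fun j => dq_cont (hg i j).continuous l k).prodMk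
      (dq_cont hf.continuous l k)))
  have ht : Filter.Tendsto (fun k => ∫ x in closedBall x₀ r, Φ x (fun i j => dq l k (g i j) x) (dq l k f x))
      (nhdsWithin 0 {0}ᶜ) (nhds (∫ x in closedBall x₀ r, Φ x (fun i j => pd l (g i j) x) (pd l f x))) := by
    refine tendsto_integral_filter_of_dominated_convergence (fun _ => B) (Filter.Eventually.of_forall fun k =>
      (hc1 k).aestronglyMeasurable) ?_ ?_ ?_
    · filter_upwards [hfil] with k hk
      rw [ae_restrict_iff' measurableSet_closedBall]
      refine Filter.Eventually.of_forall fun x hx => ?_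
      refine hB (x, (fun i j => dq l k (g i j) x), dq l k f x) ⟨hx, ?_, ?_⟩
      · rw [mem_closedBall, dist_zero_right]
        refine (pi_norm_le_iff_of_nonneg hE0).2 fun i => (pi_norm_le_iff_of_nonneg hE0).2 fun j => ?_
        exact (hD i j k hk.1 hk.2.2 x hx).trans (hEij i j)
      · rw [mem_closedBall, dist_zero_right]
        exact hDf k hk.1 hk.2.2 x hx
    · exact continuous_const.continuousOn.integrableOn_compact (isCompact_closedBall x₀ r)
    · refine Filter.Eventually.of_forall fun x => ?_
      have := (hΦ.tendsto (x, (fun i j => pd l (g i j) x), pd l f x)).comp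
        ((tendsto_const_nhds (x := x)).prodMk_nhds ((tendsto_pi_nhds.2 fun i => tendsto_pi_nhds.2 fun j =>
          dq_tendsto (hg i j) l x).prodMk_nhds (dq_tendsto hf l x)))
      exact this
  exact le_of_tendsto ht (hfil.mono fun k hk => hb k hk.1 hk.2.1)

theorem mol_dq {n : ℕ} (m : ℕ) {g : (Fin n → ℝ) → ℝ} (hg : Continuous g) (l : Fin n) (k : ℝ) (x : Fin n → ℝ) :
    dq l k (mol m g) x = mol m (dq l k g) x := by
  have hc : Continuous fun y => g (y + k • (Pi.single l 1 : Fin n → ℝ)) := hg.comp (continuous_id.add continuous_const)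
  have : dq l k g = fun y => k⁻¹ * (g (y + k • (Pi.single l 1 : Fin n → ℝ)) - g y) := by
    ext y; unfold dq; rw [div_eq_inv_mul]
  rw [this, mol_const_mul, mol_sub m hc hg, mol_shift]
  unfold dq; rw [div_eq_inv_mul]

theorem mol_TT {n : ℕ} (m : ℕ) (A : Fin n → Fin n → ℝ) {B : (Fin n → ℝ) → Fin n → Fin n → ℝ}
    (hB : ∀ i j, Continuous fun x => B x i j) (x : Fin n → ℝ) :
    mol m (fun y => TT A (B y)) x = TT A (fun i j => mol m (fun y => B y i j) x) := by
  unfold TT ftr fdot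
  have c1 : Continuous fun y => (∑ i, A i i) * ∑ i, B y i i := continuous_const.mul (continuous_finsetSum _ fun i _ => hB i i)
  have c3 : ∀ i j, Continuous fun y => A i j * B y i j := fun i j => continuous_const.mul (hB i j)
  have c2 : ∀ i, Continuous fun y => ∑ j, A i j * B y i j := fun i => continuous_finsetSum _ fun j _ => c3 i j
  rw [mol_sub m c1 (continuous_finsetSum _ fun i _ => c2 i), mol_const_mul, mol_sum m _ (fun i => hB i i), mol_sum m _ c2]
  congr 1
  refine Finset.sum_congr rfl fun i _ => ?_
  rw [mol_sum m _ (c3 i)]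
  exact Finset.sum_congr rfl fun j _ => mol_const_mul m _ _ x

theorem fdot_mol_le {n : ℕ} (m : ℕ) {B : (Fin n → ℝ) → Fin n → Fin n → ℝ}
    (hB : ∀ i j, Continuous fun x => B x i j) (x : Fin n → ℝ) :
    fdot (fun i j => mol m (fun y => B y i j) x) (fun i j => mol m (fun y => B y i j) x)
      ≤ mol m (fun y => fdot (B y) (B y)) x := by
  unfold fdot
  have c3 : ∀ i j, Continuous fun y => B y i j * B y i j := fun i j => (hB i j).mul (hB i j)
  rw [mol_sum m _ fun i => continuous_finsetSum _ fun j _ => c3 i j]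
  refine Finset.sum_le_sum fun i _ => ?_
  rw [mol_sum m _ (c3 i)]
  refine Finset.sum_le_sum fun j _ => ?_
  have := mol_sq_le m (hB i j) x
  simpa only [sq] using this

section
variable {n : ℕ} {u : (Fin n → ℝ) → ℝ} {Fc : (Fin n → ℝ) × ℝ × (Fin n → ℝ) → ℝ}
    {Hc : Fin n → Fin n → (Fin n → ℝ) × ℝ × (Fin n → ℝ) → ℝ} {L c0 : ℝ} {x₀ : Fin n → ℝ} {R2 : ℝ}

theorem Core.Bcont (hC : Core u Fc Hc L c0 x₀ R2) (l : Fin n) (k : ℝ) (i j : Fin n) :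
    Continuous fun x => Bq u Hc l k x i j := dq_cont (hC.Acont i j) l k

theorem Core.stage2 (hC : Core u Fc Hc L c0 x₀ R2) {ra : ℝ} (hr0 : 0 ≤ ra) (hra : ra < R2) :
    ∃ C : ℝ, 0 < C ∧ (∀ᶠ m : ℕ in Filter.atTop, ∀ l, ∫ x in closedBall x₀ ra,
        fdot (fun i j => pd l (mol m fun y => Am u Hc y i j) x) (fun i j => pd l (mol m fun y => Am u Hc y i j) x) ≤ C) ∧
      ∀ ε, 0 < ε → ∀ᶠ m : ℕ in Filter.atTop, ∀ l, ∫ x in closedBall x₀ ra,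
        (TT (Am u Hc x) (fun i j => pd l (mol m fun y => Am u Hc y i j) x)
          - pd l (mol m fun y => Fc (gam u y)) x) ^ 2 ≤ C * ε ^ 2 := by
  set rb := (ra + R2) / 2 with hrb
  have hrbR : rb < R2 := by rw [hrb]; linarith
  have hab : 0 < rb - ra := by rw [hrb]; linarith
  obtain ⟨C, h0, hCp, hh0, hst⟩ := hC.stage1 (rb := rb) (by rw [hrb]; linarith) hrbR
  have hsub : ∀ m : ℕ, 1 / ((m:ℝ) + 1) ≤ rb - ra → ∀ x ∈ closedBall x₀ ra, ∀ y, ‖y‖ < 1 / ((m:ℝ) + 1) →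
      x - y ∈ closedBall x₀ rb := by
    intro m hm x hx y hy
    rw [mem_closedBall, dist_eq_norm] at hx ⊢
    rw [sub_right_comm]
    have := norm_sub_le (x - x₀) y
    linarith
  have cbb : ∀ l k, Continuous fun y => fdot (Bq u Hc l k y) (Bq u Hc l k y) := fun l k =>
    cont_fdot (hC.Bcont l k) (hC.Bcont l k)
  have hmB : ∀ m : ℕ, 1 / ((m:ℝ) + 1) ≤ rb - ra → ∀ l k, k ≠ 0 → |k| < h0 →
      ∫ x in closedBall x₀ ra, mol m (fun y => fdot (Bq u Hc l k y) (Bq u Hc l k y)) x ≤ C := fun m hm l k hk hkh =>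
    (mol_integral_le m (cbb l k) (fun x => fdot_self_nonneg _) (isCompact_closedBall x₀ rb) measurableSet_closedBall
      (hsub m hm)).trans (hst k hk hkh l)
  have hFcd : ContDiff ℝ 1 (fun y => Fc (gam u y)) := gam_cd hC.hu hC.hF.cd
  have gsm : ∀ m i j, ContDiff ℝ 1 (mol m fun y => Am u Hc y i j) := fun m i j => sm_one (mol_smooth m (hC.Acont i j))
  have fsm : ∀ m, ContDiff ℝ 1 (mol m fun y => Fc (gam u y)) := fun m => sm_one (mol_smooth m hFcd.continuous)
  have hcp := isCompact_closedBall x₀ ra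
  have cmb : ∀ m l k, IntegrableOn (mol m (fun y => fdot (Bq u Hc l k y) (Bq u Hc l k y))) (closedBall x₀ ra) :=
    fun m l k => (mol_smooth m (cbb l k)).continuous.continuousOn.integrableOn_compact hcp
  set N : ℝ := 2 * ((n:ℝ) ^ 2 + 1) * (n:ℝ) ^ 2 with hN
  have hN0 : 0 ≤ N := by positivity
  refine ⟨C * (N + 1), by positivity, ?_, ?_⟩
  · filter_upwards [inv_ev hab] with m hm l
    refine (dq_limit (Φ := fun _ B _ => fdot B B) ?_ (gsm m) (fsm m) l x₀ ra C h0 hh0 ?_).trans ?_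
    · exact cont_fdot (A := fun p : (Fin n → ℝ) × (Fin n → Fin n → ℝ) × ℝ => p.2.1) (B := fun p => p.2.1)
        (fun i j => by fun_prop) (fun i j => by fun_prop)
    · intro k hk hkh
      have e : ∀ x, (fun i j => dq l k (mol m fun y => Am u Hc y i j) x) = fun i j => mol m (fun y => Bq u Hc l k y i j) x := by
        intro x; ext i j; exact mol_dq m (hC.Acont i j) l k x
      simp only [e]
      refine le_trans (setIntegral_mono_on ?_ (cmb m l k) measurableSet_closedBall
        fun x _ => fdot_mol_le m (hC.Bcont l k) x) (hmB m hm l k hk hkh)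
      have : ∀ i j, Continuous fun x => mol m (fun y => Bq u Hc l k y i j) x := fun i j =>
        (mol_smooth m (hC.Bcont l k i j)).continuous
      exact (cont_fdot this this).continuousOn.integrableOn_compact hcp
    · nlinarith
  · intro ε hε
    obtain ⟨δ, hδ0, hδ⟩ := hC.Auc hε
    filter_upwards [inv_ev hab, inv_ev (half_pos hδ0)] with m hm hm2 l
    refine (dq_limit (Φ := fun x B f => (TT (Am u Hc x) B - f) ^ 2) ?_ (gsm m) (fsm m) l x₀ ra (N * ε ^ 2 * C)
      (min h0 (min (δ / 2) (R2 - rb))) (lt_min hh0 (lt_min (half_pos hδ0) (by linarith))) ?_).trans ?_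
    · have : Continuous fun p : (Fin n → ℝ) × (Fin n → Fin n → ℝ) × ℝ => TT (Am u Hc p.1) p.2.1 :=
        cont_TT (fun i j => (hC.Acont i j).comp continuous_fst) (fun i j => by fun_prop)
      exact (this.sub (continuous_snd.comp continuous_snd)).pow 2
    · intro k hk hkh
      have hk1 : |k| < h0 := hkh.trans_le (min_le_left _ _)
      have hk2 : |k| < δ / 2 := hkh.trans_le ((min_le_right _ _).trans (min_le_left _ _))
      have hk3 : |k| < R2 - rb := hkh.trans_le ((min_le_right _ _).trans (min_le_right _ _))
      have cTB : ∀ A : Fin n → Fin n → ℝ, Continuous fun y => TT A (Bq u Hc l k y) := fun A =>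
        cont_TT (fun i j => continuous_const) (hC.Bcont l k)
      have cF : Continuous (dq l k fun y => Fc (gam u y)) := dq_cont hFcd.continuous l k
      have e : ∀ x, TT (Am u Hc x) (fun i j => dq l k (mol m fun y => Am u Hc y i j) x)
          - dq l k (mol m fun y => Fc (gam u y)) x
          = mol m (fun y => TT (Am u Hc x) (Bq u Hc l k y) - dq l k (fun y => Fc (gam u y)) y) x := by
        intro x
        rw [mol_sub m (cTB _) cF, mol_TT m _ (hC.Bcont l k), mol_dq m hFcd.continuous]
        congr 2
        ext i j; exact mol_dq m (hC.Acont i j) l k x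
      have hpt : ∀ x ∈ closedBall x₀ ra, (TT (Am u Hc x) (fun i j => dq l k (mol m fun y => Am u Hc y i j) x)
          - dq l k (mol m fun y => Fc (gam u y)) x) ^ 2 ≤ N * ε ^ 2 * mol m (fun y => fdot (Bq u Hc l k y) (Bq u Hc l k y)) x := by
        intro x hx
        rw [e, ← mol_const_mul]
        have c1 : Continuous fun y => TT (Am u Hc x) (Bq u Hc l k y) - dq l k (fun y => Fc (gam u y)) y := (cTB _).sub cF
        refine (mol_sq_le m c1 x).trans (mol_mono m (c1.pow 2) (continuous_const.mul (cbb l k)) x fun z hz => ?_)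
        set y := x - z with hy
        have hyb : y ∈ closedBall x₀ rb := hsub m hm x hx z hz
        have hxy : x - y = z := by rw [hy]; abel
        have e1 := hC.eq y (closedBall_subset_ball hrbR hyb)
        have e2 := hC.eq _ (shift_mem hk3 hyb l)
        have d1 := hδ x y (by rw [hxy]; linarith)
        have d2 := hδ x (y + k • (Pi.single l 1 : Fin n → ℝ)) (by
          rw [← sub_sub, hxy]
          have := norm_sub_le z (k • (Pi.single l 1 : Fin n → ℝ))
          have := norm_h_single l k
          linarith)
        rw [Am_shift l hk y] at e2 d2
        rw [TT_shift] at e2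
        set B := Bq u Hc l k y with hB
        have e3 : dq l k (fun y => Fc (gam u y)) y = TT (Am u Hc y) B + k / 2 * TT B B := by
          unfold dq
          rw [div_eq_iff hk]; linarith
        have e4 : TT (Am u Hc x) B - dq l k (fun y => Fc (gam u y)) y
            = TT (fun i j => Am u Hc x i j - (Am u Hc y i j + k / 2 * B i j)) B := by
          rw [e3, TT_comm (fun i j => Am u Hc x i j - (Am u Hc y i j + k / 2 * B i j)), TT_sub, TT_add, TT_smul,
            TT_comm B (Am u Hc x), TT_comm B (Am u Hc y)]
        show (TT (Am u Hc x) B - dq l k (fun y => Fc (gam u y)) y) ^ 2 ≤ N * ε ^ 2 * fdot B B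
        rw [e4]
        refine (TT_sq_le _ _).trans ?_
        have h1 := fdot_le_of (A := fun i j => Am u Hc x i j - (Am u Hc y i j + k / 2 * B i j)) (c := ε) fun i j => by
          have a1 := abs_le.1 (d1 i j)
          have a2 := abs_le.1 (d2 i j)
          rw [abs_le]; constructor <;> linarith [a1.1, a1.2, a2.1, a2.2]
        have h2 := mul_le_mul_of_nonneg_left (mul_le_mul_of_nonneg_right h1 (fdot_self_nonneg B))
          (show 0 ≤ 2 * ((n:ℝ) ^ 2 + 1) by positivity)
        refine h2.trans (le_of_eq ?_); rw [hN]; ring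
      have cg : Continuous fun x => (TT (Am u Hc x) (fun i j => dq l k (mol m fun y => Am u Hc y i j) x)
          - dq l k (mol m fun y => Fc (gam u y)) x) ^ 2 :=
        ((cont_TT hC.Acont fun i j => dq_cont (gsm m i j).continuous l k).sub (dq_cont (fsm m).continuous l k)).pow 2
      refine (setIntegral_mono_on (cg.continuousOn.integrableOn_compact hcp) ((cmb m l k).const_mul _)
        measurableSet_closedBall hpt).trans ?_
      rw [integral_const_mul]
      exact mul_le_mul_of_nonneg_left (hmB m hm l k hk hk1) (by positivity)
    · have : 0 ≤ C * ε ^ 2 := by positivity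
      linarith
end

open MeasureTheory Metric Set Matrix
open scoped ContDiff

/-- The residual. -/
noncomputable def rq {n : ℕ} (u : (Fin n → ℝ) → ℝ) (Fc : (Fin n → ℝ) × ℝ × (Fin n → ℝ) → ℝ)
    (Hc : Fin n → Fin n → (Fin n → ℝ) × ℝ × (Fin n → ℝ) → ℝ) (x : Fin n → ℝ) : ℝ :=
  TT (Am u Hc x) (Am u Hc x) / 2 - Fc (gam u x)

theorem Am_smooth {n : ℕ} {u : (Fin n → ℝ) → ℝ} {Hc : Fin n → Fin n → (Fin n → ℝ) × ℝ × (Fin n → ℝ) → ℝ}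
    (hu : ContDiff ℝ ∞ u) (hH : ∀ i j, ContDiff ℝ ∞ (Hc i j)) (i j : Fin n) :
    ContDiff ℝ ∞ (fun x => Am u Hc x i j) :=
  (contDiff_pd_top (contDiff_pd_top hu)).sub ((hH i j).comp (gam_smooth hu))

theorem rq_smooth {n : ℕ} {u : (Fin n → ℝ) → ℝ} {Hc : Fin n → Fin n → (Fin n → ℝ) × ℝ × (Fin n → ℝ) → ℝ}
    {Fc : (Fin n → ℝ) × ℝ × (Fin n → ℝ) → ℝ}
    (hu : ContDiff ℝ ∞ u) (hH : ∀ i j, ContDiff ℝ ∞ (Hc i j)) (hF : ContDiff ℝ ∞ Fc) :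
    ContDiff ℝ ∞ (rq u Fc Hc) := by
  have sA := Am_smooth hu hH
  have st := sm_sum (s := Finset.univ) fun i => sA i i
  have := ((((st.mul st).sub (sm_fdot (A := fun i j x => Am u Hc x i j) (B := fun i j x => Am u Hc x i j) sA sA)).div_const 2).sub (hF.comp (gam_smooth hu)))
  exact this

theorem pd_rq {n : ℕ} {u : (Fin n → ℝ) → ℝ} {Hc : Fin n → Fin n → (Fin n → ℝ) × ℝ × (Fin n → ℝ) → ℝ}
    {Fc : (Fin n → ℝ) × ℝ × (Fin n → ℝ) → ℝ}
    (hu : ContDiff ℝ ∞ u) (hH : ∀ i j, ContDiff ℝ ∞ (Hc i j)) (hF : ContDiff ℝ ∞ Fc) (l : Fin n) (x : Fin n → ℝ) :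
    pd l (rq u Fc Hc) x = TT (Am u Hc x) (fun i j => pd l (fun y => Am u Hc y i j) x)
      - pd l (fun y => Fc (gam u y)) x := by
  have sA := Am_smooth hu hH
  have st := sm_sum (s := Finset.univ) fun i => sA i i
  have sf := sm_fdot (A := fun i j x => Am u Hc x i j) (B := fun i j x => Am u Hc x i j) sA sA
  have e : rq u Fc Hc = fun x => (1 / 2 : ℝ) * ((∑ i, Am u Hc x i i) * (∑ i, Am u Hc x i i)
      - fdot (fun i j => Am u Hc x i j) (fun i j => Am u Hc x i j)) - Fc (gam u x) := by
    ext x; simp only [rq, TT, ftr]; ring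
  have s1 : ContDiff ℝ ∞ fun x => (∑ i, Am u Hc x i i) * (∑ i, Am u Hc x i i) := st.mul st
  have s2 : ContDiff ℝ ∞ fun x => (∑ i, Am u Hc x i i) * (∑ i, Am u Hc x i i)
      - fdot (fun i j => Am u Hc x i j) (fun i j => Am u Hc x i j) := s1.sub sf
  have s3 : ContDiff ℝ ∞ fun x => (1 / 2 : ℝ) * ((∑ i, Am u Hc x i i) * (∑ i, Am u Hc x i i)
      - fdot (fun i j => Am u Hc x i j) (fun i j => Am u Hc x i j)) := contDiff_const.mul s2
  have s4 : ContDiff ℝ ∞ fun x => Fc (gam u x) := hF.comp (gam_smooth hu)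
  rw [e, pd_sub (sm_diff s3 x) (sm_diff s4 x), pd_const_mul _ (sm_diff s2 x), pd_sub (sm_diff s1 x) (sm_diff sf x),
    pd_mul_sm st st, pd_sum_sm (fun i => sA i i), pd_fdot (A := fun i j x => Am u Hc x i j) (B := fun i j x => Am u Hc x i j) sA sA]
  rw [fdot_comm (fun i j => pd l (fun x => Am u Hc x i j) x)]
  unfold TT ftr
  ring

section
variable {n : ℕ} {u : (Fin n → ℝ) → ℝ} {Fc : (Fin n → ℝ) × ℝ × (Fin n → ℝ) → ℝ}
    {Hc : Fin n → Fin n → (Fin n → ℝ) × ℝ × (Fin n → ℝ) → ℝ} {L c0 : ℝ} {x₀ : Fin n → ℝ} {R2 : ℝ}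

/-- Uniform convergence of the mollified data. -/
theorem Core.conv (hC : Core u Fc Hc L c0 x₀ R2) {ε : ℝ} (hε : 0 < ε) : ∀ᶠ m : ℕ in Filter.atTop,
    (∀ x i j, |Am (mol m u) (fun i j => mol m (Hc i j)) x i j - Am u Hc x i j| ≤ ε) ∧
    (∀ x, |mol m Fc (gam (mol m u) x) - Fc (gam u x)| ≤ ε) ∧
    (∀ l x i j, |pd l (fun y => Am (mol m u) (fun i j => mol m (Hc i j)) y i j) x
      - pd l (mol m fun y => Am u Hc y i j) x| ≤ ε) ∧
    (∀ l x, |pd l (mol m fun y => Fc (gam u y)) x - pd l (fun y => mol m Fc (gam (mol m u) y)) x| ≤ ε) := by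
  have hε2 : 0 < ε / 2 := by linarith
  have h1 := conv_u hC.hu hC.hc hε2
  have h2 : ∀ᶠ m : ℕ in Filter.atTop, ∀ i j, (∀ x, |mol m (Hc i j) (gam (mol m u) x) - Hc i j (gam u x)| ≤ ε / 2) ∧
      ∀ l x, |pd l (fun y => mol m (Hc i j) (gam (mol m u) y)) x - pd l (fun y => Hc i j (gam u y)) x| ≤ ε / 2 := by
    rw [Filter.eventually_all]; intro i; rw [Filter.eventually_all]; intro j
    exact conv_G hC.hu hC.hc (hC.hH i j) hε2
  have h3 := conv_G hC.hu hC.hc hC.hF hε2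
  have h4 : ∀ᶠ m : ℕ in Filter.atTop, ∀ i j, ∀ l x, |pd l (mol m fun y => Hc i j (gam u y)) x - pd l (fun y => Hc i j (gam u y)) x| ≤ ε / 2 := by
    rw [Filter.eventually_all]; intro i; rw [Filter.eventually_all]; intro j
    exact (conv_mol (gam_cd hC.hu (hC.hH i j).cd) (gam_cpt (hC.hH i j).cpt) hε2).mono fun m h => h.2
  have h5 := conv_mol (gam_cd hC.hu hC.hF.cd) (gam_cpt (u := u) hC.hF.cpt) hε2
  filter_upwards [h1, h2, h3, h4, h5] with m k1 k2 k3 k4 k5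
  have su : ContDiff ℝ ∞ (mol m u) := mol_smooth m hC.hu.continuous
  have sH : ∀ i j, ContDiff ℝ ∞ (mol m (Hc i j)) := fun i j => mol_smooth m (hC.hH i j).cd.continuous
  refine ⟨fun x i j => ?_, fun x => (k3.1 x).trans (by linarith), fun l x i j => ?_, fun l x => ?_⟩
  · have a := abs_le.1 (k1.2.2 i j x)
    have b := abs_le.1 ((k2 i j).1 x)
    unfold Am
    rw [abs_le]; constructor <;> linarith [a.1, a.2, b.1, b.2]
  · have e1 : pd l (fun y => Am (mol m u) (fun i j => mol m (Hc i j)) y i j) x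
        = pd l (pd i (pd j (mol m u))) x - pd l (fun y => mol m (Hc i j) (gam (mol m u) y)) x :=
      pd_sub (sm_diff (contDiff_pd_top (contDiff_pd_top su)) x) (sm_diff ((sH i j).comp (gam_smooth su)) x)
    have e2 : (mol m fun y => Am u Hc y i j) = fun x => pd i (pd j (mol m u)) x - mol m (fun y => Hc i j (gam u y)) x := by
      ext x
      rw [pd_pd_mol hC.hu hC.hc]
      exact mol_sub m (cont_pd2 hC.hu i j) (gam_cd hC.hu (hC.hH i j).cd).continuous x
    have e3 := pd_sub (i := l) (sm_diff (contDiff_pd_top (i := i) (contDiff_pd_top (i := j) su)) x)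
      (sm_diff (mol_smooth m (gam_cd hC.hu (hC.hH i j).cd).continuous) x)
    rw [e1, e2, e3]
    have a := abs_le.1 (k4 i j l x)
    have b := abs_le.1 ((k2 i j).2 l x)
    rw [abs_le]; constructor <;> linarith [a.1, a.2, b.1, b.2]
  · have a := abs_le.1 (k5.2 l x)
    have b := abs_le.1 (k3.2 l x)
    rw [abs_le]; constructor <;> linarith [a.1, a.2, b.1, b.2]

theorem sq4 (a b c d : ℝ) : (a + b + c + d) ^ 2 ≤ 4 * (a ^ 2 + b ^ 2 + c ^ 2 + d ^ 2) := by
  nlinarith [sq_nonneg (a - b), sq_nonneg (a - c), sq_nonneg (a - d), sq_nonneg (b - c), sq_nonneg (b - d), sq_nonneg (c - d)]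

theorem Core.stage3 (hC : Core u Fc Hc L c0 x₀ R2) {ra : ℝ} (hr0 : 0 ≤ ra) (hra : ra < R2) {δ : ℝ} (hδ : 0 < δ) :
    ∀ᶠ m : ℕ in Filter.atTop, ∀ l, ∫ x in closedBall x₀ ra,
      (pd l (rq (mol m u) (mol m Fc) fun i j => mol m (Hc i j)) x) ^ 2 ≤ δ := by
  obtain ⟨C, hCp, hs1, hs2⟩ := hC.stage2 hr0 hra
  obtain ⟨a, ha, hab⟩ := hC.Abd
  set N : ℝ := 2 * ((n:ℝ) ^ 2 + 1) with hN
  have hNp : 0 < N := by positivity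
  set V : ℝ := (volume (closedBall x₀ ra)).toReal with hV
  have hV0 : 0 ≤ V := ENNReal.toReal_nonneg
  set Q : ℝ := 4 * (C + N * (n:ℝ) ^ 2 * C + (N * ((n:ℝ) ^ 2 * (a + 1) ^ 2) * (n:ℝ) ^ 2 + 1) * V) with hQ
  have hQ0 : 0 < Q := by rw [hQ]; positivity
  obtain ⟨ε, hε, hε1, hεQ⟩ : ∃ ε : ℝ, 0 < ε ∧ ε ≤ 1 ∧ Q * ε ^ 2 ≤ δ := by
    refine ⟨min 1 (δ / Q), lt_min one_pos (by positivity), min_le_left _ _, ?_⟩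
    have h1 : min 1 (δ / Q) ≤ 1 := min_le_left _ _
    have h2 : min 1 (δ / Q) ≤ δ / Q := min_le_right _ _
    have h0 : 0 < min 1 (δ / Q) := lt_min one_pos (by positivity)
    have h3 : min 1 (δ / Q) ^ 2 ≤ δ / Q := by nlinarith
    calc _ ≤ Q * (δ / Q) := mul_le_mul_of_nonneg_left h3 hQ0.le
      _ = δ := by field_simp
  filter_upwards [hs1, hs2 ε hε, hC.conv hε] with m k1 k2 ⟨c1, c2, c3, c4⟩ l
  have su : ContDiff ℝ ∞ (mol m u) := mol_smooth m hC.hu.continuous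
  have sH : ∀ i j, ContDiff ℝ ∞ (mol m (Hc i j)) := fun i j => mol_smooth m (hC.hH i j).cd.continuous
  have sF : ContDiff ℝ ∞ (mol m Fc) := mol_smooth m hC.hF.cd.continuous
  have gsm : ∀ i j, ContDiff ℝ ∞ (mol m fun y => Am u Hc y i j) := fun i j => mol_smooth m (hC.Acont i j)
  have fsm : ContDiff ℝ ∞ (mol m fun y => Fc (gam u y)) := mol_smooth m (gam_cd hC.hu hC.hF.cd).continuous
  set Aj := Am (mol m u) (fun i j => mol m (Hc i j)) with hAj
  have cP : ∀ i j, Continuous fun x => pd l (mol m fun y => Am u Hc y i j) x := fun i j =>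
    (contDiff_pd_top (gsm i j)).continuous
  have cX : Continuous fun x => (TT (Am u Hc x) (fun i j => pd l (mol m fun y => Am u Hc y i j) x)
          - pd l (mol m fun y => Fc (gam u y)) x) ^ 2 :=
    ((cont_TT hC.Acont cP).sub (contDiff_pd_top fsm).continuous).pow 2
  have cfd : Continuous fun x => fdot (fun i j => pd l (mol m fun y => Am u Hc y i j) x)
      (fun i j => pd l (mol m fun y => Am u Hc y i j) x) := cont_fdot cP cP
  have hcp : IsCompact (closedBall x₀ ra) := isCompact_closedBall _ _
  have cr : Continuous fun x => (pd l (rq (mol m u) (mol m Fc) fun i j => mol m (Hc i j)) x) ^ 2 :=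
    (contDiff_pd_top (rq_smooth su sH sF)).continuous.pow 2
  have I1 := cX.continuousOn.integrableOn_compact (μ := volume) hcp
  have I2 := cfd.continuousOn.integrableOn_compact (μ := volume) hcp
  have I3 : IntegrableOn (fun _ : Fin n → ℝ => 4 * (N * ((n:ℝ) ^ 2 * (a + 1) ^ 2) * (n:ℝ) ^ 2 + 1) * ε ^ 2) (closedBall x₀ ra) :=
    continuous_const.continuousOn.integrableOn_compact hcp
  have hpt : ∀ x ∈ closedBall x₀ ra, (pd l (rq (mol m u) (mol m Fc) fun i j => mol m (Hc i j)) x) ^ 2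
      ≤ 4 * (TT (Am u Hc x) (fun i j => pd l (mol m fun y => Am u Hc y i j) x)
          - pd l (mol m fun y => Fc (gam u y)) x) ^ 2
        + 4 * (N * (n:ℝ) ^ 2 * ε ^ 2) * fdot (fun i j => pd l (mol m fun y => Am u Hc y i j) x)
            (fun i j => pd l (mol m fun y => Am u Hc y i j) x)
        + 4 * (N * ((n:ℝ) ^ 2 * (a + 1) ^ 2) * (n:ℝ) ^ 2 + 1) * ε ^ 2 := by
    intro x _
    rw [pd_rq su sH sF]
    set P : Fin n → Fin n → ℝ := fun i j => pd l (mol m fun y => Am u Hc y i j) x with hP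
    set D : Fin n → Fin n → ℝ := fun i j => pd l (fun y => Aj y i j) x with hD
    set b := pd l (mol m fun y => Fc (gam u y)) x
    set d := pd l (fun y => mol m Fc (gam (mol m u) y)) x
    have e : TT (Aj x) D - d = (TT (Am u Hc x) P - b) + TT P (fun i j => Aj x i j - Am u Hc x i j)
        + TT (Aj x) (fun i j => D i j - P i j) + (b - d) := by
      rw [TT_sub, TT_sub, TT_comm P (fun i j => Aj x i j), TT_comm P (fun i j => Am u Hc x i j)]; ring
    rw [e]
    refine (sq4 _ _ _ _).trans ?_
    have q2 := TT_sq_le P (fun i j => Aj x i j - Am u Hc x i j)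
    have q3 := TT_sq_le (Aj x) (fun i j => D i j - P i j)
    have f2 := fdot_le_of (A := fun i j => Aj x i j - Am u Hc x i j) (c := ε) (c1 x)
    have f3 := fdot_le_of (A := fun i j => D i j - P i j) (c := ε) (c3 l x)
    have f4 := fdot_le_of (A := Aj x) (c := a + 1) fun i j => by
      have h1 := abs_le.1 (c1 x i j)
      have h2 := abs_le.1 (hab x i j)
      rw [abs_le]; constructor <;> linarith [h1.1, h1.2, h2.1, h2.2]
    have q2' := mul_le_mul_of_nonneg_left (mul_le_mul_of_nonneg_left f2 (fdot_self_nonneg P)) hNp.le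
    have q3' := mul_le_mul_of_nonneg_left (mul_le_mul f4 f3 (fdot_self_nonneg _) (by positivity)) hNp.le
    have q4 : (b - d) ^ 2 ≤ ε ^ 2 := by
      rw [← sq_abs]; exact pow_le_pow_left₀ (abs_nonneg _) (c4 l x) 2
    have q2'' := q2.trans q2'
    have q3'' := q3.trans q3'
    have r1 : N * (fdot P P * ((n:ℝ) ^ 2 * ε ^ 2)) = N * (n:ℝ) ^ 2 * ε ^ 2 * fdot P P := by ring
    have r2 : N * ((n:ℝ) ^ 2 * (a + 1) ^ 2 * ((n:ℝ) ^ 2 * ε ^ 2)) = N * ((n:ℝ) ^ 2 * (a + 1) ^ 2) * (n:ℝ) ^ 2 * ε ^ 2 := by ring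
    rw [r1] at q2''
    rw [r2] at q3''
    linarith
  refine (setIntegral_mono_on (cr.continuousOn.integrableOn_compact hcp) (((I1.const_mul 4).add
    (I2.const_mul (4 * (N * (n:ℝ) ^ 2 * ε ^ 2)))).add I3) measurableSet_closedBall hpt).trans ?_
  have i1 := integral_add ((I1.const_mul 4).add (I2.const_mul (4 * (N * (n:ℝ) ^ 2 * ε ^ 2)))) I3
  have i2 := integral_add (I1.const_mul 4) (I2.const_mul (4 * (N * (n:ℝ) ^ 2 * ε ^ 2)))
  simp only [Pi.add_apply] at i1 i2 ⊢
  rw [i1, i2, integral_const_mul, integral_const_mul, setIntegral_const]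
  have j1 := mul_le_mul_of_nonneg_left (k2 l) (show (0:ℝ) ≤ 4 by norm_num)
  have j2 := mul_le_mul_of_nonneg_left (k1 l) (show (0:ℝ) ≤ 4 * (N * (n:ℝ) ^ 2 * ε ^ 2) by positivity)
  have hVV : volume.real (closedBall x₀ ra) = V := rfl
  rw [hVV, smul_eq_mul]
  refine (add_le_add_left (add_le_add j1 j2) _).trans (le_trans (le_of_eq ?_) hεQ)
  rw [hQ]; ring
end

open MeasureTheory Metric Set Matrix
open scoped ContDiff

theorem lim_int {n : ℕ} {S : Set (Fin n → ℝ)} (hS : IsCompact S) {w v : (Fin n → ℝ) → ℝ} {vj : ℕ → (Fin n → ℝ) → ℝ}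
    {Ψ : ℝ → ℝ} (hw : Continuous w) (hv : Continuous v) (hvj : ∀ j, Continuous (vj j)) (hΨ : Continuous Ψ)
    (hlim : ∀ δ, 0 < δ → ∀ᶠ j : ℕ in Filter.atTop, ∀ x, |vj j x - v x| ≤ δ) :
    Filter.Tendsto (fun j => ∫ x in S, w x * Ψ (vj j x)) Filter.atTop (nhds (∫ x in S, w x * Ψ (v x))) := by
  obtain ⟨B, hB⟩ := hS.exists_bound_of_continuousOn hv.continuousOn
  obtain ⟨W, hW⟩ := hS.exists_bound_of_continuousOn hw.continuousOn
  obtain ⟨P, hP⟩ := (isCompact_Icc (a := -(B + 1)) (b := B + 1)).exists_bound_of_continuousOn hΨ.continuousOn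
  refine tendsto_integral_filter_of_dominated_convergence (fun _ => |W| * |P|) ?_ ?_ ?_ ?_
  · exact Filter.Eventually.of_forall fun j => (hw.mul (hΨ.comp (hvj j))).aestronglyMeasurable
  · filter_upwards [hlim 1 one_pos] with j hj
    refine (ae_restrict_iff' hS.measurableSet).2 (Filter.Eventually.of_forall fun x hx => ?_)
    rw [norm_mul]
    have h1 := abs_le.1 (hj x)
    have h2 := abs_le.1 (hB x hx)
    refine mul_le_mul ((hW x hx).trans (le_abs_self _)) ((hP _ ⟨?_, ?_⟩).trans (le_abs_self _)) (norm_nonneg _)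
      (abs_nonneg _) <;> linarith [h1.1, h1.2, h2.1, h2.2]
  · exact (continuous_const.continuousOn).integrableOn_compact hS
  · refine Filter.Eventually.of_forall fun x => ?_
    have : Filter.Tendsto (fun j => vj j x) Filter.atTop (nhds (v x)) := by
      rw [Metric.tendsto_nhds]
      intro ε hε
      filter_upwards [hlim (ε / 2) (by linarith)] with j hj
      rw [Real.dist_eq]; linarith [hj x]
    exact ((hΨ.tendsto _).comp this).const_mul _

theorem TT_diff_le {n : ℕ} {A B : Fin n → Fin n → ℝ} {a ε : ℝ} (ha : ∀ i j, |B i j| ≤ a)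
    (h : ∀ i j, |A i j - B i j| ≤ ε) (hε1 : ε ≤ 1) {c : ℝ} (hc : 0 ≤ c)
    (hN : 2 * ((n:ℝ) ^ 2 + 1) * ((n:ℝ) ^ 2 * ε ^ 2 * ((n:ℝ) ^ 2 * (2 * a + 1) ^ 2)) ≤ c ^ 2) :
    TT B B - c ≤ TT A A := by
  have e : TT A A - TT B B = TT (fun i j => A i j - B i j) (fun i j => A i j + B i j) := by
    rw [TT_add, TT_comm (fun i j => A i j - B i j) A, TT_comm (fun i j => A i j - B i j) B, TT_sub, TT_sub]
    have := TT_comm A B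
    linarith
  have q := TT_sq_le (fun i j => A i j - B i j) (fun i j => A i j + B i j)
  have f1 := fdot_le_of h
  have f2 := fdot_le_of (A := fun i j => A i j + B i j) (c := 2 * a + 1) fun i j => by
    have h1 := abs_le.1 (h i j)
    have h2 := abs_le.1 (ha i j)
    rw [abs_le]; constructor <;> linarith [h1.1, h1.2, h2.1, h2.2]
  have q2 := q.trans (mul_le_mul_of_nonneg_left (mul_le_mul f1 f2 (fdot_self_nonneg _) (by positivity)) (by positivity))
  have q3 := abs_le_of_sq_le_sq (q2.trans hN) hc
  rw [← e] at q3
  linarith [(abs_le.1 q3).1]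

section
variable {n : ℕ} {u : (Fin n → ℝ) → ℝ} {Fc : (Fin n → ℝ) × ℝ × (Fin n → ℝ) → ℝ}
    {Hc : Fin n → Fin n → (Fin n → ℝ) × ℝ × (Fin n → ℝ) → ℝ} {L c0 : ℝ} {x₀ : Fin n → ℝ} {R2 : ℝ}

/-- Nondegeneracy of the mollified data. -/
theorem Core.nondeg (hC : Core u Fc Hc L c0 x₀ R2) : ∀ᶠ m : ℕ in Filter.atTop, ∀ x ∈ ball x₀ R2,
    0 < ftr (Am (mol m u) (fun i j => mol m (Hc i j)) x) ∧
    c0 / 2 ≤ TT (Am (mol m u) (fun i j => mol m (Hc i j)) x) (Am (mol m u) (fun i j => mol m (Hc i j)) x) / 2 := by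
  obtain ⟨a, ha, hab⟩ := hC.Abd
  have hc0 := hC.c0pos
  set Q : ℝ := 2 * ((n:ℝ) ^ 2 + 1) * ((n:ℝ) ^ 2 * ((n:ℝ) ^ 2 * (2 * a + 1) ^ 2)) + 1 with hQ
  have hQ0 : 0 < Q := by positivity
  set t : ℝ := Real.sqrt (2 * c0) with ht
  have ht0 : 0 < t := Real.sqrt_pos.2 (by linarith)
  set ε := min 1 (min (c0 ^ 2 / Q) (t / (2 * (n + 1)))) with hε
  have hε0 : 0 < ε := lt_min one_pos (lt_min (by positivity) (by positivity))
  have hε1 : ε ≤ 1 := min_le_left _ _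
  have hε2 : ε ≤ c0 ^ 2 / Q := (min_le_right _ _).trans (min_le_left _ _)
  have hε3 : ε ≤ t / (2 * (n + 1)) := (min_le_right _ _).trans (min_le_right _ _)
  filter_upwards [hC.conv hε0] with m ⟨c1, _, _, _⟩ x hx
  have e := hC.eq x hx
  have lo := hC.low x hx
  have tr := hC.tr x hx
  constructor
  · have h1 : 2 * c0 ≤ ftr (Am u Hc x) ^ 2 := by
      have := fdot_self_nonneg (Am u Hc x)
      unfold TT at e
      nlinarith
    have h2 : t ≤ ftr (Am u Hc x) := by
      rw [ht]; exact Real.sqrt_le_iff.2 ⟨tr.le, h1⟩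
    have h3 : |∑ i, (Am (mol m u) (fun i j => mol m (Hc i j)) x i i - Am u Hc x i i)| ≤ n * ε :=
      abs_sum_le_of fun i => c1 x i i
    rw [Finset.sum_sub_distrib] at h3
    have h4 := (abs_le.1 h3).1
    rw [le_div_iff₀ (by positivity)] at hε3
    unfold ftr at h2 ⊢
    nlinarith
  · have := TT_diff_le (A := Am (mol m u) (fun i j => mol m (Hc i j)) x) (hab x) (c1 x) hε1 hc0.le (by
      have h1 : ε ^ 2 ≤ c0 ^ 2 / Q := by nlinarith
      rw [le_div_iff₀ hQ0] at h1
      have : 0 ≤ ε ^ 2 := sq_nonneg _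
      calc _ = ε ^ 2 * (Q - 1) := by rw [hQ]; ring
        _ ≤ c0 ^ 2 := by nlinarith)
    linarith

end

theorem lapl_cont {n : ℕ} {u : (Fin n → ℝ) → ℝ} (hu : ContDiff ℝ 2 u) : Continuous (lapl u) := by
  have : Continuous fun x => ∑ l, pd l (pd l u) x := continuous_finsetSum _ fun l _ => cont_pd2 hu l l
  exact this

theorem conv_lapl {n : ℕ} {u : (Fin n → ℝ) → ℝ} (hu : ContDiff ℝ 2 u) (hc : HasCompactSupport u) {δ : ℝ} (hδ : 0 < δ) :
    ∀ᶠ j : ℕ in Filter.atTop, ∀ x, |lapl (mol j u) x - lapl u x| ≤ δ := by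
  have h0 : 0 < δ / ((n:ℝ) + 1) := by positivity
  filter_upwards [conv_u hu hc h0] with j ⟨_, _, h⟩ x
  unfold lapl
  rw [← Finset.sum_sub_distrib]
  refine (abs_sum_le_of fun l => h l l x).trans ?_
  rw [← mul_div_assoc, div_le_iff₀ (by positivity)]
  nlinarith

/-- Weighted gradient estimate for the mollified solution. -/
theorem rh_grad (n : ℕ) (hn : 3 ≤ n) (L c0 M : ℝ) (hL : 0 < L) (hc0 : 0 < c0) (hM : 0 < M) :
    ∃ C : ℝ, 0 < C ∧ ∀ (u : (Fin n → ℝ) → ℝ) (Fc : (Fin n → ℝ) × ℝ × (Fin n → ℝ) → ℝ)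
      (Hc : Fin n → Fin n → (Fin n → ℝ) × ℝ × (Fin n → ℝ) → ℝ) (x₀ : Fin n → ℝ) (R2 ra C₁ s : ℝ) (φ : (Fin n → ℝ) → ℝ),
      Core u Fc Hc L c0 x₀ R2 → 0 ≤ C₁ → C₁ ≤ M → 1 ≤ s → ra < R2 →
      (∀ x ∈ ball x₀ R2, 1 ≤ lapl u x + C₁ ∧ (∀ i j, |pd i (pd j u) x| ≤ lapl u x + C₁) ∧ ∀ l, |pd l u x| ≤ M) →
      ContDiff ℝ ∞ φ → HasCompactSupport φ → tsupport φ ⊆ closedBall x₀ ra →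
      ∀ᶠ m : ℕ in Filter.atTop, (∀ x ∈ closedBall x₀ ra, 1 / 2 ≤ lapl (mol m u) x + C₁) ∧
        s * ∫ x, φ x ^ 2 * ((lapl (mol m u) x + C₁) ^ s *
            ∑ i, (pd i (fun y => lapl (mol m u) y + C₁) x / (lapl (mol m u) x + C₁)) ^ 2)
          ≤ C * (∫ x, (φ x ^ 2 + ∑ i, pd i φ x ^ 2) * ((lapl (mol m u) x + C₁) ^ s * (lapl (mol m u) x + C₁) ^ 3))
          + C * s * ∫ x, φ x ^ 2 * ((lapl (mol m u) x + C₁) ^ s *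
            ∑ i, pd i (rq (mol m u) (mol m Fc) fun i j => mol m (Hc i j)) x ^ 2) := by
  have hn1 : (1:ℝ) ≤ n := by exact_mod_cast (by omega : 1 ≤ n)
  set M' := M + 1 with hM'
  have hM0 : 0 < M' := by rw [hM']; linarith
  set K2 : ℝ := (n * (L * (2 * M' + 2) * (2 + 2 * M' + 2 * n)) + 2 * L * (1 + 2 * M')) with hK2
  have hK20 : 0 < K2 := by positivity
  set K : ℝ := 1 + (M + n * L) + L * (2 * M' + 2) + L + L * (1 + M') + K2 with hK
  have p1 : 0 < L * (2 * M' + 2) := by positivity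
  have p2 : 0 < L * (1 + M') := by positivity
  have p3 : 0 < n * L := by positivity
  obtain ⟨C, hCp, hS⟩ := lemS n K (c0 / 2) hn1 (by rw [hK]; linarith) (by linarith)
  have hK0 : 0 < K := by rw [hK]; linarith
  set κ := c0 / 2 / (12 * K) with hκ
  have hκ0 : 0 < κ := by positivity
  refine ⟨C / κ, by positivity, ?_⟩
  intro u Fc Hc x₀ R2 ra C₁ s φ hC hC0 hC1 hs hra hb hφ hφc hφs
  have hv := conv_lapl hC.hu hC.hc (show (0:ℝ) < 1 / 4 by norm_num)
  have hu' := conv_u hC.hu hC.hc (show (0:ℝ) < 1 / 4 by norm_num)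
  filter_upwards [hC.nondeg, hv, hu'] with m k1 k2 ⟨_, k3, k4⟩
  have su : ContDiff ℝ ∞ (mol m u) := mol_smooth m hC.hu.continuous
  have sH : ∀ i j, ContDiff ℝ ∞ (mol m (Hc i j)) := fun i j => mol_smooth m (hC.hH i j).cd.continuous
  have sF : ContDiff ℝ ∞ (mol m Fc) := mol_smooth m hC.hF.cd.continuous
  have hsub : closedBall x₀ ra ⊆ ball x₀ R2 := closedBall_subset_ball hra
  have hv2 : ∀ x ∈ closedBall x₀ ra, 3 / 4 ≤ lapl (mol m u) x + C₁ ∧ lapl u x ≤ lapl (mol m u) x + 1 / 4 := fun x hx => by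
    have := (hb x (hsub hx)).1
    have := abs_le.1 (k2 x)
    constructor <;> linarith [this.1, this.2]
  refine ⟨fun x hx => by linarith [(hv2 x hx).1], ?_⟩
  have pdv : ∀ i x, pd i (fun y => lapl (mol m u) y + C₁) x = pd i (lapl (mol m u)) x := fun i x => by
    simp [pd]
  have key := hS s C₁ φ (mol m u) (fun y => mol m Fc (gam (mol m u) y)) (fun y => lapl (mol m u) y + C₁)
    (rq (mol m u) (mol m Fc) fun i j => mol m (Hc i j))
    (fun i j y => mol m (Hc i j) (gam (mol m u) y))
    (fun i j y => Am (mol m u) (fun i j => mol m (Hc i j)) y i j)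
    (fun i j k y => fderiv ℝ (mol m (Hc i j)) (gam (mol m u) y) (0, 0, Pi.single k 1))
    (fun k y => fderiv ℝ (mol m Fc) (gam (mol m u) y) (0, 0, Pi.single k 1))
    hs hφ hφc su (fun i j => (sH i j).comp (gam_smooth su)) (fun i j => by rw [hC.hsym i j])
    (sF.comp (gam_smooth su)) (fun i j k => (smooth_dir (sH i j) _).comp (gam_smooth su))
    (fun i j x => rfl) (fun x => rfl)
    (fun x => by unfold rq TT ftr; ring) ?_
  · rw [hκ] at *
    have e : ∀ X Y Z : ℝ, c0 / 2 / (12 * K) * s * X ≤ C * Y + C * s * Z →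
        s * X ≤ C / (c0 / 2 / (12 * K)) * Y + C / (c0 / 2 / (12 * K)) * s * Z := by
      intro X Y Z h
      have : s * X ≤ (C * Y + C * s * Z) / (c0 / 2 / (12 * K)) := by
        rw [le_div_iff₀ hκ0]; linarith
      refine this.trans (le_of_eq ?_)
      ring
    exact e _ _ _ key
  · intro x hx
    have hx1 := hφs hx
    have hx2 := hsub hx1
    obtain ⟨b1, b2, b3⟩ := hb x hx2
    obtain ⟨v1, v2⟩ := hv2 x hx1
    obtain ⟨t1, t2⟩ := k1 x hx2
    have d2 : ∀ i j, |pd i (pd j (mol m u)) x| ≤ 2 * (lapl (mol m u) x + C₁) := fun i j => by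
      have h1 := abs_le.1 (k4 i j x)
      have h2 := abs_le.1 (b2 i j)
      rw [abs_le]; constructor <;> linarith [h1.1, h1.2, h2.1, h2.2]
    have d1 : ∀ l, |pd l (mol m u) x| ≤ M' := fun l => by
      have h1 := abs_le.1 (k3 l x)
      have h2 := abs_le.1 (b3 l)
      rw [abs_le]; constructor <;> linarith [h1.1, h1.2, h2.1, h2.2]
    have hCM : |C₁| ≤ M' := by rw [abs_of_nonneg hC0]; linarith
    have cF := chain_bounds sF (L := L) (hC.hF.mol_fderiv_le hL.le m)
      (fun e he y => hC.hF.mol_fderiv2_le hL.le m e he y) su x hM0.le hCM (by linarith) rfl d1 d2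
    have cH := fun i j => chain_bounds (sH i j) (L := L) ((hC.hH i j).mol_fderiv_le hL.le m)
      (fun e he y => (hC.hH i j).mol_fderiv2_le hL.le m e he y) su x hM0.le hCM (by linarith) rfl d1 d2
    have hHb : ∀ i j y, |mol m (Hc i j) y| ≤ L := fun i j y =>
      mol_abs_le m (hC.hH i j).cd.continuous y fun z _ => (hC.hH i j).bd _
    set v := lapl (mol m u) x + C₁ with hvd
    have hv0 : 0 < v := by linarith
    have K1 : L * (2 * M' + 2) * v ≤ K * v := mul_le_mul_of_nonneg_right (by rw [hK]; linarith) hv0.le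
    have K3 : K2 * v ^ 2 ≤ K * v ^ 2 := mul_le_mul_of_nonneg_right (by rw [hK]; linarith) (sq_nonneg v)
    have K4 : L ≤ K := by rw [hK]; linarith
    have K5 : L * (1 + M') ≤ K := by rw [hK]; linarith
    simp only [pdv]
    refine ⟨by linarith, t1, ?_, ?_, fun l => (cF.2.2.2.1 l).trans K1, fun i j => (hHb i j _).trans K4, d2,
      fun i j k => ((cH i j).1 k).trans K4, fun l i j k => ((cH i j).2.1 l k).trans K1,
      fun l i j => ((cH i j).2.2.1 l).trans K5, fun i j => ((cH i j).2.2.2.2).trans K3, fun k => (cF.1 k).trans K4,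
      cF.2.2.2.2.trans K3⟩
    · have e : v - ∑ i, Am (mol m u) (fun i j => mol m (Hc i j)) x i i
          = C₁ + ∑ i, mol m (Hc i i) (gam (mol m u) x) := by
        rw [hvd]; unfold Am lapl; rw [Finset.sum_sub_distrib]; ring
      rw [e]
      refine (abs_add_le _ _).trans ?_
      have h1 := abs_sum_le_of fun i => hHb i i (gam (mol m u) x)
      rw [abs_of_nonneg hC0, hK]; linarith
    · have : TT (Am (mol m u) (fun i j => mol m (Hc i j)) x) (Am (mol m u) (fun i j => mol m (Hc i j)) x)
        = (∑ i, Am (mol m u) (fun i j => mol m (Hc i j)) x i i) ^ 2 - fdot (Am (mol m u) (fun i j => mol m (Hc i j)) x) (Am (mol m u) (fun i j => mol m (Hc i j)) x) := by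
        unfold TT ftr; ring
      rw [this] at t2
      exact t2

open MeasureTheory Metric Set Matrix
open scoped ContDiff

section
variable {n : ℕ} {u : (Fin n → ℝ) → ℝ} {Fc : (Fin n → ℝ) × ℝ × (Fin n → ℝ) → ℝ}
    {Hc : Fin n → Fin n → (Fin n → ℝ) × ℝ × (Fin n → ℝ) → ℝ} {L c0 : ℝ} {x₀ : Fin n → ℝ} {R2 : ℝ}

/-- The error term tends to zero. -/
theorem Core.err (hC : Core u Fc Hc L c0 x₀ R2) {ra : ℝ} (hr0 : 0 ≤ ra) (hra : ra < R2) {C₁ s : ℝ} (hs : 0 ≤ s)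
    (hb : ∀ x ∈ ball x₀ R2, 1 ≤ lapl u x + C₁) {φ : (Fin n → ℝ) → ℝ} (hφ : ContDiff ℝ ∞ φ)
    (hφs : tsupport φ ⊆ closedBall x₀ ra) (hφ1 : ∀ x, 0 ≤ φ x ∧ φ x ≤ 1) :
    Filter.Tendsto (fun m : ℕ => ∫ x, φ x ^ 2 * ((lapl (mol m u) x + C₁) ^ s *
            ∑ i, pd i (rq (mol m u) (mol m Fc) fun i j => mol m (Hc i j)) x ^ 2)) Filter.atTop (nhds 0) := by
  have hcp : IsCompact (closedBall x₀ ra) := isCompact_closedBall _ _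
  have hsub : closedBall x₀ ra ⊆ ball x₀ R2 := closedBall_subset_ball hra
  have hlc := lapl_cont hC.hu
  obtain ⟨D, hD⟩ := hcp.exists_bound_of_continuousOn hlc.continuousOn
  set B := max 1 (D + 1 + C₁) with hB
  have hB0 : 0 < B := lt_max_of_lt_left one_pos
  have hBs : 0 < B ^ s := Real.rpow_pos_of_pos hB0 _
  rw [Metric.tendsto_nhds]
  intro ε hε
  have hδ : 0 < ε / (2 * (B ^ s * (n + 1))) := by positivity
  filter_upwards [hC.stage3 hr0 hra hδ, conv_lapl hC.hu hC.hc (show (0:ℝ) < 1 / 2 by norm_num)] with m k1 k2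
  have su : ContDiff ℝ ∞ (mol m u) := mol_smooth m hC.hu.continuous
  have sH : ∀ i j, ContDiff ℝ ∞ (mol m (Hc i j)) := fun i j => mol_smooth m (hC.hH i j).cd.continuous
  have sF : ContDiff ℝ ∞ (mol m Fc) := mol_smooth m hC.hF.cd.continuous
  set r := rq (mol m u) (mol m Fc) fun i j => mol m (Hc i j) with hr
  have cr : ∀ i, Continuous (pd i r) := fun i => (contDiff_pd_top (rq_smooth su sH sF)).continuous
  have cS : Continuous fun x => ∑ i, pd i r x ^ 2 := continuous_finsetSum _ fun i _ => (cr i).pow 2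
  have cv : Continuous fun x => lapl (mol m u) x + C₁ := (lapl_cont (sm_two su)).add continuous_const
  have cvs : Continuous fun x => (lapl (mol m u) x + C₁) ^ s := cv.rpow_const fun x => Or.inr hs
  have z : ∀ x, x ∉ closedBall x₀ ra → φ x ^ 2 * ((lapl (mol m u) x + C₁) ^ s * ∑ i, pd i r x ^ 2) = 0 := fun x hx => by
    rw [image_eq_zero_of_notMem_tsupport fun h => hx (hφs h)]; simp
  have hvb : ∀ x ∈ closedBall x₀ ra, 0 ≤ lapl (mol m u) x + C₁ ∧ lapl (mol m u) x + C₁ ≤ B := fun x hx => by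
    have h1 := abs_le.1 (k2 x)
    have h2 := abs_le.1 (hD x hx)
    have h3 := hb x (hsub hx)
    have h4 : D + 1 + C₁ ≤ B := le_max_right _ _
    constructor <;> linarith [h1.1, h1.2, h2.1, h2.2]
  rw [← setIntegral_eq_integral_of_forall_compl_eq_zero z]
  have hnn : 0 ≤ ∫ x in closedBall x₀ ra, φ x ^ 2 * ((lapl (mol m u) x + C₁) ^ s * ∑ i, pd i r x ^ 2) :=
    setIntegral_nonneg measurableSet_closedBall fun x hx => mul_nonneg (sq_nonneg _)
      (mul_nonneg (Real.rpow_nonneg (hvb x hx).1 _) (Finset.sum_nonneg fun _ _ => sq_nonneg _))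
  rw [Real.dist_eq, sub_zero, abs_of_nonneg hnn]
  have c1 : Continuous fun x => φ x ^ 2 * ((lapl (mol m u) x + C₁) ^ s * ∑ i, pd i r x ^ 2) :=
    (hφ.continuous.pow 2).mul (cvs.mul cS)
  have c2 : Continuous fun x => B ^ s * ∑ i, pd i r x ^ 2 := continuous_const.mul cS
  refine (setIntegral_mono_on (c1.continuousOn.integrableOn_compact hcp) (c2.continuousOn.integrableOn_compact hcp)
    measurableSet_closedBall fun x hx => ?_).trans_lt ?_
  · have h1 : φ x ^ 2 ≤ 1 := pow_le_one₀ (hφ1 x).1 (hφ1 x).2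
    have h2 : (lapl (mol m u) x + C₁) ^ s ≤ B ^ s := Real.rpow_le_rpow (hvb x hx).1 (hvb x hx).2 hs
    have h3 : 0 ≤ ∑ i, pd i r x ^ 2 := Finset.sum_nonneg fun _ _ => sq_nonneg _
    have h4 := mul_le_mul_of_nonneg_right h2 h3
    have h5 := mul_le_mul h1 h4 (mul_nonneg (Real.rpow_nonneg (hvb x hx).1 _) h3) zero_le_one
    rwa [one_mul] at h5
  · have ci : ∀ i, IntegrableOn (fun x => pd i r x ^ 2) (closedBall x₀ ra) := fun i =>
      ((cr i).pow 2).continuousOn.integrableOn_compact hcp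
    rw [integral_const_mul, integral_finsetSum _ fun i _ => ci i]
    have h1 : ∑ i, ∫ x in closedBall x₀ ra, pd i r x ^ 2 ≤ n * (ε / (2 * (B ^ s * (n + 1)))) := by
      refine (Finset.sum_le_sum fun i _ => k1 i).trans (le_of_eq ?_)
      simp
    refine (mul_le_mul_of_nonneg_left h1 hBs.le).trans_lt ?_
    have e : B ^ s * (n * (ε / (2 * (B ^ s * (n + 1))))) = ε * (n / (2 * (n + 1))) := by
      field_simp
    rw [e]
    have : (n:ℝ) / (2 * (n + 1)) < 1 := by
      rw [div_lt_one (by positivity)]; have : (0:ℝ) ≤ n := Nat.cast_nonneg n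
      linarith
    nlinarith
end

set_option maxHeartbeats 1600000 in
/-- Reverse Hölder inequality for globalised data. -/
theorem core_rh (n : ℕ) (hn : 3 ≤ n) (L c0 M R : ℝ) (hL : 0 < L) (hc0 : 0 < c0) (hM : 0 < M) (hR : 0 < R) :
    ∃ C : ℝ, 0 < C ∧ ∀ (u : (Fin n → ℝ) → ℝ) (Fc : (Fin n → ℝ) × ℝ × (Fin n → ℝ) → ℝ)
      (Hc : Fin n → Fin n → (Fin n → ℝ) × ℝ × (Fin n → ℝ) → ℝ) (x₀ : Fin n → ℝ) (C₁ q ρ : ℝ),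
      Core u Fc Hc L c0 x₀ (2 * R) → 0 ≤ C₁ → C₁ ≤ M → 2 ≤ q → 0 < ρ → ρ ≤ R / 3 →
      (∀ x ∈ ball x₀ (2 * R), 1 ≤ lapl u x + C₁ ∧ (∀ i j, |pd i (pd j u) x| ≤ lapl u x + C₁) ∧ ∀ l, |pd l u x| ≤ M) →
      (∫ x in ball x₀ (2 * R), (lapl u x + C₁) ^ ((3 : ℝ) * n / 2)) ≤ M →
      (∫ x in ball x₀ (R + ρ), (lapl u x + C₁) ^ (((3 : ℝ) * n / ((3 : ℝ) * n - 4)) * q))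
            ^ (((3 : ℝ) * n / ((3 : ℝ) * n - 4))⁻¹)
        ≤ C * q / ρ ^ 2 * ∫ x in ball x₀ (R + 3 * ρ), (lapl u x + C₁) ^ (q + 2) := by
  have hn' : (3:ℝ) ≤ n := by exact_mod_cast hn
  obtain ⟨Cs, hCs, hsob⟩ := sob_weighted n hn
  obtain ⟨Cg, hCg, hgrad⟩ := rh_grad n hn L c0 M hL hc0 hM
  obtain ⟨Cc, hCc, hcut⟩ := cutoff n
  set β := (3:ℝ) * n / ((3:ℝ) * n - 4) with hβ
  have h4 : (0:ℝ) < 3 * n - 4 := by linarith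
  have hβ0 : 0 < β := by rw [hβ]; positivity
  set P := M ^ (2 * ((3:ℝ) * n)⁻¹) with hP
  have hP0 : 0 < P := Real.rpow_pos_of_pos hM _
  set W := R ^ 2 + n * Cc ^ 2 with hW
  have hW0 : 0 < W := by positivity
  refine ⟨Cs * P * ((1 + 2 * Cg) * W), by positivity, ?_⟩
  intro u Fc Hc x₀ C₁ q ρ hC hC0 hC1 hq hρ hρR hb hintgr
  obtain ⟨φ, hφ, hφc, hφs, hφ1, hφ01, hφd⟩ := hcut x₀ (R + ρ) ρ (by linarith) hρ
  set ra := R + ρ + ρ with hra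
  have hra0 : 0 ≤ ra := by rw [hra]; linarith
  have hra2 : ra < 2 * R := by rw [hra]; linarith
  have hsub : closedBall x₀ ra ⊆ ball x₀ (2 * R) := closedBall_subset_ball hra2
  have hcp : IsCompact (closedBall x₀ ra) := isCompact_closedBall _ _
  set s := q - 1 with hs
  have hs1 : 1 ≤ s := by rw [hs]; linarith
  set v := fun x => lapl u x + C₁ with hv
  have cv : Continuous v := (lapl_cont hC.hu).add continuous_const
  set vj := fun (m : ℕ) x => lapl (mol m u) x + C₁ with hvj
  have su : ∀ m, ContDiff ℝ ∞ (mol m u) := fun m => mol_smooth m hC.hu.continuous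
  have svj : ∀ m, ContDiff ℝ ∞ (vj m) := fun m => by
    have : ContDiff ℝ ∞ fun x => ∑ l, pd l (pd l (mol m u)) x := sm_sum fun l => contDiff_pd_top (contDiff_pd_top (su m))
    exact this.add contDiff_const
  have cvj : ∀ m, Continuous (vj m) := fun m => (svj m).continuous
  have hlim : ∀ δ, 0 < δ → ∀ᶠ j : ℕ in Filter.atTop, ∀ x, |vj j x - v x| ≤ δ := fun δ hδ => by
    filter_upwards [conv_lapl hC.hu hC.hc hδ] with j hj x
    have := hj x
    simp only [hvj, hv]
    rwa [add_sub_add_right_eq_sub]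
  have cpow : ∀ p : ℝ, 0 ≤ p → Continuous fun t : ℝ => t ^ p := fun p hp => Real.continuous_rpow_const hp
  -- weights
  set w1 := fun x => (φ x ^ 2) ^ β with hw1
  set w2 := fun x => ∑ i, pd i φ x ^ 2 with hw2
  set w3 := fun x => φ x ^ 2 + ∑ i, pd i φ x ^ 2 with hw3
  have cφi : ∀ i, Continuous (pd i φ) := fun i => (contDiff_pd_top hφ).continuous
  have cw1 : Continuous w1 := (hφ.continuous.pow 2).rpow_const fun x => Or.inr hβ0.le
  have cw2 : Continuous w2 := continuous_finsetSum _ fun i _ => (cφi i).pow 2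
  have cw3 : Continuous w3 := (hφ.continuous.pow 2).add cw2
  have zφ : ∀ x, x ∉ closedBall x₀ ra → φ x = 0 := fun x hx => image_eq_zero_of_notMem_tsupport fun h => hx (hφs h)
  have zw1 : ∀ x, x ∉ closedBall x₀ ra → w1 x = 0 := fun x hx => by
    simp only [hw1]; rw [zφ x hx]; simp [Real.zero_rpow hβ0.ne']
  have zw2 : ∀ x, x ∉ closedBall x₀ ra → w2 x = 0 := fun x hx => by
    simp only [hw2]
    exact Finset.sum_eq_zero fun i _ => by rw [pd_eq_zero_of_notMem fun h => hx (hφs h)]; simp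
  have zw3 : ∀ x, x ∉ closedBall x₀ ra → w3 x = 0 := fun x hx => by
    have := zw2 x hx
    simp only [hw2] at this
    simp only [hw3]; rw [zφ x hx, this]; simp
  have tofull : ∀ (w g : (Fin n → ℝ) → ℝ), (∀ x, x ∉ closedBall x₀ ra → w x = 0) →
      ∫ x in closedBall x₀ ra, w x * g x = ∫ x, w x * g x := fun w g hw =>
    setIntegral_eq_integral_of_forall_compl_eq_zero fun x hx => by rw [hw x hx, zero_mul]
  -- limits
  have hβq : 0 ≤ β * q := by positivity
  have l1 := lim_int hcp cw1 cv cvj (cpow (β * q) hβq) hlim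
  have l2 := lim_int hcp cw2 cv cvj (cpow (q - 1) (by linarith)) hlim
  have l3 := lim_int hcp cw3 cv cvj (Ψ := fun t => t ^ s * t ^ 3) ((cpow s (by linarith)).mul (continuous_pow 3)) hlim
  have l4 := lim_int (S := tsupport φ) hφc cw1 cv cvj (cpow (β * q) hβq) hlim
  have l5 := lim_int (S := tsupport φ) (w := fun _ => 1) hφc continuous_const cv cvj (cpow ((3:ℝ) * n / 2) (by positivity)) hlim
  simp only [one_mul] at l5
  have l6 := hC.err hra0 hra2 (s := s) (by linarith) (fun x hx => (hb x hx).1) hφ hφs hφ01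
  have hev : ∀ᶠ m : ℕ in Filter.atTop,
      (∫ x in closedBall x₀ ra, w1 x * vj m x ^ (β * q)) ^ β⁻¹ ≤
        Cs * (∫ x in tsupport φ, vj m x ^ ((3:ℝ) * n / 2)) ^ (2 * ((3:ℝ) * n)⁻¹) *
          ((∫ x in closedBall x₀ ra, w2 x * vj m x ^ (q - 1)) + 2 * q * (Cg * (∫ x in closedBall x₀ ra, w3 x * (vj m x ^ s * vj m x ^ 3))
            + Cg * s * ∫ x, φ x ^ 2 * ((lapl (mol m u) x + C₁) ^ s *
            ∑ i, pd i (rq (mol m u) (mol m Fc) fun i j => mol m (Hc i j)) x ^ 2))) := by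
    filter_upwards [hgrad u Fc Hc x₀ (2 * R) ra C₁ s φ hC hC0 hC1 hs1 hra2 hb hφ hφc hφs] with m ⟨k1, k2⟩
    have hpos : ∀ x ∈ tsupport φ, 0 < vj m x := fun x hx => by
      have := k1 x (hφs hx); simp only [hvj]; linarith
    rw [tofull w1 _ zw1, tofull w2 _ zw2, tofull w3 _ zw3]
    refine (hsob φ (vj m) q (by linarith) hφ hφc (svj m) hpos).trans ?_
    have hb0 : 0 ≤ ∫ x in tsupport φ, vj m x ^ ((3:ℝ) * n / 2) :=
      setIntegral_nonneg hφc.isCompact.measurableSet fun x hx => Real.rpow_nonneg (hpos x hx).le _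
    refine mul_le_mul_of_nonneg_left (add_le_add le_rfl ?_) (mul_nonneg hCs.le (Real.rpow_nonneg hb0 _))
    set I := ∫ x, φ x ^ 2 * (vj m x ^ (q - 1) * ∑ i, (pd i (vj m) x / vj m x) ^ 2) with hI
    have hI0 : 0 ≤ I := by
      rw [hI, ← setIntegral_eq_integral_of_forall_compl_eq_zero (s := tsupport φ) fun x hx => by
        rw [image_eq_zero_of_notMem_tsupport hx]; simp]
      exact setIntegral_nonneg hφc.isCompact.measurableSet fun x hx => mul_nonneg (sq_nonneg _)
        (mul_nonneg (Real.rpow_nonneg (hpos x hx).le _) (Finset.sum_nonneg fun _ _ => sq_nonneg _))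
    have k3 := mul_le_mul_of_nonneg_left k2 (show 0 ≤ 2 * q by linarith)
    refine le_trans ?_ k3
    have : q ^ 2 ≤ 2 * q * s := by rw [hs]; nlinarith
    have := mul_le_mul_of_nonneg_right this hI0
    calc _ ≤ _ := this
      _ = 2 * q * (s * I) := by ring
  have hlimit := le_of_tendsto_of_tendsto (l1.rpow_const (p := β⁻¹) (Or.inr (inv_pos.2 hβ0).le))
    (((l5.rpow_const (p := 2 * ((3:ℝ) * n)⁻¹) (Or.inr (by positivity))).const_mul Cs).mul
      (l2.add (((l3.const_mul Cg).add (l6.const_mul (Cg * s))).const_mul (2 * q)))) hev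
  rw [mul_zero, add_zero] at hlimit
  -- comparison
  have hv1 : ∀ x ∈ closedBall x₀ ra, 1 ≤ v x := fun x hx => (hb x (hsub hx)).1
  have cint : ∀ (p : ℝ), 0 ≤ p → ∀ r, IntegrableOn (fun x => v x ^ p) (ball x₀ r) := fun p hp r =>
    (((cpow p hp).comp cv).continuousOn.integrableOn_compact (isCompact_closedBall x₀ r)).mono_set ball_subset_closedBall
  have cintc : ∀ (p : ℝ), 0 ≤ p → IntegrableOn (fun x => v x ^ p) (closedBall x₀ ra) := fun p hp =>
    (((cpow p hp).comp cv).continuousOn.integrableOn_compact hcp)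
  have m1 : ∫ x in ball x₀ (R + ρ), v x ^ (β * q) ≤ ∫ x in closedBall x₀ ra, w1 x * v x ^ (β * q) := by
    have hss : ball x₀ (R + ρ) ⊆ closedBall x₀ ra := ball_subset_closedBall.trans (closedBall_subset_closedBall (by rw [hra]; linarith))
    have e : ∫ x in ball x₀ (R + ρ), v x ^ (β * q) = ∫ x in ball x₀ (R + ρ), w1 x * v x ^ (β * q) := by
      refine setIntegral_congr_fun measurableSet_ball fun x hx => ?_
      simp only [hw1]
      rw [hφ1 x (ball_subset_closedBall hx)]; simp
    rw [e]
    refine setIntegral_mono_set ((cw1.mul ((cpow _ hβq).comp cv)).continuousOn.integrableOn_compact hcp) ?_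
      (Filter.Eventually.of_forall hss)
    refine (ae_restrict_iff' measurableSet_closedBall).2 (Filter.Eventually.of_forall fun x hx => ?_)
    exact mul_nonneg (Real.rpow_nonneg (sq_nonneg _) _) (Real.rpow_nonneg (by linarith [hv1 x hx]) _)
  have m1' : (0:ℝ) ≤ ∫ x in ball x₀ (R + ρ), v x ^ (β * q) := by
    refine setIntegral_nonneg measurableSet_ball fun x hx => Real.rpow_nonneg ?_ _
    have := (hb x (ball_subset_ball (by linarith) hx)).1
    simp only [hv]; linarith
  have m2 : ∫ x in tsupport φ, v x ^ ((3:ℝ) * n / 2) ≤ M := by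
    refine le_trans (setIntegral_mono_set (cint _ (by positivity) _) ?_ (Filter.Eventually.of_forall (hφs.trans hsub))) hintgr
    refine (ae_restrict_iff' measurableSet_ball).2 (Filter.Eventually.of_forall fun x hx => ?_)
    have := (hb x hx).1
    exact Real.rpow_nonneg (by simp only [hv]; linarith) _
  have m2' : 0 ≤ ∫ x in tsupport φ, v x ^ ((3:ℝ) * n / 2) :=
    setIntegral_nonneg hφc.isCompact.measurableSet fun x hx => Real.rpow_nonneg (by linarith [hv1 x (hφs hx)]) _
  set X := ∫ x in closedBall x₀ ra, v x ^ (q + 2) with hX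
  have hX0 : 0 ≤ X := setIntegral_nonneg measurableSet_closedBall fun x hx => Real.rpow_nonneg (by linarith [hv1 x hx]) _
  have mX : X ≤ ∫ x in ball x₀ (R + 3 * ρ), v x ^ (q + 2) := by
    refine setIntegral_mono_set (cint _ (by linarith) _) ?_ (Filter.Eventually.of_forall (closedBall_subset_ball (by rw [hra]; linarith)))
    refine (ae_restrict_iff' measurableSet_ball).2 (Filter.Eventually.of_forall fun x hx => ?_)
    have := (hb x (ball_subset_ball (by linarith) hx)).1
    exact Real.rpow_nonneg (by simp only [hv]; linarith) _
  have bw2 : ∀ x, w2 x ≤ n * (Cc / ρ) ^ 2 := fun x => by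
    have : ∀ i ∈ (Finset.univ : Finset (Fin n)), pd i φ x ^ 2 ≤ (Cc / ρ) ^ 2 := fun i _ => by
      rw [← sq_abs]; exact pow_le_pow_left₀ (abs_nonneg _) (hφd i x) 2
    refine (Finset.sum_le_sum this).trans (le_of_eq ?_)
    simp
  have bw3' : ∀ x, w3 x ≤ W / ρ ^ 2 := fun x => by
    have h1 := bw2 x
    have h2 : φ x ^ 2 ≤ 1 := pow_le_one₀ (hφ01 x).1 (hφ01 x).2
    have h3 : 1 ≤ R ^ 2 / ρ ^ 2 := by
      rw [one_le_div (by positivity)]; nlinarith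
    have e : W / ρ ^ 2 = R ^ 2 / ρ ^ 2 + n * (Cc / ρ) ^ 2 := by rw [hW]; field_simp
    rw [e]
    simp only [hw3]; simp only [hw2] at h1; linarith
  have bw2' : ∀ x, w2 x ≤ W / ρ ^ 2 := fun x => by
    refine le_trans ?_ (bw3' x)
    simp only [hw2, hw3]; nlinarith [sq_nonneg (φ x)]
  have nw2 : ∀ x, 0 ≤ w2 x := fun x => Finset.sum_nonneg fun _ _ => sq_nonneg _
  have hWρ : 0 ≤ W / ρ ^ 2 := by positivity
  have m3 : ∫ x in closedBall x₀ ra, w2 x * v x ^ (q - 1) ≤ W / ρ ^ 2 * X := by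
    rw [hX, ← integral_const_mul]
    refine setIntegral_mono_on ((cw2.mul ((cpow _ (by linarith)).comp cv)).continuousOn.integrableOn_compact hcp)
      ((cintc _ (by linarith)).const_mul _) measurableSet_closedBall fun x hx => ?_
    have h1 := hv1 x hx
    exact mul_le_mul (bw2' x) (Real.rpow_le_rpow_of_exponent_le h1 (by linarith)) (Real.rpow_nonneg (by linarith) _) hWρ
  have m4 : ∫ x in closedBall x₀ ra, w3 x * (v x ^ s * v x ^ 3) ≤ W / ρ ^ 2 * X := by
    rw [hX, ← integral_const_mul]
    have c3 : Continuous fun x => w3 x * (v x ^ s * v x ^ 3) :=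
      cw3.mul (((cpow s (by linarith)).comp cv).mul (cv.pow 3))
    refine setIntegral_mono_on (c3.continuousOn.integrableOn_compact hcp)
      ((cintc _ (by linarith)).const_mul _) measurableSet_closedBall fun x hx => ?_
    have h1 := hv1 x hx
    have e : v x ^ s * v x ^ 3 = v x ^ (q + 2) := by
      rw [← Real.rpow_natCast, ← Real.rpow_add (by linarith)]; congr 1; rw [hs]; push_cast; ring
    rw [e]
    exact mul_le_mul_of_nonneg_right (bw3' x) (Real.rpow_nonneg (by linarith) _)
  have f1 := Real.rpow_le_rpow m1' m1 (inv_pos.2 hβ0).le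
  have f2 : (∫ x in tsupport φ, v x ^ ((3:ℝ) * n / 2)) ^ (2 * ((3:ℝ) * n)⁻¹) ≤ P :=
    Real.rpow_le_rpow m2' m2 (by positivity)
  have f3 : (∫ x in closedBall x₀ ra, w2 x * v x ^ (q - 1)) + 2 * q * (Cg * ∫ x in closedBall x₀ ra, w3 x * (v x ^ s * v x ^ 3))
      ≤ (1 + 2 * Cg) * W * q / ρ ^ 2 * X := by
    have g1 := mul_le_mul_of_nonneg_left m4 (show 0 ≤ 2 * q * Cg by positivity)
    have g2 : W / ρ ^ 2 * X ≤ q * (W / ρ ^ 2 * X) := le_mul_of_one_le_left (by positivity) (by linarith)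
    have e : (1 + 2 * Cg) * W * q / ρ ^ 2 * X = q * (W / ρ ^ 2 * X) + 2 * q * Cg * (W / ρ ^ 2 * X) := by ring
    rw [e]; linarith
  have f4 : 0 ≤ (1 + 2 * Cg) * W * q / ρ ^ 2 * X := by positivity
  have g1 : Cs * (∫ x in tsupport φ, v x ^ ((3:ℝ) * n / 2)) ^ (2 * ((3:ℝ) * n)⁻¹) ≤ Cs * P := mul_le_mul_of_nonneg_left f2 hCs.le
  have g0 : 0 ≤ Cs * (∫ x in tsupport φ, v x ^ ((3:ℝ) * n / 2)) ^ (2 * ((3:ℝ) * n)⁻¹) := mul_nonneg hCs.le (Real.rpow_nonneg m2' _)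
  have g2 := (mul_le_mul_of_nonneg_left f3 g0).trans (mul_le_mul_of_nonneg_right g1 f4)
  have g3 := f1.trans (hlimit.trans g2)
  refine g3.trans ?_
  have e : Cs * P * ((1 + 2 * Cg) * W * q / ρ ^ 2 * X) = Cs * P * ((1 + 2 * Cg) * W) * q / ρ ^ 2 * X := by ring
  rw [e]
  exact mul_le_mul_of_nonneg_left mX (by positivity)

open MeasureTheory Metric Set Matrix
open scoped ContDiff

theorem abs_entry_le_matNorm {n : ℕ} (A : Matrix (Fin n) (Fin n) ℝ) (i j : Fin n) : |A i j| ≤ matNorm A := by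
  have h1 := (LinearMap.toContinuousLinearMap (Matrix.toEuclideanLin A)).le_opNorm (EuclideanSpace.single j (1:ℝ))
  rw [EuclideanSpace.norm_single, norm_one, mul_one] at h1
  have h2 := PiLp.norm_apply_le (LinearMap.toContinuousLinearMap (Matrix.toEuclideanLin A) (EuclideanSpace.single j (1:ℝ))) i
  have e : (LinearMap.toContinuousLinearMap (Matrix.toEuclideanLin A) (EuclideanSpace.single j (1:ℝ))) i = A i j := by
    simp [Matrix.toEuclideanLin_apply]
  rw [e] at h2
  exact h2.trans h1

theorem abs_le_vnorm {n : ℕ} (ξ : Fin n → ℝ) (i : Fin n) : |ξ i| ≤ vnorm ξ := by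
  unfold vnorm
  refine Real.abs_le_sqrt ?_
  exact Finset.single_le_sum (f := fun i => ξ i ^ 2) (fun _ _ => sq_nonneg _) (Finset.mem_univ i)

/-- Cutoff in jet space. -/
theorem jet_cut {n : ℕ} (Ω : Set (Fin n → ℝ)) (hΩ : IsOpen Ω) (x₀ : Fin n → ℝ) {r M : ℝ} (hr : 0 ≤ r) (hM : 0 ≤ M)
    (hb : closedBall x₀ r ⊆ Ω) :
    ∃ (ψ : (Fin n → ℝ) → ℝ) (χ : (Fin n → ℝ) × ℝ × (Fin n → ℝ) → ℝ),
      ContDiff ℝ ∞ ψ ∧ HasCompactSupport ψ ∧ tsupport ψ ⊆ Ω ∧ (∀ x ∈ closedBall x₀ r, ψ x = 1) ∧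
      ContDiff ℝ ∞ χ ∧ HasCompactSupport χ ∧ tsupport χ ⊆ Ω ×ˢ ((univ : Set ℝ) ×ˢ (univ : Set (Fin n → ℝ))) ∧
      ∀ x z ξ, x ∈ closedBall x₀ r → |z| ≤ M → (∀ i, |ξ i| ≤ M) → χ (x, z, ξ) = 1 := by
  obtain ⟨δ, hδ, hsub⟩ := (isCompact_closedBall x₀ r).exists_cthickening_subset_open hΩ hb
  rw [cthickening_closedBall hδ.le hr] at hsub
  obtain ⟨C, -, hcut⟩ := cutoff n
  obtain ⟨C', -, hcut'⟩ := cutoff 1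
  obtain ⟨ψ, a1, a2, a3, a4, -, -⟩ := hcut x₀ r δ hr hδ
  obtain ⟨ψ2, b1, b2, b3, b4, -, -⟩ := hcut 0 M 1 hM one_pos
  obtain ⟨ψ3, d1, d2, d3, d4, -, -⟩ := hcut' 0 M 1 hM one_pos
  have hcontr : ∀ x, ψ x ≠ 0 → x ∈ closedBall x₀ (δ + r) := fun x hx => by
    have := a3 (subset_tsupport _ hx); rwa [add_comm] at this
  set χ : (Fin n → ℝ) × ℝ × (Fin n → ℝ) → ℝ := fun y => ψ y.1 * (ψ3 (fun _ => y.2.1) * ψ2 y.2.2) with hχ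
  set Kc : Set ((Fin n → ℝ) × ℝ × (Fin n → ℝ)) := closedBall x₀ (δ + r) ×ˢ (closedBall (0:ℝ) (M + 1) ×ˢ closedBall 0 (M + 1)) with hKc
  have hKcomp : IsCompact Kc := (isCompact_closedBall _ _).prod ((isCompact_closedBall _ _).prod (isCompact_closedBall _ _))
  have hsup : Function.support χ ⊆ Kc := fun y hy => by
    have h1 : ψ y.1 ≠ 0 := fun h => hy (by simp [hχ, h])
    have h2 : ψ3 (fun _ => y.2.1) ≠ 0 := fun h => hy (by simp [hχ, h])
    have h3 : ψ2 y.2.2 ≠ 0 := fun h => hy (by simp [hχ, h])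
    refine ⟨hcontr _ h1, ?_, b3 (subset_tsupport _ h3)⟩
    have := d3 (subset_tsupport _ h2)
    rw [mem_closedBall_zero_iff] at this ⊢
    exact (norm_le_pi_norm (fun _ : Fin 1 => y.2.1) 0).trans this
  have htsup : tsupport χ ⊆ Kc := closure_minimal hsup hKcomp.isClosed
  refine ⟨ψ, χ, a1, a2, fun x hx => hsub (by have := a3 hx; rwa [add_comm] at this), a4, ?_,
    HasCompactSupport.of_support_subset_isCompact hKcomp hsup, fun y hy => ⟨hsub (htsup hy).1, mem_univ _, mem_univ _⟩, ?_⟩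
  · have p : ContDiff ℝ ∞ fun y : (Fin n → ℝ) × ℝ × (Fin n → ℝ) => (fun _ : Fin 1 => y.2.1) :=
      contDiff_pi.2 fun _ => contDiff_fst.comp contDiff_snd
    exact (a1.comp contDiff_fst).mul ((d1.comp p).mul (b1.comp (contDiff_snd.comp contDiff_snd)))
  · intro x z ξ hx hz hξ
    simp only [hχ]
    rw [a4 x hx, d4 _ ?_, b4 ξ ?_]
    · norm_num
    · rw [mem_closedBall_zero_iff]; exact (pi_norm_le_iff_of_nonneg hM).2 hξ
    · rw [mem_closedBall_zero_iff]; exact (pi_norm_le_iff_of_nonneg hM).2 fun _ => hz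

/-- Reverse Hölder inequality for `k = 2` with general `H`
(estimate (AB') in the proof of Theorem 1.6 for classical solutions). -/
theorem reverse_holder_k2_generalH
    {n : ℕ} (hn : 3 ≤ n)
    (Ω : Set (Fin n → ℝ)) (hΩ : IsOpen Ω)
    (f : ((Fin n → ℝ) × ℝ × (Fin n → ℝ)) → ℝ)
    (hfpos : ∀ y ∈ Ω ×ˢ ((univ : Set ℝ) ×ˢ (univ : Set (Fin n → ℝ))), 0 < f y)
    (hf : C11On f (Ω ×ˢ ((univ : Set ℝ) ×ˢ (univ : Set (Fin n → ℝ)))))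
    (H : ((Fin n → ℝ) × ℝ × (Fin n → ℝ)) → Matrix (Fin n) (Fin n) ℝ)
    (hH : ∀ i j : Fin n,
      C11On (fun y => H y i j) (Ω ×ˢ ((univ : Set ℝ) ×ˢ (univ : Set (Fin n → ℝ)))))
    (hHsymm : ∀ y ∈ Ω ×ˢ ((univ : Set ℝ) ×ˢ (univ : Set (Fin n → ℝ))), (H y).IsSymm)
    (x₀ : Fin n → ℝ) (R : ℝ) (hR : 0 < R)
    (hball : closure (ball x₀ (2 * R)) ⊆ Ω)
    (M : ℝ) (hM : 0 < M) :
    ∃ C : ℝ, ∀ (u : (Fin n → ℝ) → ℝ) (C₁ q ρ : ℝ),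
      ContDiffOn ℝ 2 u Ω →
      (∀ x ∈ Ω,
        esymmMat 2 (hess u x - H (x, u x, grad u x)) = f (x, u x, grad u x) ^ 2 ∧
        GammaPlus 2 (hess u x - H (x, u x, grad u x))) →
      0 ≤ C₁ → C₁ ≤ M →
      (∀ x ∈ ball x₀ (2 * R), 1 ≤ lapl u x + C₁ ∧ matNorm (hess u x) ≤ lapl u x + C₁) →
      (∀ x ∈ ball x₀ (2 * R), |u x| + vnorm (grad u x) ≤ M) →
      (∫ x in ball x₀ (2 * R), (lapl u x + C₁) ^ ((3 : ℝ) * n / 2)) ≤ M →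
      (3 : ℝ) * n / 2 - 2 < q →
      0 < ρ → ρ ≤ R / 3 →
      (∫ x in ball x₀ (R + ρ),
          (lapl u x + C₁) ^ (((3 : ℝ) * n / ((3 : ℝ) * n - 4)) * q))
            ^ (((3 : ℝ) * n / ((3 : ℝ) * n - 4))⁻¹)
        ≤ C * q / ρ ^ 2 *
            ∫ x in ball x₀ (R + 3 * ρ), (lapl u x + C₁) ^ (q + 2) := by
  have h2R : (0:ℝ) < 2 * R := by linarith
  rw [closure_ball x₀ h2R.ne'] at hball
  set S : Set ((Fin n → ℝ) × ℝ × (Fin n → ℝ)) := Ω ×ˢ ((univ : Set ℝ) ×ˢ (univ : Set (Fin n → ℝ))) with hS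
  have hSo : IsOpen S := hΩ.prod (isOpen_univ.prod isOpen_univ)
  obtain ⟨ψ, χ, ψs, ψc, ψt, ψ1, χs, χc, χt, χ1⟩ := jet_cut Ω hΩ x₀ h2R.le hM.le hball
  set Fc : (Fin n → ℝ) × ℝ × (Fin n → ℝ) → ℝ := fun y => (χ y * f y) * (χ y * f y) with hFc
  set Hc : Fin n → Fin n → (Fin n → ℝ) × ℝ × (Fin n → ℝ) → ℝ := fun i j y => χ y * H y i j with hHc
  obtain ⟨L0, hL0, hF0⟩ := C11At.globalize (G := Fc)
    (fun y => (C11At.cut hSo hf χs χt y).mul (C11At.cut hSo hf χs χt y)) (χc.mul_right.mul_right)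
  have hHg : ∀ i j, ∃ L, 0 < L ∧ C11c (Hc i j) L := fun i j =>
    C11At.globalize (fun y => C11At.cut hSo (hH i j) χs χt y) χc.mul_right
  choose Lh hLh hHh using hHg
  set L := L0 + ∑ i, ∑ j, Lh i j with hL
  have hLs : 0 ≤ ∑ i, ∑ j, Lh i j := Finset.sum_nonneg fun i _ => Finset.sum_nonneg fun j _ => (hLh i j).le
  have hLL : ∀ i j, Lh i j ≤ L := fun i j => by
    have h1 := Finset.single_le_sum (f := fun j => Lh i j) (fun j _ => (hLh i j).le) (Finset.mem_univ j)
    have h2 := Finset.single_le_sum (f := fun i => ∑ j, Lh i j) (fun i _ => Finset.sum_nonneg fun j _ => (hLh i j).le) (Finset.mem_univ i)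
    rw [hL]; linarith
  set Kc : Set ((Fin n → ℝ) × ℝ × (Fin n → ℝ)) := closedBall x₀ (2 * R) ×ˢ (closedBall (0:ℝ) M ×ˢ closedBall 0 M) with hKc
  have hKcomp : IsCompact Kc := (isCompact_closedBall _ _).prod ((isCompact_closedBall _ _).prod (isCompact_closedBall _ _))
  have hKS : Kc ⊆ S := fun y hy => ⟨hball hy.1, mem_univ _, mem_univ _⟩
  have hKne : Kc.Nonempty := ⟨(x₀, 0, 0), mem_closedBall_self h2R.le, mem_closedBall_self hM.le, mem_closedBall_self hM.le⟩
  obtain ⟨y0, hy0, hmin⟩ := hKcomp.exists_isMinOn hKne (hf.1.continuousOn.mono hKS)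
  have hy0p := hfpos y0 (hKS hy0)
  obtain ⟨C, hC, hmain⟩ := core_rh n hn L (f y0 ^ 2) M R (by rw [hL]; linarith) (by positivity) hM hR
  refine ⟨C, ?_⟩
  intro u C₁ q ρ hu heq hC0 hC1 hv hbd hintgr hq hρ hρR
  set w : (Fin n → ℝ) → ℝ := fun x => ψ x * u x with hw
  have hBΩ : ball x₀ (2 * R) ⊆ Ω := ball_subset_closedBall.trans hball
  have huat : ∀ x ∈ Ω, ContDiffAt ℝ 2 u x := fun x hx => hu.contDiffAt (hΩ.mem_nhds hx)
  have hwcd : ContDiff ℝ 2 w := contDiff_mul_tsupport (contDiff_infty.1 ψs 2) fun x hx => huat x (ψt hx)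
  have hwc : HasCompactSupport w := ψc.mul_right
  have w0 : ∀ x ∈ ball x₀ (2 * R), w x = u x := fun x hx => by
    simp only [hw]; rw [ψ1 x (ball_subset_closedBall hx), one_mul]
  have w0e : ∀ x ∈ ball x₀ (2 * R), w =ᶠ[nhds x] u := fun x hx => by
    filter_upwards [isOpen_ball.mem_nhds hx] with y hy using w0 y hy
  have w1 : ∀ i, ∀ x ∈ ball x₀ (2 * R), pd i w x = pd i u x := fun i x hx => pd_congr_of_eventuallyEq (w0e x hx)
  have w2 : ∀ i j, ∀ x ∈ ball x₀ (2 * R), pd i (pd j w) x = pd i (pd j u) x := fun i j x hx => by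
    refine pd_congr_of_eventuallyEq ?_
    filter_upwards [isOpen_ball.mem_nhds hx] with y hy using w1 j y hy
  have wl : ∀ x ∈ ball x₀ (2 * R), lapl w x = lapl u x := fun x hx => by
    unfold lapl; exact Finset.sum_congr rfl fun l _ => w2 l l x hx
  have wg : ∀ x ∈ ball x₀ (2 * R), gam w x = (x, u x, grad u x) := fun x hx => by
    unfold gam grad; rw [w0 x hx]; congr 2; funext m; exact w1 m x hx
  have hgb : ∀ x ∈ ball x₀ (2 * R), |u x| ≤ M ∧ ∀ l, |pd l u x| ≤ M := fun x hx => by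
    have h := hbd x hx
    have hu0 : 0 ≤ vnorm (grad u x) := Real.sqrt_nonneg _
    refine ⟨by linarith, fun l => ?_⟩
    have h2 := abs_le_vnorm (grad u x) l
    have h3 : |pd l u x| ≤ vnorm (grad u x) := h2
    linarith [abs_nonneg (u x)]
  have wχ : ∀ x ∈ ball x₀ (2 * R), χ (x, u x, grad u x) = 1 := fun x hx =>
    χ1 _ _ _ (ball_subset_closedBall hx) (hgb x hx).1 (hgb x hx).2
  have wA : ∀ x ∈ ball x₀ (2 * R), Am w Hc x = fun i j => (hess u x - H (x, u x, grad u x)) i j := fun x hx => by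
    funext i j
    simp only [Am, hHc]
    rw [wg x hx, wχ x hx, w2 i j x hx, one_mul]
    rfl
  have wF : ∀ x ∈ ball x₀ (2 * R), Fc (gam w x) = f (x, u x, grad u x) ^ 2 := fun x hx => by
    simp only [hFc]
    rw [wg x hx, wχ x hx]; ring
  have hcore : Core w Fc Hc L (f y0 ^ 2) x₀ (2 * R) := by
    refine ⟨hwcd, hwc, hF0.mono (by rw [hL]; linarith), fun i j => (hHh i j).mono (hLL i j), fun i j => ?_,
      by positivity, by rw [hL]; linarith, fun x hx => ?_, fun x hx => ?_, fun x hx => ?_⟩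
    · funext y
      simp only [hHc]
      by_cases hy : y ∈ tsupport χ
      · rw [(hHsymm y (χt hy)).apply j i]
      · rw [image_eq_zero_of_notMem_tsupport hy, zero_mul, zero_mul]
    · rw [wA x hx, wF x hx]
      have hs : ∀ i j, (hess u x - H (x, u x, grad u x)) i j = (hess u x - H (x, u x, grad u x)) j i := fun i j => by
        have h1 : pd i (pd j u) x = pd j (pd i u) x := pd_comm_at (huat x (hBΩ hx))
        have h2 := (hHsymm (x, u x, grad u x) ⟨hBΩ hx, mem_univ _, mem_univ _⟩).apply j i
        simp only [Matrix.sub_apply, hess, Matrix.of_apply]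
        rw [h1, h2]
      have e := esymmMat_two hn _ hs
      rw [(heq x (hBΩ hx)).1] at e
      rw [e]
      unfold TT ftr fdot
      simp only [sq]
    · rw [wA x hx]
      have := (heq x (hBΩ hx)).2 1 le_rfl (by norm_num)
      rw [esymmMat_one hn] at this
      exact this
    · rw [wF x hx]
      have hk : (x, u x, grad u x) ∈ Kc := ⟨ball_subset_closedBall hx,
        mem_closedBall_zero_iff.2 (hgb x hx).1, mem_closedBall_zero_iff.2 ((pi_norm_le_iff_of_nonneg hM.le).2 (hgb x hx).2)⟩
      exact pow_le_pow_left₀ hy0p.le (hmin hk) 2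
  have hcongr : ∀ (r p : ℝ), r ≤ 2 * R →
      ∫ x in ball x₀ r, (lapl w x + C₁) ^ p = ∫ x in ball x₀ r, (lapl u x + C₁) ^ p := fun r p hr =>
    setIntegral_congr_fun measurableSet_ball fun x hx => by
      show (lapl w x + C₁) ^ p = (lapl u x + C₁) ^ p; rw [wl x (ball_subset_ball hr hx)]
  have hn' : (3:ℝ) ≤ n := by exact_mod_cast hn
  have key := hmain w Fc Hc x₀ C₁ q ρ hcore hC0 hC1 (by linarith) hρ hρR (fun x hx => ?_)
    (by rw [hcongr _ _ le_rfl]; exact hintgr)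
  · rw [hcongr _ _ (by linarith), hcongr _ _ (by linarith)] at key
    exact key
  · rw [wl x hx]
    refine ⟨(hv x hx).1, fun i j => ?_, fun l => ?_⟩
    · rw [w2 i j x hx]; exact (abs_entry_le_matNorm (hess u x) i j).trans (hv x hx).2
    · rw [w1 l x hx]; exact (hgb x hx).2 l
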